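/- Let p = 2n or p = 2n/(2n-1) for some positive integer n, and let p* = max{p, p/(p-1)}. Then for every sequence (a_n) in ℓ^p(ℤ) one has ‖(𝓡 a_n)‖_p ≤ cot(π/(2p*)) · ‖(a_n)‖_p, where 𝓡 is the Riesz–Titchmarsh operator, and the constant cot(π/(2p*)) is best possible; that is, the operator norm of 𝓡 on ℓ^p(ℤ) equals cot(π/(2p*)). -/

import Mathlib

open scoped BigOperators
open MeasureTheory

noncomputable section

/-- The ℓ^p norm of a doubly infinite complex sequence. -/
def lpNorm (p : ℝ) (a : ℤ → ℂ) : ℝ := (∑' n : ℤ, ‖a n‖ ^ p) ^ (1 / p)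

/-- Membership in ℓ^p(ℤ). -/
def MemLpZ (p : ℝ) (a : ℤ → ℂ) : Prop := Summable fun n : ℤ => ‖a n‖ ^ p

/-- The operator norm of an operator on ℓ^p(ℤ): the least admissible constant. -/
def opNormOn (p : ℝ) (T : (ℤ → ℂ) → ℤ → ℂ) : ℝ :=
  sInf {C : ℝ | 0 ≤ C ∧ ∀ a : ℤ → ℂ, MemLpZ p a → lpNorm p (T a) ≤ C * lpNorm p a}

/-- The Riesz–Titchmarsh operator: 𝓡 a_n = (1/π) Σ_{m ∈ ℤ} a_{n-m}/(m + 1/2). -/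
def RT (a : ℤ → ℂ) (n : ℤ) : ℂ :=
  (1 / (Real.pi : ℂ)) * ∑' m : ℤ, a (n - m) / ((m : ℂ) + 1 / 2)

/-- The Kak–Hilbert transform: 𝓚 a_n = (2/π) Σ_{m odd} a_{n-m}/m. -/
def KT (a : ℤ → ℂ) (n : ℤ) : ℂ :=
  (2 / (Real.pi : ℂ)) * ∑' m : {m : ℤ // Odd m}, a (n - (m : ℤ)) / ((m : ℤ) : ℂ)

/-- The discrete Hilbert transform: 𝓗₀ a_n = (1/π) Σ_{m ≠ 0} a_{n-m}/m. -/
def H0T (a : ℤ → ℂ) (n : ℤ) : ℂ :=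
  (1 / (Real.pi : ℂ)) * ∑' m : {m : ℤ // m ≠ 0}, a (n - (m : ℤ)) / ((m : ℤ) : ℂ)

/-- The operator 𝓗: 𝓗 a_n = (2/π) Σ_{m even, m ≠ 0} a_{n-m}/m. -/
def HT (a : ℤ → ℂ) (n : ℤ) : ℂ :=
  (2 / (Real.pi : ℂ)) *
    ∑' m : {m : ℤ // Even (m : ℤ) ∧ (m : ℤ) ≠ 0}, a (n - (m : ℤ)) / ((m : ℤ) : ℂ)

/-- The operator 𝓘: 𝓘 a_n = (4/π²) Σ_{m odd} a_{n-m}/m². -/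
def IT (a : ℤ → ℂ) (n : ℤ) : ℂ :=
  (4 / (Real.pi : ℂ) ^ 2) * ∑' m : {m : ℤ // Odd m}, a (n - (m : ℤ)) / ((m : ℤ) : ℂ) ^ 2

/-- p* = max(p, p/(p-1)). -/
def pstar (p : ℝ) : ℝ := max p (p / (p - 1))

/-- C_p = cot(π/(2 p*)). -/
def Cconst (p : ℝ) : ℝ := Real.cot (Real.pi / (2 * pstar p))

section

open Complex

/-- `HasDbar F d z`: `F` is real-differentiable at `z` and `2 i ∂̄F(z) = d`. -/
def HasDbar (F : ℂ → ℂ) (d z : ℂ) : Prop :=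
  ∃ L : ℂ →L[ℝ] ℂ, HasFDerivAt F L z ∧ I * L 1 - L I = d

namespace HasDbar

variable {F G : ℂ → ℂ} {d e z : ℂ}

theorem differentiableAt (h : HasDbar F d z) : DifferentiableAt ℝ F z := by
  obtain ⟨L, hL, -⟩ := h
  exact hL.differentiableAt

theorem fderiv_eq (h : HasDbar F d z) : I • fderiv ℝ F z 1 - fderiv ℝ F z I = d := by
  obtain ⟨L, hL, h⟩ := h
  rw [hL.fderiv, smul_eq_mul, h]

theorem of_hasDerivAt {F' : ℂ} (h : HasDerivAt F F' z) : HasDbar F 0 z := by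
  refine ⟨_, h.complexToReal_fderiv, ?_⟩
  simp
  ring

theorem of_differentiableAt (h : DifferentiableAt ℂ F z) : HasDbar F 0 z :=
  of_hasDerivAt h.hasDerivAt

theorem add (hF : HasDbar F d z) (hG : HasDbar G e z) :
    HasDbar (fun x => F x + G x) (d + e) z := by
  obtain ⟨L, hL, h⟩ := hF
  obtain ⟨M, hM, h'⟩ := hG
  refine ⟨_, hL.add hM, ?_⟩
  rw [← h, ← h']
  simp
  ring

theorem mul (hF : HasDbar F d z) (hG : HasDbar G e z) :
    HasDbar (fun x => F x * G x) (F z * e + G z * d) z := by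
  obtain ⟨L, hL, h⟩ := hF
  obtain ⟨M, hM, h'⟩ := hG
  refine ⟨_, hL.mul hM, ?_⟩
  rw [← h, ← h']
  simp
  ring

theorem const_mul (a : ℂ) (hF : HasDbar F d z) : HasDbar (fun x => a * F x) (a * d) z := by
  simpa using (of_hasDerivAt (hasDerivAt_const z a)).mul hF

theorem sub (hF : HasDbar F d z) (hG : HasDbar G e z) :
    HasDbar (fun x => F x - G x) (d - e) z := by
  simpa [sub_eq_add_neg] using hF.add (hG.const_mul (-1))

theorem pow (hF : HasDbar F d z) (k : ℕ) :
    HasDbar (fun x => F x ^ (k + 1)) ((k + 1) * F z ^ k * d) z := by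
  induction k with
  | zero => simpa using hF
  | succ k ih =>
    have := ih.mul hF
    simp only [← pow_succ] at this
    convert this using 1
    push_cast
    ring

theorem congr_val (hF : HasDbar F d z) (h : d = e) : HasDbar F e z := h ▸ hF

end HasDbar

/-- For holomorphic `Φ`, `c`, the quotient of the imaginary parts. -/
theorem hasDbar_im_div_im {Φ c : ℂ → ℂ} {Φ' c' z : ℂ} (hΦ : HasDerivAt Φ Φ' z)
    (hc : HasDerivAt c c' z) (h0 : (c z).im ≠ 0) :
    HasDbar (fun x => (((Φ x).im / (c x).im : ℝ) : ℂ))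
      (-((starRingEnd ℂ) (Φ' - ((Φ z).im / (c z).im : ℝ) * c')) / (c z).im) z := by
  have h1 := imCLM.hasFDerivAt.comp z hΦ.complexToReal_fderiv
  have h2 := imCLM.hasFDerivAt.comp z hc.complexToReal_fderiv
  have h3 := ofRealCLM.hasFDerivAt.comp z (h1.mul ((hasDerivAt_inv h0).comp_hasFDerivAt z h2))
  refine ⟨_, h3, ?_⟩
  apply Complex.ext
  · simp [-ofReal_pow]
    field_simp
    ring
  · simp [-ofReal_pow]
    field_simp

section potential

variable (A B : ℝ) (k : ℕ)

/-- The homogeneous form `A u ^ p - v ^ p + B Re (v + i u) ^ p` with `p = k + 1`. -/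
def qForm (U V : ℂ) : ℂ :=
  A * U ^ (k + 1) - V ^ (k + 1) + B * (((V + I * U) ^ (k + 1) + (V - I * U) ^ (k + 1)) * (1 / 2))

/-- The `u`-derivative of `qForm`. -/
def qFormU (U V : ℂ) : ℂ :=
  (k + 1) * (A * U ^ k + B * (I * ((V + I * U) ^ k - (V - I * U) ^ k) / 2))

/-- The `v`-derivative of `qForm`. -/
def qFormV (U V : ℂ) : ℂ :=
  (k + 1) * (-V ^ k + B * (((V + I * U) ^ k + (V - I * U) ^ k) / 2))

/-- The logarithmic factor in the potential. -/
def lamFactor (U c F F1 : ℂ) : ℂ :=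
  ((k + 2) / Real.pi) * F1 * F⁻¹ - c - (k + 1) * U * ((1 + c * c) * F⁻¹)

/-- The potential whose `∂̄`-derivative has nonnegative imaginary part. -/
def potential (U V c F F1 : ℂ) : ℂ :=
  A * (U ^ (k + 1) * c) + V ^ (k + 1) * c⁻¹
    + B * (1 / (2 * I)) * ((V + I * U) ^ (k + 1) - (V - I * U) ^ (k + 1))
    + qForm A B k U V * lamFactor k U c F F1

variable {A B k}

theorem hasDbar_potential {U V c F F1 : ℂ → ℂ} {m z : ℂ} (hU : HasDbar U m z)
    (hV : HasDbar V (-(c z) * m) z) (hc : HasDbar c 0 z)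
    (hF1 : HasDbar F1 0 z) (hci : HasDbar (fun x => (c x)⁻¹) 0 z)
    (hFi : HasDbar (fun x => (F x)⁻¹) 0 z) (hc0 : c z ≠ 0) (hF0 : F z ≠ 0)
    (hFe : F z = U z * c z + V z) :
    HasDbar (fun x => potential A B k (U x) (V x) (c x) (F x) (F1 x))
      (((k + 2) / Real.pi) * m * (qFormU A B k (U z) (V z) - c z * qFormV B k (U z) (V z))
        * (F1 z - U z * (Real.pi * (1 + c z ^ 2))) / F z) z := by
  have one (a : ℂ) : HasDbar (fun _ => a) 0 z := .of_hasDerivAt (hasDerivAt_const z a)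
  have hw := hV.add (hU.const_mul I)
  have hw' := hV.sub (hU.const_mul I)
  have hq := (((hU.pow k).const_mul A).sub (hV.pow k)).add
    ((((hw.pow k).add (hw'.pow k)).mul (one (1 / 2))).const_mul B)
  have hl := (((hF1.const_mul ((k + 2) / Real.pi)).mul hFi).sub hc).sub
    ((hU.const_mul (k + 1)).mul (((one 1).add (hc.mul hc)).mul hFi))
  have h := (((((hU.pow k).mul hc).const_mul A).add ((hV.pow k).mul hci)).add
    (((hw.pow k).sub (hw'.pow k)).const_mul (B * (1 / (2 * I))))).add (hq.mul hl)
  refine HasDbar.congr_val h ?_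
  have hpi : (Real.pi : ℂ) ≠ 0 := by exact_mod_cast Real.pi_ne_zero
  have hI : (I : ℂ)⁻¹ = -I := inv_I
  simp only [qFormU, qFormV, pow_succ (_ + _) k, pow_succ (_ - _) k, pow_succ (U z) k,
    pow_succ (V z) k]
  generalize (V z + I * U z) ^ k = wk
  generalize (V z - I * U z) ^ k = wbk
  generalize U z ^ k = uk
  generalize V z ^ k = vk
  have hVe : V z = F z - U z * c z := by rw [hFe]; ring
  rw [hVe]
  generalize U z = u at *
  generalize c z = c at *
  generalize F z = F at *
  generalize F1 z = F1 at *
  have hI2 : (I : ℂ) ^ 2 = -1 := I_sq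
  have h2 : 1 / (2 * I) = -I / 2 := by rw [one_div, mul_inv, hI]; ring
  rw [h2]
  field_simp
  ring_nf
  simp only [hI2]
  ring
end potential

end

section

open Complex

/-- The (Herglotz) cotangent `-cot (π z)`, mapping the upper half plane to itself. -/
def herglotzCot (z : ℂ) : ℂ := -(Complex.cos (Real.pi * z) * (Complex.sin (Real.pi * z))⁻¹)

theorem re_pi_mul (z : ℂ) : ((Real.pi : ℂ) * z).re = Real.pi * z.re := by simp

theorem im_pi_mul (z : ℂ) : ((Real.pi : ℂ) * z).im = Real.pi * z.im := by simp

theorem complex_sin_re (z : ℂ) : (Complex.sin z).re = Real.sin z.re * Real.cosh z.im := by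
  rw [Complex.sin_eq, ← ofReal_sin, ← ofReal_cos, ← ofReal_sinh, ← ofReal_cosh]
  simp [-ofReal_sin, -ofReal_cos, -ofReal_sinh, -ofReal_cosh]

theorem complex_sin_im (z : ℂ) : (Complex.sin z).im = Real.cos z.re * Real.sinh z.im := by
  rw [Complex.sin_eq, ← ofReal_sin, ← ofReal_cos, ← ofReal_sinh, ← ofReal_cosh]
  simp [-ofReal_sin, -ofReal_cos, -ofReal_sinh, -ofReal_cosh]

theorem complex_cos_re (z : ℂ) : (Complex.cos z).re = Real.cos z.re * Real.cosh z.im := by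
  rw [Complex.cos_eq, ← ofReal_sin, ← ofReal_cos, ← ofReal_sinh, ← ofReal_cosh]
  simp [-ofReal_sin, -ofReal_cos, -ofReal_sinh, -ofReal_cosh]

theorem complex_cos_im (z : ℂ) : (Complex.cos z).im = -(Real.sin z.re * Real.sinh z.im) := by
  rw [Complex.cos_eq, ← ofReal_sin, ← ofReal_cos, ← ofReal_sinh, ← ofReal_cosh]
  simp [-ofReal_sin, -ofReal_cos, -ofReal_sinh, -ofReal_cosh]

theorem normSq_sin (z : ℂ) :
    normSq (Complex.sin z) = Real.sin z.re ^ 2 + Real.sinh z.im ^ 2 := by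
  rw [normSq_apply, complex_sin_re, complex_sin_im]
  linear_combination Real.sin z.re ^ 2 * Real.cosh_sq z.im +
    Real.sinh z.im ^ 2 * Real.sin_sq_add_cos_sq z.re

theorem normSq_cos (z : ℂ) :
    normSq (Complex.cos z) = Real.cos z.re ^ 2 + Real.sinh z.im ^ 2 := by
  rw [normSq_apply, complex_cos_re, complex_cos_im]
  linear_combination Real.cos z.re ^ 2 * Real.cosh_sq z.im +
    Real.sinh z.im ^ 2 * Real.sin_sq_add_cos_sq z.re

theorem sin_pi_mul_ne_zero_of_im_pos {z : ℂ} (hz : 0 < z.im) : Complex.sin (Real.pi * z) ≠ 0 := by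
  have : 0 < Real.sinh (Real.pi * z.im) := Real.sinh_pos_iff.2 (mul_pos Real.pi_pos hz)
  rw [← normSq_pos, normSq_sin, re_pi_mul, im_pi_mul]
  positivity

theorem cos_pi_mul_ne_zero_of_im_pos {z : ℂ} (hz : 0 < z.im) : Complex.cos (Real.pi * z) ≠ 0 := by
  have : 0 < Real.sinh (Real.pi * z.im) := Real.sinh_pos_iff.2 (mul_pos Real.pi_pos hz)
  rw [← normSq_pos, normSq_cos, re_pi_mul, im_pi_mul]
  positivity

theorem herglotzCot_ne_zero {z : ℂ} (hz : 0 < z.im) : herglotzCot z ≠ 0 :=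
  neg_ne_zero.2 (mul_ne_zero (cos_pi_mul_ne_zero_of_im_pos hz) (inv_ne_zero (sin_pi_mul_ne_zero_of_im_pos hz)))

theorem herglotzCot_im (z : ℂ) :
    (herglotzCot z).im = Real.sinh (Real.pi * z.im) * Real.cosh (Real.pi * z.im) /
      normSq (Complex.sin (Real.pi * z)) := by
  rw [herglotzCot, inv_def, ← mul_assoc, ← neg_mul, im_mul_ofReal, div_eq_mul_inv]
  congr 1
  rw [neg_im, mul_im, conj_re, conj_im, complex_sin_re, complex_sin_im, complex_cos_re, complex_cos_im,
    re_pi_mul, im_pi_mul]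
  linear_combination Real.sinh (Real.pi * z.im) * Real.cosh (Real.pi * z.im) *
    Real.sin_sq_add_cos_sq (Real.pi * z.re)

theorem herglotzCot_im_pos {z : ℂ} (hz : 0 < z.im) : 0 < (herglotzCot z).im := by
  rw [herglotzCot_im]
  have h1 : 0 < Real.sinh (Real.pi * z.im) := Real.sinh_pos_iff.2 (mul_pos Real.pi_pos hz)
  have h2 := normSq_pos.2 (sin_pi_mul_ne_zero_of_im_pos hz)
  have h3 := Real.cosh_pos (Real.pi * z.im)
  positivity

theorem normSq_herglotzCot (z : ℂ) : normSq (herglotzCot z) =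
    normSq (Complex.cos (Real.pi * z)) / normSq (Complex.sin (Real.pi * z)) := by
  rw [herglotzCot, normSq_neg, map_mul, map_inv₀, div_eq_mul_inv]

theorem one_add_herglotzCot_sq {z : ℂ} (hz : Complex.sin (Real.pi * z) ≠ 0) :
    1 + herglotzCot z ^ 2 = (Complex.sin (Real.pi * z) ^ 2)⁻¹ := by
  rw [herglotzCot]
  field_simp
  exact Complex.sin_sq_add_cos_sq _

theorem hasDerivAt_herglotzCot {z : ℂ} (hz : Complex.sin (Real.pi * z) ≠ 0) :
    HasDerivAt herglotzCot (Real.pi * (1 + herglotzCot z ^ 2)) z := by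
  have h0 : HasDerivAt (fun x : ℂ => (Real.pi : ℂ) * x) (Real.pi : ℂ) z := by
    simpa using (hasDerivAt_id z).const_mul (Real.pi : ℂ)
  have hs := (Complex.hasDerivAt_sin _).comp z h0
  have hc := (Complex.hasDerivAt_cos _).comp z h0
  refine (hc.mul (hs.inv hz)).neg.congr_deriv ?_
  rw [one_add_herglotzCot_sq hz]
  simp only [Function.comp_apply, Pi.inv_apply]
  field_simp
  linear_combination Complex.sin_sq_add_cos_sq ((Real.pi : ℂ) * z)

/-- Uniform bounds for the cotangent on half planes. -/
theorem exists_herglotzCot_bound {t : ℝ} (ht : 0 < t) : ∃ M : ℝ, 1 ≤ M ∧ ∀ z : ℂ, t ≤ z.im →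
    ‖herglotzCot z‖ ≤ M ∧ ‖(herglotzCot z)⁻¹‖ ≤ M ∧ ((herglotzCot z).im)⁻¹ ≤ M := by
  have hs0 : 0 < Real.sinh (Real.pi * t) := Real.sinh_pos_iff.2 (mul_pos Real.pi_pos ht)
  refine ⟨1 + (Real.sinh (Real.pi * t))⁻¹, by simpa using hs0.le, fun z hz => ?_⟩
  set M := 1 + (Real.sinh (Real.pi * t))⁻¹ with hM
  have hM1 : 0 < M := by positivity
  have hzi : 0 < z.im := ht.trans_le hz
  have hs : Real.sinh (Real.pi * t) ≤ Real.sinh (Real.pi * z.im) :=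
    Real.sinh_le_sinh.2 (by gcongr)
  have hsp := hs0.trans_le hs
  set S := Real.sinh (Real.pi * z.im)
  have hcs : Real.cosh (Real.pi * z.im) ^ 2 = S ^ 2 + 1 := Real.cosh_sq _
  have hcp := Real.cosh_pos (Real.pi * z.im)
  set Ch := Real.cosh (Real.pi * z.im)
  have h1 : Ch ≤ M * S := by
    have : Ch ≤ 1 + S := abs_le_of_sq_le_sq' (by nlinarith) (by positivity) |>.2
    have h2 : 1 ≤ (Real.sinh (Real.pi * t))⁻¹ * S := by
      rw [inv_mul_eq_div, le_div_iff₀ hs0]; simpa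
    nlinarith
  have nS := normSq_sin (Real.pi * z)
  have nC := normSq_cos (Real.pi * z)
  rw [re_pi_mul, im_pi_mul] at nS nC
  have h3 := Real.sin_sq_add_cos_sq (Real.pi * z.re)
  have h4 : Ch ^ 2 ≤ M ^ 2 * S ^ 2 := by rw [← mul_pow]; gcongr
  have pS := normSq_pos.2 (sin_pi_mul_ne_zero_of_im_pos hzi)
  have pC := normSq_pos.2 (cos_pi_mul_ne_zero_of_im_pos hzi)
  have b1 := sq_nonneg (Real.sin (Real.pi * z.re))
  have b2 := sq_nonneg (Real.cos (Real.pi * z.re))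
  have nc := normSq_herglotzCot z
  refine ⟨?_, ?_, ?_⟩
  · refine abs_le_of_sq_le_sq' ?_ hM1.le |>.2
    rw [← normSq_eq_norm_sq, nc, div_le_iff₀ pS, nC, nS]
    nlinarith [mul_nonneg (sq_nonneg M) b1]
  · refine abs_le_of_sq_le_sq' ?_ hM1.le |>.2
    rw [← normSq_eq_norm_sq, map_inv₀, nc, inv_div, div_le_iff₀ pC, nC, nS]
    nlinarith [mul_nonneg (sq_nonneg M) b2]
  · rw [herglotzCot_im, inv_div, div_le_iff₀ (by positivity), nS]
    nlinarith

end

section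

open Complex

/-- The real form `A u ^ p - v ^ p + B Re (v + i u) ^ p` with `p = k + 1`. -/
def qReal (A B : ℝ) (k : ℕ) (u v : ℝ) : ℝ :=
  A * u ^ (k + 1) - v ^ (k + 1) + B * (((v : ℂ) + I * u) ^ (k + 1)).re

theorem sub_I_mul_eq_conj (u v : ℝ) : (v : ℂ) - I * u = (starRingEnd ℂ) (v + I * u) := by
  simp [sub_eq_add_neg]

theorem qForm_ofReal (A B : ℝ) (k : ℕ) (u v : ℝ) : qForm A B k u v = qReal A B k u v := by
  rw [qForm, qReal, sub_I_mul_eq_conj, ← map_pow, add_conj]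
  push_cast
  ring

theorem qFormU_ofReal (A B : ℝ) (k : ℕ) (u v : ℝ) : qFormU A B k u v =
    ((k + 1) * (A * u ^ k - B * (((v : ℂ) + I * u) ^ k).im) : ℝ) := by
  rw [qFormU, sub_I_mul_eq_conj, ← map_pow, sub_conj]
  push_cast
  linear_combination (k + 1) * B * (((v : ℂ) + I * u) ^ k).im * I_sq

theorem qFormV_ofReal (B : ℝ) (k : ℕ) (u v : ℝ) : qFormV B k u v =
    ((k + 1) * (-v ^ k + B * (((v : ℂ) + I * u) ^ k).re) : ℝ) := by
  rw [qFormV, sub_I_mul_eq_conj, ← map_pow, add_conj]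
  push_cast
  ring

theorem qReal_euler (A B : ℝ) (k : ℕ) (u v : ℝ) :
    u * ((k + 1) * (A * u ^ k - B * (((v : ℂ) + I * u) ^ k).im)) +
      v * ((k + 1) * (-v ^ k + B * (((v : ℂ) + I * u) ^ k).re)) = (k + 1) * qReal A B k u v := by
  rw [qReal, pow_succ ((v : ℂ) + I * u) k, mul_re]
  simp
  ring

/-- The imaginary part of the `∂̄`-derivative of the potential. -/
theorem im_dbar_potential (A B : ℝ) (k : ℕ) (u v : ℝ) (c X : ℂ) (hc : c.im ≠ 0) :
    (((k + 2) / Real.pi) * (-((starRingEnd ℂ) X) / c.im) *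
      (qFormU A B k u v - c * qFormV B k u v) * X / (u * c + v)).im =
    (k + 2) / Real.pi * (k + 1) * (normSq X / normSq (u * c + v)) * qReal A B k u v := by
  rw [qFormU_ofReal, qFormV_ofReal]
  have he := qReal_euler A B k u v
  generalize (k + 1) * (A * u ^ k - B * (((v : ℂ) + I * u) ^ k).im) = qu at *
  generalize (k + 1) * (-v ^ k + B * (((v : ℂ) + I * u) ^ k).re) = qv at *
  have h1 : ((k + 2) / Real.pi) * (-((starRingEnd ℂ) X) / c.im) * (qu - c * qv) * X / (u * c + v)
      = ((-((k + 2) / Real.pi * normSq X / c.im) * (normSq (u * c + v))⁻¹ : ℝ) : ℂ) *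
        ((qu - c * qv) * (starRingEnd ℂ) (u * c + v)) := by
    rw [div_eq_mul_inv _ (u * c + v), inv_def]
    push_cast
    rw [normSq_eq_conj_mul_self (z := X)]
    ring
  rw [h1, im_ofReal_mul]
  have h2 : ((qu - c * qv) * (starRingEnd ℂ) (u * c + v)).im = -(c.im * ((k + 1) * qReal A B k u v)) := by
    rw [← he]
    simp
    ring
  rw [h2]
  field_simp

theorem im_potential (A B : ℝ) (k : ℕ) (u v : ℝ) (c F F1 : ℂ) :
    (potential A B k u v c F F1).im = A * (u ^ (k + 1) * c.im) - v ^ (k + 1) * (c.im / normSq c) +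
      qReal A B k u v * (lamFactor k u c F F1).im := by
  have h : (B : ℂ) * (1 / (2 * I)) *
      (((v : ℂ) + I * u) ^ (k + 1) - ((v : ℂ) - I * u) ^ (k + 1)) =
      ((B * (((v : ℂ) + I * u) ^ (k + 1)).im : ℝ) : ℂ) := by
    rw [sub_I_mul_eq_conj, ← map_pow, sub_conj]
    push_cast
    field_simp
  rw [potential, qForm_ofReal, h]
  rw [add_im, add_im, add_im, im_ofReal_mul, im_ofReal_mul, ofReal_im, ← ofReal_pow, ← ofReal_pow,
    im_ofReal_mul, im_ofReal_mul, inv_im]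
  ring

theorem im_lamFactor (k : ℕ) (u v : ℝ) (c F1 : ℂ) (hF : (u * c + v : ℂ) ≠ 0) :
    (lamFactor k u c (u * c + v) F1).im ≤
      (k + 2) / Real.pi * ‖F1 - u * (Real.pi * (1 + c ^ 2))‖ * ‖(u * c + v : ℂ)‖⁻¹ -
        c.im * (u ^ 2 + v ^ 2) * (‖(u * c + v : ℂ)‖⁻¹) ^ 2 := by
  set X := F1 - u * (Real.pi * (1 + c ^ 2)) with hX
  have hpi : (Real.pi : ℂ) ≠ 0 := by exact_mod_cast Real.pi_ne_zero
  have h1 : lamFactor k u c (u * c + v) F1 =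
      ((((k + 2) / Real.pi : ℝ) : ℂ)) * (X * (u * c + v)⁻¹) +
      (((‖(u * c + v : ℂ)‖⁻¹) ^ 2 : ℝ) : ℂ) * ((u - v * c) * (starRingEnd ℂ) (u * c + v)) := by
    have h2 : (((‖(u * c + v : ℂ)‖⁻¹) ^ 2 : ℝ) : ℂ) * ((u - v * c) * (starRingEnd ℂ) (u * c + v)) =
        (u - v * c) * (u * c + v : ℂ)⁻¹ := by
      rw [inv_def, normSq_eq_norm_sq, inv_pow]
      ring
    rw [h2, lamFactor, hX]
    push_cast
    field_simp
    ring
  have h3 : ((u - v * c) * (starRingEnd ℂ) (u * c + v)).im = - (c.im * (u ^ 2 + v ^ 2)) := by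
    simp
    ring
  rw [h1, add_im, im_ofReal_mul, im_ofReal_mul, h3]
  have h4 : (X * (u * c + v : ℂ)⁻¹).im ≤ ‖X‖ * ‖(u * c + v : ℂ)‖⁻¹ := by
    rw [← norm_inv, ← norm_mul]
    exact (le_abs_self _).trans (abs_im_le_norm _)
  have : (0:ℝ) ≤ (k + 2) / Real.pi := by positivity
  nlinarith [mul_le_mul_of_nonneg_left h4 this]

theorem mul_sub_sq_le {Q K β x h r y : ℝ} (hQ : 0 ≤ Q) (hQK : Q ≤ K * r) (hh : 0 < h)
    (hK : 0 ≤ K) (hr : 0 ≤ r) : Q * (β * x * y - h * r * y ^ 2) ≤ K * (β ^ 2 * x ^ 2 / (4 * h)) := by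
  rcases hr.eq_or_lt with rfl | hr
  · have : Q = 0 := by linarith
    rw [this, zero_mul]
    positivity
  have h1 : β * x * y - h * r * y ^ 2 ≤ β ^ 2 * x ^ 2 / (4 * h) / r := by
    rw [div_div, le_div_iff₀ (by positivity)]
    nlinarith [sq_nonneg (β * x - 2 * h * r * y)]
  calc _ ≤ Q * (β ^ 2 * x ^ 2 / (4 * h) / r) := by gcongr
    _ ≤ K * r * (β ^ 2 * x ^ 2 / (4 * h) / r) := by gcongr
    _ = _ := by field_simp

theorem norm_add_I_mul_le (u v : ℝ) : ‖(v : ℂ) + I * u‖ ≤ |u| + |v| := by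
  refine (norm_add_le _ _).trans ?_
  simp [add_comm]

theorem abs_qReal_le (A B : ℝ) (k : ℕ) {u v M : ℝ} (hu : |u| ≤ M) (hv : |v| ≤ M) :
    |qReal A B k u v| ≤ (|A| + 1 + |B|) * (2 * M) ^ (k + 1) := by
  have hM : 0 ≤ M := (abs_nonneg u).trans hu
  have h1 : |u ^ (k + 1)| ≤ (2 * M) ^ (k + 1) := by rw [abs_pow]; gcongr; linarith
  have h2 : |v ^ (k + 1)| ≤ (2 * M) ^ (k + 1) := by rw [abs_pow]; gcongr; linarith
  have h3 : |(((v : ℂ) + I * u) ^ (k + 1)).re| ≤ (2 * M) ^ (k + 1) := by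
    refine (abs_re_le_norm _).trans ?_
    rw [norm_pow]
    gcongr
    exact (norm_add_I_mul_le u v).trans (by linarith)
  rw [qReal]
  calc _ ≤ |A * u ^ (k + 1)| + |v ^ (k + 1)| + |B * (((v : ℂ) + I * u) ^ (k + 1)).re| :=
        (abs_add_le _ _).trans (by gcongr; exact abs_sub _ _)
    _ ≤ _ := by
      rw [abs_mul, abs_mul]
      nlinarith [mul_le_mul_of_nonneg_left h1 (abs_nonneg A),
        mul_le_mul_of_nonneg_left h3 (abs_nonneg B)]

theorem qReal_le_sq (A B : ℝ) (j : ℕ) {u v M : ℝ} (hu : |u| ≤ M) (hv : |v| ≤ M) :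
    qReal A B (j + 1) u v ≤ (|A| + 1 + |B|) * (2 * M) ^ j * (u ^ 2 + v ^ 2) := by
  have hM : 0 ≤ M := (abs_nonneg u).trans hu
  have key (x : ℝ) (hx : |x| ≤ 2 * M) (y : ℝ) (hxy : x ^ 2 ≤ y) :
      |x ^ (j + 2)| ≤ (2 * M) ^ j * y := by
    rw [abs_pow, pow_add, sq_abs]
    gcongr
  have h1 := key u (by linarith) (u ^ 2 + v ^ 2) (by nlinarith [sq_nonneg v])
  have h2 := key v (by linarith) (u ^ 2 + v ^ 2) (by nlinarith [sq_nonneg u])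
  have h3 : |(((v : ℂ) + I * u) ^ (j + 2)).re| ≤ (2 * M) ^ j * (u ^ 2 + v ^ 2) := by
    refine (abs_re_le_norm _).trans ?_
    rw [norm_pow]
    refine (le_abs_self _).trans ((abs_pow _ _).trans_le ?_)
    rw [← abs_pow]
    refine key _ ?_ _ ?_
    · rw [abs_norm]
      exact (norm_add_I_mul_le u v).trans (by linarith)
    · rw [← normSq_eq_norm_sq, normSq_apply]
      simp
      nlinarith
  rw [qReal]
  calc _ ≤ |A * u ^ (j + 2)| + |v ^ (j + 2)| + |B * (((v : ℂ) + I * u) ^ (j + 2)).re| :=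
        (le_abs_self _).trans ((abs_add_le _ _).trans (by gcongr; exact abs_sub _ _))
    _ ≤ _ := by
      rw [abs_mul, abs_mul]
      nlinarith [mul_le_mul_of_nonneg_left h1 (abs_nonneg A),
        mul_le_mul_of_nonneg_left h3 (abs_nonneg B)]

theorem norm_potential_le (A B : ℝ) (k : ℕ) {u v M : ℝ} {c F F1 : ℂ} (hM : 1 ≤ M)
    (hu : |u| ≤ M * ‖F‖) (hv : |v| ≤ M * ‖F‖) (hc : ‖c‖ ≤ M) (hci : ‖c⁻¹‖ ≤ M) :
    ‖potential A B k u v c F F1‖ ≤ (|A| + 1 + |B|) * (2 * M) ^ (k + 1) *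
      (M + (k + 2) + M + (k + 1) * M * (1 + M ^ 2)) * (‖F‖ ^ (k + 1) + ‖F‖ ^ k * ‖F1‖) := by
  set f := ‖F‖ with hf
  set N := (2 * M) ^ (k + 1) with hN
  have hf0 : 0 ≤ f := norm_nonneg _
  have hNf : (2 * (M * f)) ^ (k + 1) = N * f ^ (k + 1) := by rw [← mul_assoc, mul_pow]
  have hMf : M * f ≤ 2 * (M * f) := by nlinarith
  have h1 : ‖(u : ℂ) ^ (k + 1)‖ ≤ N * f ^ (k + 1) := by
    rw [norm_pow, norm_real, Real.norm_eq_abs, ← hNf]; gcongr; linarith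
  have h2 : ‖(v : ℂ) ^ (k + 1)‖ ≤ N * f ^ (k + 1) := by
    rw [norm_pow, norm_real, Real.norm_eq_abs, ← hNf]; gcongr; linarith
  have h3 : ‖((v : ℂ) + I * u) ^ (k + 1)‖ ≤ N * f ^ (k + 1) := by
    rw [norm_pow, ← hNf]; gcongr; exact (norm_add_I_mul_le u v).trans (by linarith)
  have h3' : ‖((v : ℂ) - I * u) ^ (k + 1)‖ ≤ N * f ^ (k + 1) := by
    rw [sub_I_mul_eq_conj, ← map_pow, norm_conj]; exact h3
  have hq : ‖qForm A B k u v‖ ≤ (|A| + 1 + |B|) * (N * f ^ (k + 1)) := by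
    rw [qForm_ofReal, norm_real, Real.norm_eq_abs, ← hNf]
    exact abs_qReal_le A B k hu hv
  have hL : f * ‖lamFactor k u c F F1‖ ≤ (k + 2) * ‖F1‖ + (M + (k + 1) * M * (1 + M ^ 2)) * f := by
    rcases eq_or_ne F 0 with hF | hF
    · rw [hf, hF]; simp; positivity
    have e : F * lamFactor k u c F F1 =
        ((k + 2) / Real.pi) * F1 - F * c - (k + 1) * u * (1 + c * c) := by
      rw [lamFactor]; field_simp
    rw [hf, ← norm_mul, e]
    have g1 : ‖((k + 2) / Real.pi : ℂ) * F1‖ ≤ (k + 2) * ‖F1‖ := by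
      rw [norm_mul]
      gcongr
      have : ((k + 2) / Real.pi : ℂ) = ((k + 2) / Real.pi : ℝ) := by push_cast; rfl
      rw [this, norm_real, Real.norm_of_nonneg (by positivity)]
      exact div_le_self (by positivity) (by linarith [Real.pi_gt_three])
    have g2 : ‖F * c‖ ≤ M * f := by rw [norm_mul, mul_comm]; gcongr
    have g3 : ‖(k + 1) * (u : ℂ) * (1 + c * c)‖ ≤ (k + 1) * (M * f) * (1 + M ^ 2) := by
      rw [norm_mul, norm_mul, norm_real, Real.norm_eq_abs]
      have : ‖(k + 1 : ℂ)‖ = k + 1 := by exact_mod_cast norm_natCast (k + 1)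
      rw [this]
      gcongr
      refine (norm_add_le _ _).trans ?_
      rw [norm_mul, norm_one, pow_two]
      gcongr
    calc _ ≤ _ := norm_sub_le_of_le (norm_sub_le_of_le g1 g2) g3
      _ = _ := by ring
  have hfk : 0 ≤ f ^ k := by positivity
  have hN0 : 0 ≤ N := by positivity
  have e1 : ‖(A : ℂ) * ((u : ℂ) ^ (k + 1) * c)‖ ≤ |A| * (N * f ^ (k + 1) * M) := by
    rw [norm_mul, norm_mul, norm_real, Real.norm_eq_abs]; gcongr
  have e2 : ‖(v : ℂ) ^ (k + 1) * c⁻¹‖ ≤ N * f ^ (k + 1) * M := by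
    rw [norm_mul]; gcongr
  have e3 : ‖(B : ℂ) * (1 / (2 * I)) *
      (((v : ℂ) + I * u) ^ (k + 1) - ((v : ℂ) - I * u) ^ (k + 1))‖ ≤ |B| * (N * f ^ (k + 1)) := by
    rw [norm_mul, norm_mul, norm_real, Real.norm_eq_abs, mul_assoc]
    refine mul_le_mul_of_nonneg_left ?_ (abs_nonneg B)
    have : ‖(1 / (2 * I) : ℂ)‖ = 1 / 2 := by simp
    rw [this]
    linarith [norm_sub_le_of_le h3 h3']
  have e4 : ‖qForm A B k u v * lamFactor k u c F F1‖ ≤ (|A| + 1 + |B|) * (N * f ^ k) *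
      ((k + 2) * ‖F1‖ + (M + (k + 1) * M * (1 + M ^ 2)) * f) := by
    rw [norm_mul]
    calc _ ≤ (|A| + 1 + |B|) * (N * f ^ (k + 1)) * ‖lamFactor k u c F F1‖ := by gcongr
      _ = (|A| + 1 + |B|) * (N * f ^ k) * (f * ‖lamFactor k u c F F1‖) := by ring
      _ ≤ _ := by gcongr
  rw [potential]
  refine (norm_add_le_of_le (norm_add_le_of_le (norm_add_le_of_le e1 e2) e3) e4).trans ?_
  have hfk1 : 0 ≤ f ^ (k + 1) := by positivity
  have hP : 0 ≤ (M + (k + 1) * M * (1 + M ^ 2)) * (f ^ k * ‖F1‖) := by positivity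
  have hP' : 0 ≤ ((k:ℝ) + 2) * f ^ (k + 1) := by positivity
  have hP'' : 0 ≤ M * (f ^ k * ‖F1‖) := by positivity
  calc _ ≤ (|A| + 1 + |B|) * N * (f ^ (k + 1) * M) + (|A| + 1 + |B|) * (N * f ^ k) *
        ((k + 2) * ‖F1‖ + (M + (k + 1) * M * (1 + M ^ 2)) * f) := by
        gcongr
        have : |B| * (N * f ^ (k + 1)) * 1 ≤ |B| * (N * f ^ (k + 1)) * M := by gcongr
        linarith
    _ = (|A| + 1 + |B|) * N * (M * f ^ (k + 1) + (k + 2) * (f ^ k * ‖F1‖) +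
        (M + (k + 1) * M * (1 + M ^ 2)) * f ^ (k + 1)) := by ring
    _ ≤ (|A| + 1 + |B|) * N * ((M + (k + 2) + M + (k + 1) * M * (1 + M ^ 2)) *
        (f ^ (k + 1) + f ^ k * ‖F1‖)) := by
        gcongr
        linarith
    _ = _ := by ring

end

section

open Complex

section cauchy

variable (S : Finset ℤ) (a : ℤ → ℝ)

/-- The Cauchy transform of `∑ a m δ_m`, normalised so that its imaginary part is a Poisson
integral. -/
def cauchySum (z : ℂ) : ℂ := ∑ m ∈ S, ((a m / Real.pi : ℝ) : ℂ) * ((m : ℂ) - z)⁻¹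

/-- The derivative of `cauchySum`. -/
def cauchySumDeriv (z : ℂ) : ℂ := ∑ m ∈ S, ((a m / Real.pi : ℝ) : ℂ) * (((m : ℂ) - z)⁻¹) ^ 2

/-- The quotient of the imaginary parts of `cauchySum` and `herglotzCot`. -/
def uFun (z : ℂ) : ℝ := (cauchySum S a z).im / (herglotzCot z).im

/-- The real function `v` with `cauchySum = u * herglotzCot + v`. -/
def vFun (z : ℂ) : ℝ := (cauchySum S a z).re - uFun S a z * (herglotzCot z).re

/-- The defect `Φ' - u c'`. -/
def xFun (z : ℂ) : ℂ :=
  cauchySumDeriv S a z - uFun S a z * (Real.pi * (1 + herglotzCot z ^ 2))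

theorem intCast_sub_ne_zero (m : ℤ) {z : ℂ} (hz : 0 < z.im) : (m : ℂ) - z ≠ 0 := by
  intro h
  have := congrArg Complex.im h
  simp at this
  exact hz.ne' this

theorem hasDerivAt_inv_intCast_sub (m : ℤ) {z : ℂ} (hz : (m : ℂ) - z ≠ 0) :
    HasDerivAt (fun z : ℂ => ((m : ℂ) - z)⁻¹) ((((m : ℂ) - z)⁻¹) ^ 2) z := by
  refine (((hasDerivAt_id z).const_sub (m : ℂ)).fun_inv hz).congr_deriv ?_
  simp

theorem hasDerivAt_cauchySum {z : ℂ} (hz : 0 < z.im) :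
    HasDerivAt (cauchySum S a) (cauchySumDeriv S a z) z :=
  HasDerivAt.fun_sum fun m _ =>
    (hasDerivAt_inv_intCast_sub m (intCast_sub_ne_zero m hz)).const_mul _

theorem differentiableAt_cauchySumDeriv {z : ℂ} (hz : 0 < z.im) :
    DifferentiableAt ℂ (cauchySumDeriv S a) z :=
  DifferentiableAt.fun_sum fun m _ =>
    ((hasDerivAt_inv_intCast_sub m (intCast_sub_ne_zero m hz)).differentiableAt.pow 2).const_mul _

theorem uFun_mul_im {z : ℂ} (hz : 0 < z.im) :
    uFun S a z * (herglotzCot z).im = (cauchySum S a z).im :=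
  div_mul_cancel₀ _ (herglotzCot_im_pos hz).ne'

theorem cauchySum_eq {z : ℂ} (hz : 0 < z.im) :
    cauchySum S a z = uFun S a z * herglotzCot z + vFun S a z := by
  apply Complex.ext
  · simp [vFun]
  · simp [uFun_mul_im S a hz]

/-- The `∂̄`-potential attached to `cauchySum`. -/
def wFun (A B : ℝ) (k : ℕ) (z : ℂ) : ℂ :=
  potential A B k (uFun S a z) (vFun S a z) (herglotzCot z) (cauchySum S a z)
    (cauchySumDeriv S a z)

/-- The `∂̄`-derivative of `wFun`. -/
def wDbar (A B : ℝ) (k : ℕ) (z : ℂ) : ℂ :=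
  ((k + 2) / Real.pi) * (-((starRingEnd ℂ) (xFun S a z)) / (herglotzCot z).im) *
    (qFormU A B k (uFun S a z) (vFun S a z) -
      herglotzCot z * qFormV B k (uFun S a z) (vFun S a z)) * xFun S a z / cauchySum S a z

theorem eventually_im_pos {z : ℂ} (hz : 0 < z.im) : ∀ᶠ x in nhds z, 0 < x.im :=
  continuous_im.continuousAt.eventually (lt_mem_nhds hz)

theorem HasDbar.congr_of_eventuallyEq {F G : ℂ → ℂ} {d z : ℂ} (h : HasDbar F d z)
    (hFG : G =ᶠ[nhds z] F) : HasDbar G d z := by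
  obtain ⟨L, hL, h⟩ := h
  exact ⟨L, hL.congr_of_eventuallyEq hFG, h⟩

theorem hasDbar_wFun (A B : ℝ) (k : ℕ) {z : ℂ} (hz : 0 < z.im) (h0 : cauchySum S a z ≠ 0) :
    HasDbar (wFun S a A B k) (wDbar S a A B k z) z := by
  have hc := hasDerivAt_herglotzCot (sin_pi_mul_ne_zero_of_im_pos hz)
  have hc0 := herglotzCot_ne_zero hz
  have hF := hasDerivAt_cauchySum S a hz
  have hU : HasDbar (fun x => (uFun S a x : ℂ)) _ z :=
    hasDbar_im_div_im hF hc (herglotzCot_im_pos hz).ne'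
  have hV : HasDbar (fun x => (vFun S a x : ℂ)) (-(herglotzCot z) *
      (-((starRingEnd ℂ) (xFun S a z)) / (herglotzCot z).im)) z := by
    have h1 := ((HasDbar.of_hasDerivAt hF).sub (hU.mul (HasDbar.of_hasDerivAt hc)))
    refine HasDbar.congr_of_eventuallyEq (h1.congr_val ?_) ?_
    · simp only [xFun, uFun]
      ring
    · filter_upwards [eventually_im_pos hz] with x hx
      rw [cauchySum_eq S a hx]
      ring
  have := hasDbar_potential (A := A) (B := B) (k := k) hU hV (HasDbar.of_hasDerivAt hc)
    (.of_differentiableAt (differentiableAt_cauchySumDeriv S a hz))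
    (.of_differentiableAt (hc.differentiableAt.inv hc0))
    (.of_differentiableAt (hF.differentiableAt.inv h0)) hc0 h0 (cauchySum_eq S a hz)
  exact this

theorem wDbar_im_nonneg {A B : ℝ} {k : ℕ} (hQ : ∀ u v, 0 ≤ qReal A B k u v) {z : ℂ}
    (hz : 0 < z.im) : 0 ≤ (wDbar S a A B k z).im := by
  have h := im_dbar_potential A B k (uFun S a z) (vFun S a z) (herglotzCot z) (xFun S a z)
    (herglotzCot_im_pos hz).ne'
  rw [← cauchySum_eq S a hz] at h
  rw [wDbar, h]
  have h1 := hQ (uFun S a z) (vFun S a z)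
  have h2 := normSq_nonneg (xFun S a z)
  have h3 := normSq_nonneg (cauchySum S a z)
  positivity

theorem exists_uFun_vFun_bound {t : ℝ} (ht : 0 < t) : ∃ M : ℝ, 1 ≤ M ∧ ∀ z : ℂ, t ≤ z.im →
    ‖herglotzCot z‖ ≤ M ∧ ‖(herglotzCot z)⁻¹‖ ≤ M ∧ ((herglotzCot z).im)⁻¹ ≤ M ∧
      |uFun S a z| ≤ M * ‖cauchySum S a z‖ ∧ |vFun S a z| ≤ M * ‖cauchySum S a z‖ := by
  obtain ⟨M, hM, h⟩ := exists_herglotzCot_bound ht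
  have hM2 : M ≤ 1 + M ^ 2 := by nlinarith
  refine ⟨1 + M ^ 2, by nlinarith, fun z hz => ?_⟩
  obtain ⟨h1, h2, h3⟩ := h z hz
  have hp := herglotzCot_im_pos (ht.trans_le hz)
  have hu : |uFun S a z| ≤ M * ‖cauchySum S a z‖ := by
    rw [uFun, abs_div, abs_of_pos hp, div_eq_inv_mul]
    gcongr
    exact abs_im_le_norm _
  refine ⟨h1.trans hM2, h2.trans hM2, h3.trans hM2, hu.trans (by gcongr), ?_⟩
  calc |vFun S a z| ≤ |(cauchySum S a z).re| + |uFun S a z| * |(herglotzCot z).re| := by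
        rw [vFun, ← abs_mul]; exact abs_sub _ _
    _ ≤ ‖cauchySum S a z‖ + M * ‖cauchySum S a z‖ * M := by
        gcongr
        · exact abs_re_le_norm _
        · exact (abs_re_le_norm _).trans h1
    _ = _ := by ring

theorem exists_inv_intCast_sub_decay {t : ℝ} (ht : 0 < t) (m : ℤ) : ∃ K : ℝ, 0 ≤ K ∧
    ∀ z : ℂ, t ≤ z.im → ‖((m : ℂ) - z)⁻¹‖ ≤ K * (1 + ‖z‖)⁻¹ := by
  refine ⟨(1 + ‖(m : ℂ)‖) / t + 1, by positivity, fun z hz => ?_⟩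
  have hn : t ≤ ‖(m : ℂ) - z‖ := by
    refine hz.trans ((le_abs_self _).trans ?_)
    have := abs_im_le_norm ((m : ℂ) - z)
    simpa using this
  have hp : 0 < ‖(m : ℂ) - z‖ := ht.trans_le hn
  rw [norm_inv, inv_le_comm₀ hp (by positivity), mul_inv, inv_inv, inv_mul_le_iff₀ (by positivity)]
  have h1 : ‖z‖ ≤ ‖(m : ℂ)‖ + ‖(m : ℂ) - z‖ := by
    rw [norm_sub_rev]
    simpa using norm_add_le (m : ℂ) (z - m)
  have h2 : 1 + ‖(m : ℂ)‖ ≤ (1 + ‖(m : ℂ)‖) / t * ‖(m : ℂ) - z‖ := by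
    rw [div_mul_eq_mul_div, le_div_iff₀ ht]
    gcongr
  linarith

theorem exists_cauchySum_decay {t : ℝ} (ht : 0 < t) : ∃ K : ℝ, 0 ≤ K ∧ ∀ z : ℂ, t ≤ z.im →
    ‖cauchySum S a z‖ ≤ K * (1 + ‖z‖)⁻¹ ∧ ‖cauchySumDeriv S a z‖ ≤ K * (1 + ‖z‖)⁻¹ := by
  choose K hK h using fun m => exists_inv_intCast_sub_decay ht m
  refine ⟨∑ m ∈ S, |a m / Real.pi| * (K m + K m ^ 2), ?_, fun z hz => ⟨?_, ?_⟩⟩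
  · exact Finset.sum_nonneg fun m _ => by have := hK m; positivity
  · rw [Finset.sum_mul]
    refine norm_sum_le_of_le _ fun m _ => ?_
    rw [norm_mul, norm_real, Real.norm_eq_abs, mul_assoc]
    gcongr
    refine (h m z hz).trans ?_
    gcongr
    nlinarith
  · rw [Finset.sum_mul]
    refine norm_sum_le_of_le _ fun m _ => ?_
    rw [norm_mul, norm_real, Real.norm_eq_abs, mul_assoc, norm_pow]
    gcongr
    have h1 : (1 + ‖z‖)⁻¹ ≤ 1 := inv_le_one_of_one_le₀ (by linarith [norm_nonneg z])
    have h0 : 0 ≤ (1 + ‖z‖)⁻¹ := by positivity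
    calc _ ≤ (K m * (1 + ‖z‖)⁻¹) ^ 2 := by gcongr; exact h m z hz
      _ = K m ^ 2 * ((1 + ‖z‖)⁻¹ * (1 + ‖z‖)⁻¹) := by ring
      _ ≤ K m ^ 2 * ((1 + ‖z‖)⁻¹ * 1) := by gcongr
      _ ≤ _ := by rw [mul_one]; gcongr; have := hK m; linarith

theorem exists_wFun_bound (A B : ℝ) (k : ℕ) {t : ℝ} (ht : 0 < t) : ∃ K : ℝ, 0 ≤ K ∧
    ∀ z : ℂ, t ≤ z.im → ‖wFun S a A B k z‖ ≤
      K * (‖cauchySum S a z‖ ^ (k + 1) + ‖cauchySum S a z‖ ^ k * ‖cauchySumDeriv S a z‖) := by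
  obtain ⟨M, hM, h⟩ := exists_uFun_vFun_bound S a ht
  refine ⟨(|A| + 1 + |B|) * (2 * M) ^ (k + 1) * (M + (k + 2) + M + (k + 1) * M * (1 + M ^ 2)),
    by positivity, fun z hz => ?_⟩
  obtain ⟨h1, h2, -, h3, h4⟩ := h z hz
  exact norm_potential_le A B k hM h3 h4 h1 h2

theorem exists_wFun_decay (A B : ℝ) (j : ℕ) {t : ℝ} (ht : 0 < t) : ∃ K : ℝ, 0 ≤ K ∧
    ∀ z : ℂ, t ≤ z.im → ‖wFun S a A B (j + 1) z‖ ≤ K * ((1 + ‖z‖)⁻¹) ^ 2 := by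
  obtain ⟨K, hK, h⟩ := exists_wFun_bound S a A B (j + 1) ht
  obtain ⟨L, hL, hd⟩ := exists_cauchySum_decay S a ht
  refine ⟨K * (L ^ (j + 2) + L ^ (j + 1) * L), by positivity, fun z hz => ?_⟩
  obtain ⟨h1, h2⟩ := hd z hz
  refine (h z hz).trans ?_
  set r := (1 + ‖z‖)⁻¹ with hr
  have hr1 : r ≤ 1 := inv_le_one_of_one_le₀ (by linarith [norm_nonneg z])
  have hr0 : 0 ≤ r := by positivity
  have hrj : r ^ j ≤ 1 := pow_le_one₀ hr0 hr1
  calc _ ≤ K * ((L * r) ^ (j + 2) + (L * r) ^ (j + 1) * (L * r)) := by gcongr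
    _ = K * (L ^ (j + 2) + L ^ (j + 1) * L) * (r ^ 2 * r ^ j) := by ring
    _ ≤ K * (L ^ (j + 2) + L ^ (j + 1) * L) * (r ^ 2 * 1) := by gcongr
    _ = _ := by ring

theorem wFun_eq_zero (A B : ℝ) (k : ℕ) {z : ℂ} (h : cauchySum S a z = 0) :
    wFun S a A B k z = 0 := by
  have hu : uFun S a z = 0 := by simp [uFun, h]
  have hv : vFun S a z = 0 := by simp [vFun, hu, h]
  simp [wFun, potential, hu, hv, qForm]

theorem continuousAt_wFun (A B : ℝ) (j : ℕ) {z : ℂ} (hz : 0 < z.im) :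
    ContinuousAt (wFun S a A B (j + 1)) z := by
  by_cases h0 : cauchySum S a z = 0
  · obtain ⟨K, hK, h⟩ := exists_wFun_bound S a A B (j + 1) (half_pos hz)
    rw [ContinuousAt, wFun_eq_zero S a A B _ h0]
    have h1 : Filter.Tendsto (fun z => K * (‖cauchySum S a z‖ ^ (j + 1 + 1) +
        ‖cauchySum S a z‖ ^ (j + 1) * ‖cauchySumDeriv S a z‖)) (nhds z) (nhds 0) := by
      have c1 := (hasDerivAt_cauchySum S a hz).continuousAt
      have c2 := (differentiableAt_cauchySumDeriv S a hz).continuousAt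
      have : ContinuousAt (fun z => K * (‖cauchySum S a z‖ ^ (j + 1 + 1) +
        ‖cauchySum S a z‖ ^ (j + 1) * ‖cauchySumDeriv S a z‖)) z := by fun_prop
      simpa [ContinuousAt, h0] using this
    refine squeeze_zero_norm' ?_ h1
    filter_upwards [continuous_im.continuousAt.eventually (lt_mem_nhds (half_lt_self hz))] with x hx
    exact h x hx.le
  · exact (hasDbar_wFun S a A B _ hz h0).differentiableAt.continuousAt
end cauchy

end

section

open Complex MeasureTheory

section rect
variable (S : Finset ℤ) (a : ℤ → ℝ)

theorem finite_cauchySum_zeros (h : ∃ m ∈ S, a m ≠ 0) :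
    {z : ℂ | 0 < z.im ∧ cauchySum S a z = 0}.Finite := by
  classical
  let P : Polynomial ℂ := ∑ m ∈ S, Polynomial.C (((a m / Real.pi : ℝ) : ℂ)) *
    ∏ j ∈ S.erase m, (Polynomial.C (j : ℂ) - Polynomial.X)
  have hev (z : ℂ) : P.eval z =
      ∑ m ∈ S, ((a m / Real.pi : ℝ) : ℂ) * ∏ j ∈ S.erase m, ((j : ℂ) - z) := by
    simp [P, Polynomial.eval_finsetSum, Polynomial.eval_prod]
  have hP : P ≠ 0 := by
    obtain ⟨m, hm, ha⟩ := h
    intro h0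
    have h1 : P.eval (m : ℂ) = 0 := by rw [h0]; simp
    rw [hev, Finset.sum_eq_single_of_mem m hm] at h1
    · rcases mul_eq_zero.1 h1 with h2 | h2
      · have : a m / Real.pi = 0 := by exact_mod_cast h2
        exact (div_ne_zero ha Real.pi_ne_zero) this
      · obtain ⟨j, hj, h3⟩ := Finset.prod_eq_zero_iff.1 h2
        exact (Finset.mem_erase.1 hj).1 (by exact_mod_cast sub_eq_zero.1 h3)
    · intro l hl hlm
      rw [Finset.prod_eq_zero (Finset.mem_erase.2 ⟨hlm.symm, hm⟩) (sub_self (m : ℂ)), mul_zero]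
  refine (P.roots.toFinset.finite_toSet).subset fun z hz => ?_
  have hz2 : P.eval z = (∏ j ∈ S, ((j : ℂ) - z)) * cauchySum S a z := by
    rw [hev, cauchySum, Finset.mul_sum]
    refine Finset.sum_congr rfl fun m hm => ?_
    rw [← Finset.mul_prod_erase S _ hm]
    have := intCast_sub_ne_zero m hz.1
    field_simp
  rw [hz.2, mul_zero] at hz2
  simp [hP, hz2]

theorem measurable_cauchySum : Measurable (cauchySum S a) := by
  unfold cauchySum; fun_prop

theorem measurable_cauchySumDeriv : Measurable (cauchySumDeriv S a) := by
  unfold cauchySumDeriv; fun_prop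

theorem measurable_herglotzCot : Measurable herglotzCot := by
  unfold herglotzCot; fun_prop

theorem measurable_uFun : Measurable (uFun S a) := by
  have := measurable_cauchySum S a
  have := measurable_herglotzCot
  unfold uFun; fun_prop

theorem measurable_vFun : Measurable (vFun S a) := by
  have := measurable_cauchySum S a
  have := measurable_herglotzCot
  have := measurable_uFun S a
  unfold vFun; fun_prop

theorem measurable_xFun : Measurable (xFun S a) := by
  have := measurable_cauchySumDeriv S a
  have := measurable_herglotzCot
  have := measurable_uFun S a
  unfold xFun; fun_prop

theorem measurable_wDbar (A B : ℝ) (k : ℕ) : Measurable (wDbar S a A B k) := by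
  have := measurable_cauchySum S a
  have := measurable_herglotzCot
  have := measurable_uFun S a
  have := measurable_vFun S a
  have := measurable_xFun S a
  have := continuous_conj.measurable
  unfold wDbar qFormU qFormV
  fun_prop

theorem norm_qFormU_sub_le (A B : ℝ) (k : ℕ) {u v M f : ℝ} {c : ℂ} (hM : 1 ≤ M)
    (hu : |u| ≤ M * f) (hv : |v| ≤ M * f) (hc : ‖c‖ ≤ M) (hf : 0 ≤ f) :
    ‖qFormU A B k u v - c * qFormV B k u v‖ ≤
      (k + 1) * (|A| + 1 + |B|) * (2 * M) ^ k * (1 + M) * f ^ k := by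
  have hMf : M * f ≤ 2 * (M * f) := by nlinarith
  have hNf : (2 * (M * f)) ^ k = (2 * M) ^ k * f ^ k := by rw [← mul_assoc, mul_pow]
  have h1 : |u ^ k| ≤ (2 * (M * f)) ^ k := by
    rw [abs_pow]; gcongr; linarith
  have h2 : |v ^ k| ≤ (2 * (M * f)) ^ k := by
    rw [abs_pow]; gcongr; linarith
  have h3 : ‖((v : ℂ) + I * u) ^ k‖ ≤ (2 * (M * f)) ^ k := by
    rw [norm_pow]; gcongr; exact (norm_add_I_mul_le u v).trans (by linarith)
  have h4 := (abs_im_le_norm _).trans h3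
  have h5 := (abs_re_le_norm _).trans h3
  set N := (2 * (M * f)) ^ k
  have hN : 0 ≤ N := (abs_nonneg _).trans h1
  have hk : |(k + 1 : ℝ)| = k + 1 := abs_of_nonneg (by positivity)
  have e1 : ‖qFormU A B k u v‖ ≤ (k + 1) * ((|A| + 1 + |B|) * N) := by
    rw [qFormU_ofReal, norm_real, Real.norm_eq_abs, abs_mul, hk]
    gcongr
    calc _ ≤ |A| * |u ^ k| + |B| * |(((v : ℂ) + I * u) ^ k).im| := by
          rw [← abs_mul, ← abs_mul]; exact abs_sub _ _
      _ ≤ |A| * N + |B| * N := by gcongr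
      _ ≤ _ := by nlinarith
  have e2 : ‖qFormV B k u v‖ ≤ (k + 1) * ((|A| + 1 + |B|) * N) := by
    rw [qFormV_ofReal, norm_real, Real.norm_eq_abs, abs_mul, hk]
    gcongr
    calc _ ≤ |v ^ k| + |B| * |(((v : ℂ) + I * u) ^ k).re| := by
          rw [← abs_mul, ← abs_neg (v ^ k)]; exact abs_add_le _ _
      _ ≤ N + |B| * N := by gcongr
      _ ≤ _ := by nlinarith [mul_nonneg (abs_nonneg A) hN]
  calc _ ≤ ‖qFormU A B k u v‖ + ‖c‖ * ‖qFormV B k u v‖ := by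
        rw [← norm_mul]; exact norm_sub_le _ _
    _ ≤ (k + 1) * ((|A| + 1 + |B|) * N) + M * ((k + 1) * ((|A| + 1 + |B|) * N)) := by gcongr
    _ = _ := by rw [hNf]; ring

theorem exists_wDbar_bound (A B : ℝ) (j : ℕ) {t : ℝ} (ht : 0 < t) : ∃ K : ℝ,
    ∀ z : ℂ, t ≤ z.im → ‖wDbar S a A B (j + 1) z‖ ≤ K := by
  obtain ⟨M, hM, h⟩ := exists_uFun_vFun_bound S a ht
  obtain ⟨L, hL, hd⟩ := exists_cauchySum_decay S a ht
  set Y := L + M * L * (Real.pi * (1 + M ^ 2)) with hY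
  set Z := ((j + 1 : ℕ) + 1) * (|A| + 1 + |B|) * (2 * M) ^ (j + 1) * (1 + M) with hZ
  have hY0 : 0 ≤ Y := by positivity
  have hZ0 : 0 ≤ Z := by positivity
  refine ⟨((j + 1 : ℕ) + 2) / Real.pi * (Y * M) * (Z * L ^ j) * Y, fun z hz => ?_⟩
  obtain ⟨h1, -, h3, h4, h5⟩ := h z hz
  obtain ⟨d1, d2⟩ := hd z hz
  have hr1 : (1 + ‖z‖)⁻¹ ≤ 1 := inv_le_one_of_one_le₀ (by linarith [norm_nonneg z])
  have hp := herglotzCot_im_pos (ht.trans_le hz)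
  replace d1 : ‖cauchySum S a z‖ ≤ L := d1.trans (mul_le_of_le_one_right hL hr1)
  replace d2 : ‖cauchySumDeriv S a z‖ ≤ L := d2.trans (mul_le_of_le_one_right hL hr1)
  have hX : ‖xFun S a z‖ ≤ Y := by
    rw [xFun, hY]
    refine norm_sub_le_of_le d2 ?_
    rw [norm_mul, norm_mul, norm_real, norm_real, Real.norm_eq_abs,
      Real.norm_of_nonneg Real.pi_pos.le]
    gcongr
    · exact h4.trans (by gcongr)
    · refine (norm_add_le _ _).trans ?_
      rw [norm_one, norm_pow]
      gcongr
  have hq := norm_qFormU_sub_le A B (j + 1) hM h4 h5 h1 (norm_nonneg _)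
  rw [← hZ] at hq
  set q := qFormU A B (j + 1) (uFun S a z) (vFun S a z) -
      herglotzCot z * qFormV B (j + 1) (uFun S a z) (vFun S a z)
  have hq' : ‖q‖ / ‖cauchySum S a z‖ ≤ Z * L ^ j := by
    refine div_le_of_le_mul₀ (norm_nonneg _) (by positivity) (hq.trans ?_)
    rw [pow_succ, ← mul_assoc]
    gcongr
  have hk : ‖(((j + 1 : ℕ) : ℂ) + 2) / Real.pi‖ = ((j + 1 : ℕ) + 2) / Real.pi := by
    have : (((j + 1 : ℕ) : ℂ) + 2) / Real.pi = (((j + 1 : ℕ) + 2) / Real.pi : ℝ) := by push_cast; rfl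
    rw [this, norm_real, Real.norm_of_nonneg (by positivity)]
  rw [wDbar, norm_div, norm_mul, norm_mul, norm_mul, hk, norm_div, norm_neg, norm_conj, norm_real,
    Real.norm_of_nonneg hp.le]
  calc _ = ((j + 1 : ℕ) + 2) / Real.pi * (‖xFun S a z‖ * ((herglotzCot z).im)⁻¹) *
        (‖q‖ / ‖cauchySum S a z‖) * ‖xFun S a z‖ := by ring
    _ ≤ _ := by gcongr

theorem integral_im_nonneg {α : Type*} [MeasurableSpace α] {μ : Measure α} {f : α → ℂ}
    (h : 0 ≤ᵐ[μ] fun x => (f x).im) : 0 ≤ (∫ x, f x ∂μ).im := by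
  by_cases hf : Integrable f μ
  · have := imCLM.integral_comp_comm hf
    simp only [imCLM_apply] at this
    rw [← this]
    exact integral_nonneg_of_ae h
  · rw [integral_undef hf]; simp

theorem intervalIntegral_im_nonneg {f : ℝ → ℂ} {x y : ℝ} (hxy : x ≤ y)
    (h : ∀ s ∈ Set.Ioc x y, 0 ≤ (f s).im) : 0 ≤ (∫ s in x..y, f s).im := by
  rw [intervalIntegral.integral_of_le hxy]
  exact integral_im_nonneg ((ae_restrict_iff' measurableSet_Ioc).2 (.of_forall h))

/-- Integrals of `Im wFun` along horizontal lines are almost nonnegative. -/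
theorem exists_integral_im_wFun_ge {A B : ℝ} {j : ℕ} (hQ : ∀ u v, 0 ≤ qReal A B (j + 1) u v)
    (h : ∃ m ∈ S, a m ≠ 0) {t : ℝ} (ht : 0 < t) : ∃ K : ℝ, ∀ R : ℝ, 0 < R →
      -(K / R) ≤ ∫ s in (-R)..R, (wFun S a A B (j + 1) (s + t * I)).im := by
  obtain ⟨K, hK, hd⟩ := exists_wFun_decay S a A B j ht
  refine ⟨4 * K, fun R hR => ?_⟩
  classical
  set f := wFun S a A B (j + 1) with hf
  set z : ℂ := ⟨-R, t⟩ with hz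
  set w : ℂ := ⟨R, t + R⟩ with hw
  have hRR : -R ≤ R := by linarith
  have htR : t ≤ t + R := by linarith
  set Q := Set.uIcc z.re w.re ×ℂ Set.uIcc z.im w.im with hQdef
  have hQe : Q = Set.Icc (-R) R ×ℂ Set.Icc t (t + R) := by
    rw [hQdef, Set.uIcc_of_le hRR, Set.uIcc_of_le htR]
  have hsub : ∀ x ∈ Q, t ≤ x.im := by
    intro x hx
    rw [hQe] at hx
    exact (mem_reProdIm.1 hx).2.1
  set f' : ℂ → ℂ →L[ℝ] ℂ := fun x => if cauchySum S a x = 0 then 0 else fderiv ℝ f x with hf'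
  have hg : ∀ x : ℂ, 0 < x.im → I • f' x 1 - f' x I = wDbar S a A B (j + 1) x := by
    intro x hx
    by_cases h0 : cauchySum S a x = 0
    · simp [hf', h0, wDbar]
    · simpa [hf', h0] using (hasDbar_wFun S a A B (j + 1) hx h0).fderiv_eq
  have hcompact : IsCompact Q := by
    rw [hQe]; exact isCompact_Icc.reProdIm isCompact_Icc
  have hrect := integral_boundary_rect_of_hasFDerivAt_real_off_countable f
    f' z w {z : ℂ | 0 < z.im ∧ cauchySum S a z = 0}
    (finite_cauchySum_zeros S a h).countable
    (fun x hx => (continuousAt_wFun S a A B j (ht.trans_le (hsub x hx))).continuousWithinAt)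
    (by
      intro x hx
      have hx1 : 0 < x.im := by
        have := (mem_reProdIm.1 hx.1).2.1
        rw [min_eq_left (show z.im ≤ w.im from htR)] at this
        exact ht.trans this
      have h0 : cauchySum S a x ≠ 0 := fun h0 => hx.2 ⟨hx1, h0⟩
      simp only [hf', h0, if_false]
      exact (hasDbar_wFun S a A B (j + 1) hx1 h0).differentiableAt.hasFDerivAt)
    (by
      obtain ⟨L, hL⟩ := exists_wDbar_bound S a A B j ht
      have h1 : IntegrableOn (wDbar S a A B (j + 1)) Q :=
        Measure.integrableOn_of_bounded hcompact.measure_lt_top.ne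
          (measurable_wDbar S a A B (j + 1)).aestronglyMeasurable
          ((ae_restrict_iff' hcompact.measurableSet).2 (.of_forall fun x hx => hL x (hsub x hx)))
      exact h1.congr_fun (fun x hx => (hg x (ht.trans_le (hsub x hx))).symm) hcompact.measurableSet)
  have hpos : 0 ≤ (∫ x : ℝ in z.re..w.re, ∫ y : ℝ in z.im..w.im,
      I • f' (x + y * I) 1 - f' (x + y * I) I).im := by
    refine intervalIntegral_im_nonneg hRR fun x _ => intervalIntegral_im_nonneg htR fun y hy => ?_
    have hy0 : 0 < (x + y * I : ℂ).im := by simpa using ht.trans hy.1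
    rw [hg _ hy0]
    exact wDbar_im_nonneg S a hQ hy0
  rw [← hrect] at hpos
  have hbd : ∀ x : ℂ, t ≤ x.im → R ≤ ‖x‖ → ‖f x‖ ≤ K / R ^ 2 := by
    intro x hx hxR
    refine (hd x hx).trans ?_
    rw [div_eq_mul_inv, inv_pow]
    gcongr
    linarith
  have eT : ‖∫ x : ℝ in z.re..w.re, f (x + w.im * I)‖ ≤ K / R ^ 2 * |R - -R| := by
    refine intervalIntegral.norm_integral_le_of_norm_le_const fun x _ => hbd _ ?_ ?_
    · simp [hw, hR.le]
    · refine le_trans ?_ (abs_im_le_norm _)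
      simp only [hw, add_im, ofReal_im, mul_im, ofReal_re, I_im, I_re, mul_one, mul_zero, add_zero,
        zero_add]
      rw [abs_of_pos (by linarith)]
      linarith
  have eR : ‖∫ y : ℝ in z.im..w.im, f (w.re + y * I)‖ ≤ K / R ^ 2 * |t + R - t| := by
    refine intervalIntegral.norm_integral_le_of_norm_le_const fun y hy => hbd _ ?_ ?_
    · rw [Set.uIoc_of_le htR] at hy
      simpa using hy.1.le
    · refine le_trans ?_ (abs_re_le_norm _)
      simp [hw, le_abs_self]
  have eL : ‖∫ y : ℝ in z.im..w.im, f (z.re + y * I)‖ ≤ K / R ^ 2 * |t + R - t| := by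
    refine intervalIntegral.norm_integral_le_of_norm_le_const fun y hy => hbd _ ?_ ?_
    · rw [Set.uIoc_of_le htR] at hy
      simpa using hy.1.le
    · refine le_trans ?_ (abs_re_le_norm _)
      simp [hz, le_abs_self]
  have hB : (∫ x : ℝ in z.re..w.re, f (x + z.im * I)).im = ∫ s in (-R)..R, (f (s + t * I)).im := by
    have hint : IntervalIntegrable (fun x : ℝ => f (x + t * I)) volume (-R) R := by
      refine Continuous.intervalIntegrable (continuous_iff_continuousAt.2 fun x => ?_) _ _
      have : ContinuousAt f (x + t * I) := continuousAt_wFun S a A B j (by simpa using ht)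
      exact ContinuousAt.comp (f := fun x : ℝ => (x + t * I : ℂ)) this (by fun_prop)
    exact (imCLM.intervalIntegral_comp_comm hint).symm
  rw [← hB]
  have a1 := (abs_le.1 ((abs_im_le_norm _).trans eT))
  have a2 := (abs_le.1 ((abs_re_le_norm _).trans eR))
  have a3 := (abs_le.1 ((abs_re_le_norm _).trans eL))
  rw [abs_of_pos (by linarith)] at a1 a2 a3
  simp only [sub_im, add_im, smul_eq_mul, I_mul_im] at hpos
  have e1 : K / R ^ 2 * (R - -R) = 2 * (K / R) := by field_simp; ring
  have e2 : K / R ^ 2 * (t + R - t) = K / R := by field_simp; ring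
  have e3 : 4 * K / R = 4 * (K / R) := by ring
  rw [e1] at a1
  rw [e2] at a2 a3
  rw [e3]
  linarith [a1.1, a2.2, a3.1]
end rect

end

section

open Complex MeasureTheory

theorem abs_le_of_abs_deriv_le {f f' : ℝ → ℝ} (h0 : f 0 = 0) (hf : ∀ y, HasDerivAt f (f' y) y)
    {x C : ℝ} (hC : ∀ y, |y| ≤ |x| → |f' y| ≤ C) : |f x| ≤ C * |x| := by
  have := (convex_closedBall (0 : ℝ) |x|).norm_image_sub_le_of_norm_hasDerivWithin_le
    (f := f) (f' := f') (C := C) (x := 0) (y := x) (fun y _ => (hf y).hasDerivWithinAt)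
    (fun y hy => hC y (by simpa using hy)) (by simp) (by simp)
  simpa [h0] using this

theorem abs_sin_sub_mul_cos_le (x : ℝ) : |Real.sin x - x * Real.cos x| ≤ x ^ 2 * |x| := by
  refine abs_le_of_abs_deriv_le (f := fun x => Real.sin x - x * Real.cos x)
    (f' := fun y => y * Real.sin y) (by simp) (fun y => ?_) fun y hy => ?_
  · refine ((Real.hasDerivAt_sin y).sub ((hasDerivAt_id y).mul (Real.hasDerivAt_cos y))).congr_deriv ?_
    simp
  · rw [abs_mul, ← sq_abs x, pow_two]
    exact mul_le_mul hy (Real.abs_sin_le_abs.trans hy) (abs_nonneg _) (abs_nonneg _)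

theorem abs_sub_sin_le (x : ℝ) : |x - Real.sin x| ≤ |x| * |x| := by
  refine abs_le_of_abs_deriv_le (f := fun x => x - Real.sin x)
    (f' := fun y => 1 - Real.cos y) (by simp)
    (fun y => (hasDerivAt_id y).sub (Real.hasDerivAt_sin y)) fun y hy => ?_
  rw [abs_of_nonneg (by linarith [Real.cos_le_one y])]
  refine le_trans ?_ hy
  rcases le_total |y| 2 with h | h
  · have := Real.one_sub_sq_div_two_le_cos (x := y)
    nlinarith [sq_abs y, abs_nonneg y]
  · linarith [Real.neg_one_le_cos y]

theorem abs_mul_cosh_sub_sinh_le (x : ℝ) :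
    |x * Real.cosh x - Real.sinh x| ≤ x ^ 2 * Real.cosh x * |x| := by
  refine abs_le_of_abs_deriv_le (f := fun x => x * Real.cosh x - Real.sinh x)
    (f' := fun y => y * Real.sinh y) (by simp) (fun y => ?_) fun y hy => ?_
  · refine (((hasDerivAt_id y).mul (Real.hasDerivAt_cosh y)).sub
      (Real.hasDerivAt_sinh y)).congr_deriv ?_
    simp
  · have h1 : |Real.sinh y| ≤ Real.cosh x * |y| := by
      refine abs_le_of_abs_deriv_le (f' := Real.cosh) (by simp) (Real.hasDerivAt_sinh) fun w hw => ?_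
      rw [abs_of_pos (Real.cosh_pos _)]
      exact Real.cosh_le_cosh.2 (hw.trans hy)
    rw [abs_mul]
    calc _ ≤ |y| * (Real.cosh x * |y|) := by gcongr
      _ ≤ |x| * (Real.cosh x * |x|) := by
        have := Real.cosh_pos x
        gcongr
      _ = _ := by rw [← sq_abs x]; ring

theorem sinh_le_mul_cosh {x : ℝ} (hx : 0 ≤ x) : Real.sinh x ≤ x * Real.cosh x := by
  have h : MonotoneOn (fun x => x * Real.cosh x - Real.sinh x) (Set.Ici 0) := by
    refine monotoneOn_of_hasDerivWithinAt_nonneg (f' := fun y => y * Real.sinh y) (convex_Ici 0)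
      (by fun_prop) (fun y _ => ?_) fun y hy => ?_
    · refine HasDerivAt.hasDerivWithinAt ((((hasDerivAt_id y).mul (Real.hasDerivAt_cosh y)).sub
        (Real.hasDerivAt_sinh y)).congr_deriv ?_)
      simp
    · rw [interior_Ici] at hy
      exact mul_nonneg hy.le (Real.sinh_nonneg_iff.2 hy.le)
  have := h (Set.mem_Ici.2 le_rfl) (Set.mem_Ici.2 hx) hx
  simpa using this

/-- The basic profile: `uFun` for a unit mass at the origin. -/
def uProfile (z : ℂ) : ℝ :=
  z.im / (Real.pi * normSq z) * (normSq (Complex.sin (Real.pi * z)) /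
    (Real.sinh (Real.pi * z.im) * Real.cosh (Real.pi * z.im)))

/-- `vFun` for a unit mass at the origin. -/
def vProfile (z : ℂ) : ℝ := (-(Real.pi * z)⁻¹ : ℂ).re - uProfile z * (herglotzCot z).re

/-- `xFun` for a unit mass at the origin. -/
def xProfile (z : ℂ) : ℂ :=
  (Real.pi * z ^ 2 : ℂ)⁻¹ - uProfile z * (Real.pi * (1 + herglotzCot z ^ 2))

theorem herglotzCot_sub_intCast (z : ℂ) (m : ℤ) : herglotzCot (z - m) = herglotzCot z := by
  have h : (Real.pi : ℂ) * (z - m) = Real.pi * z - m * Real.pi := by ring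
  rw [herglotzCot, herglotzCot, h, Complex.sin_antiperiodic.sub_int_mul_eq,
    Complex.cos_antiperiodic.sub_int_mul_eq]
  rcases Int.even_or_odd m with hm | hm
  · rw [Int.negOnePow_even m hm]; simp
  · rw [Int.negOnePow_odd m hm]; simp

theorem uProfile_eq (z : ℂ) : uProfile z = (-(Real.pi * z)⁻¹ : ℂ).im / (herglotzCot z).im := by
  rw [uProfile, herglotzCot_im, neg_im, inv_im, im_pi_mul, map_mul, normSq_ofReal]
  have := Real.pi_ne_zero
  rw [div_div_eq_mul_div, mul_div_assoc, ← neg_div, neg_neg]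
  congr 1
  rw [mul_assoc, mul_div_mul_left _ _ this]

theorem uFun_eq_sum (S : Finset ℤ) (a : ℤ → ℝ) (z : ℂ) :
    uFun S a z = ∑ m ∈ S, a m * uProfile (z - m) := by
  rw [uFun, cauchySum, im_sum, Finset.sum_div]
  refine Finset.sum_congr rfl fun m _ => ?_
  rw [im_ofReal_mul, uProfile_eq, herglotzCot_sub_intCast, ← mul_div_assoc]
  congr 1
  rw [← inv_neg, ← mul_neg, neg_sub, mul_inv, ← ofReal_inv, im_ofReal_mul]
  ring

theorem vFun_eq_sum (S : Finset ℤ) (a : ℤ → ℝ) (z : ℂ) :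
    vFun S a z = ∑ m ∈ S, a m * vProfile (z - m) := by
  rw [vFun, uFun_eq_sum, cauchySum, re_sum, Finset.sum_mul, ← Finset.sum_sub_distrib]
  refine Finset.sum_congr rfl fun m _ => ?_
  rw [re_ofReal_mul, vProfile, herglotzCot_sub_intCast, ← inv_neg, ← mul_neg, neg_sub, mul_inv,
    ← ofReal_inv, re_ofReal_mul]
  ring

theorem xFun_eq_sum (S : Finset ℤ) (a : ℤ → ℝ) (z : ℂ) :
    xFun S a z = ∑ m ∈ S, a m * xProfile (z - m) := by
  rw [xFun, uFun_eq_sum, cauchySumDeriv, ofReal_sum, Finset.sum_mul, ← Finset.sum_sub_distrib]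
  refine Finset.sum_congr rfl fun m _ => ?_
  rw [xProfile, herglotzCot_sub_intCast, mul_inv, ← neg_sub z, inv_neg, neg_sq, inv_pow]
  push_cast
  ring

section bounds
variable {z : ℂ}

theorem norm_sin_pi_mul_le (h0 : 0 ≤ z.im) :
    normSq (Complex.sin (Real.pi * z)) ≤ Real.pi ^ 2 * Real.cosh (Real.pi * z.im) ^ 2 * normSq z := by
  rw [normSq_sin, re_pi_mul, im_pi_mul, normSq_apply]
  have hτ : 0 ≤ Real.pi * z.im := by positivity
  have h1 := sinh_le_mul_cosh hτ
  have h2 := Real.one_le_cosh (Real.pi * z.im)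
  have h3 : Real.sinh (Real.pi * z.im) ^ 2 ≤ (Real.pi * z.im * Real.cosh (Real.pi * z.im)) ^ 2 := by
    have := Real.sinh_nonneg_iff.2 hτ
    gcongr
  have h4 : Real.sin (Real.pi * z.re) ^ 2 ≤ (Real.pi * z.re) ^ 2 :=
    sq_le_sq.2 Real.abs_sin_le_abs
  have h5 : (Real.pi * z.re) ^ 2 * 1 ≤ (Real.pi * z.re) ^ 2 * Real.cosh (Real.pi * z.im) ^ 2 := by
    gcongr; nlinarith
  nlinarith

theorem uProfile_nonneg (h0 : 0 ≤ z.im) : 0 ≤ uProfile z := by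
  have h1 : 0 ≤ Real.sinh (Real.pi * z.im) := Real.sinh_nonneg_iff.2 (by positivity)
  have h2 := Real.cosh_pos (Real.pi * z.im)
  have := normSq_nonneg z
  have := normSq_nonneg (Complex.sin (Real.pi * z))
  have := Real.pi_pos
  unfold uProfile
  positivity

/-- The factor `τ / (sinh τ cosh τ)`. -/
def kFactor (t : ℝ) : ℝ := Real.pi * t / (Real.sinh (Real.pi * t) * Real.cosh (Real.pi * t))

theorem kFactor_bounds {t : ℝ} (ht : 0 < t) : 0 ≤ kFactor t ∧ kFactor t ≤ 1 ∧
    1 - (Real.pi * t) ^ 2 ≤ kFactor t := by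
  have hτ : 0 < Real.pi * t := mul_pos Real.pi_pos ht
  have h1 : 0 < Real.sinh (Real.pi * t) := Real.sinh_pos_iff.2 hτ
  have h2 := Real.one_le_cosh (Real.pi * t)
  have h3 := Real.self_le_sinh_iff.2 hτ.le
  have h4 := sinh_le_mul_cosh hτ.le
  have h5 := Real.cosh_sq (Real.pi * t)
  unfold kFactor
  set τ := Real.pi * t
  set s := Real.sinh τ
  set c := Real.cosh τ
  refine ⟨by positivity, ?_, ?_⟩
  · rw [div_le_one (by positivity)]; nlinarith
  · rw [le_div_iff₀ (by positivity)]
    have h6 : s ^ 2 ≤ τ ^ 2 * c ^ 2 := by rw [← mul_pow]; gcongr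
    have h7 : (1 - τ ^ 2) * c ^ 2 ≤ 1 := by nlinarith
    rcases le_total (1 - τ ^ 2) 0 with h8 | h8
    · have : (1 - τ ^ 2) * (s * c) ≤ 0 := mul_nonpos_of_nonpos_of_nonneg h8 (by positivity)
      linarith
    · calc (1 - τ ^ 2) * (s * c) ≤ (1 - τ ^ 2) * (τ * c * c) := by gcongr
        _ = τ * ((1 - τ ^ 2) * c ^ 2) := by ring
        _ ≤ τ * 1 := by gcongr
        _ = τ := mul_one _

theorem uProfile_eq_kFactor (hz : 0 < z.im) :
    uProfile z = normSq (Complex.sin (Real.pi * z)) / (Real.pi ^ 2 * normSq z) * kFactor z.im := by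
  have h1 : 0 < Real.sinh (Real.pi * z.im) := Real.sinh_pos_iff.2 (mul_pos Real.pi_pos hz)
  have h2 := Real.cosh_pos (Real.pi * z.im)
  have h3 : 0 < normSq z := normSq_pos.2 fun h => by simp [h] at hz
  have := Real.pi_pos
  unfold uProfile kFactor
  field_simp

theorem uProfile_le (hz : 0 < z.im) : uProfile z ≤ Real.cosh (Real.pi * z.im) ^ 2 := by
  have h3 : 0 < normSq z := normSq_pos.2 fun h => by simp [h] at hz
  have := Real.pi_pos
  obtain ⟨k0, k1, -⟩ := kFactor_bounds hz
  rw [uProfile_eq_kFactor hz]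
  refine (mul_le_of_le_one_right ?_ k1).trans ?_
  · have := normSq_nonneg (Complex.sin (Real.pi * z)); positivity
  · rw [div_le_iff₀ (by positivity)]
    refine (norm_sin_pi_mul_le hz.le).trans_eq (by ring)

theorem vProfile_eq (hz : 0 < z.im) : vProfile z =
    (kFactor z.im * (Real.sin (Real.pi * z.re) * Real.cos (Real.pi * z.re)) - Real.pi * z.re) /
      (Real.pi ^ 2 * normSq z) := by
  have h3 : 0 < normSq z := normSq_pos.2 fun h => by simp [h] at hz
  have h4 := normSq_pos.2 (sin_pi_mul_ne_zero_of_im_pos hz)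
  have hc : (herglotzCot z).re = -(Real.sin (Real.pi * z.re) * Real.cos (Real.pi * z.re)) /
      normSq (Complex.sin (Real.pi * z)) := by
    rw [herglotzCot, inv_def, ← mul_assoc, ← neg_mul, re_mul_ofReal, div_eq_mul_inv]
    congr 1
    rw [neg_re, mul_re, conj_re, conj_im, complex_sin_re, complex_sin_im, complex_cos_re, complex_cos_im, re_pi_mul, im_pi_mul]
    linear_combination -Real.sin (Real.pi * z.re) * Real.cos (Real.pi * z.re) *
      Real.cosh_sq (Real.pi * z.im)
  rw [vProfile, hc, uProfile_eq_kFactor hz, neg_re, inv_re, re_pi_mul, map_mul, normSq_ofReal]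
  have := Real.pi_pos
  field_simp
  ring

theorem abs_vProfile_le (hz : 0 < z.im) : |vProfile z| ≤ 4 + Real.pi ^ 2 * z.im := by
  have h3 : 0 < normSq z := normSq_pos.2 fun h => by simp [h] at hz
  have hpi := Real.pi_pos
  obtain ⟨k0, k1, k2⟩ := kFactor_bounds hz
  rw [vProfile_eq hz, abs_div, abs_of_pos (by positivity : 0 < Real.pi ^ 2 * normSq z),
    div_le_iff₀ (by positivity)]
  set k := kFactor z.im
  set σ := Real.pi * z.re with hσ
  have h1 : |2 * σ - Real.sin (2 * σ)| ≤ |2 * σ| * |2 * σ| := abs_sub_sin_le _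
  rw [Real.sin_two_mul, abs_mul_abs_self] at h1
  have h2 : |Real.sin σ * Real.cos σ| ≤ |σ| := by
    rw [abs_mul]
    exact (mul_le_of_le_one_right (abs_nonneg _) (Real.abs_cos_le_one _)).trans Real.abs_sin_le_abs
  have e : k * (Real.sin σ * Real.cos σ) - σ = -(2 * σ - 2 * Real.sin σ * Real.cos σ) / 2 -
      (1 - k) * (Real.sin σ * Real.cos σ) := by ring
  have hn : normSq z = z.re ^ 2 + z.im ^ 2 := by rw [normSq_apply]; ring
  have h4 : (1 - k) * |Real.sin σ * Real.cos σ| ≤ (Real.pi * z.im) ^ 2 * |σ| := by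
    gcongr
    linarith
  have h5 : |σ| = Real.pi * |z.re| := by rw [hσ, abs_mul, abs_of_pos hpi]
  rw [e]
  refine (abs_sub _ _).trans ?_
  rw [abs_div, abs_neg, abs_mul (1 - k), abs_of_nonneg (by linarith : 0 ≤ 1 - k)]
  rw [abs_of_pos (by norm_num : (0:ℝ) < 2)]
  have h6 : z.im * |z.re| ≤ normSq z := by
    rw [hn, ← sq_abs z.re]; nlinarith [sq_nonneg (z.im - |z.re|), sq_nonneg (z.im + |z.re|)]
  have h7 : (Real.pi * z.im) ^ 2 * |σ| ≤ Real.pi ^ 2 * Real.pi * z.im * normSq z := by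
    rw [h5]
    calc _ = Real.pi ^ 2 * Real.pi * z.im * (z.im * |z.re|) := by ring
      _ ≤ _ := by gcongr
  have h8 : (2 * σ) * (2 * σ) / 2 ≤ 4 * (Real.pi ^ 2 * normSq z) := by
    rw [hn, hσ]; nlinarith [mul_nonneg (sq_nonneg Real.pi) (sq_nonneg z.re), mul_nonneg (sq_nonneg Real.pi) (sq_nonneg z.im)]
  have h9 : Real.pi ^ 2 * Real.pi * z.im * normSq z ≤ Real.pi ^ 2 * z.im * (Real.pi ^ 2 * normSq z) := by
    have : 0 ≤ Real.pi ^ 2 * z.im * normSq z := by positivity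
    nlinarith [mul_le_mul_of_nonneg_left (show Real.pi ≤ Real.pi ^ 2 by nlinarith [Real.pi_gt_three])
      this]
  linarith

/-- The numerator of `xProfile`. -/
def xNumer (z : ℂ) : ℂ :=
  (starRingEnd ℂ) z * Complex.sin (Real.pi * z) -
    kFactor z.im * (z * (starRingEnd ℂ) (Complex.sin (Real.pi * z)))

theorem xProfile_eq (hz : 0 < z.im) : xProfile z =
    xNumer z * (Real.pi * z ^ 2 * (starRingEnd ℂ) z * Complex.sin (Real.pi * z))⁻¹ := by
  have hs := sin_pi_mul_ne_zero_of_im_pos hz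
  have h0 : z ≠ 0 := fun h => by simp [h] at hz
  have h1 : (starRingEnd ℂ) z ≠ 0 := by simpa using h0
  have hpi : (Real.pi : ℂ) ≠ 0 := by simp [Real.pi_ne_zero]
  rw [xProfile, one_add_herglotzCot_sq hs, uProfile_eq_kFactor hz, xNumer]
  push_cast
  rw [← mul_conj, ← mul_conj]
  field_simp
  try ring

theorem im_conj_mul_sin (z : ℂ) :
    Real.pi * ((starRingEnd ℂ) z * Complex.sin (Real.pi * z)).im =
      (Real.pi * z.re) * Real.cos (Real.pi * z.re) * (Real.sinh (Real.pi * z.im) -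
        Real.pi * z.im * Real.cosh (Real.pi * z.im)) +
      Real.pi * z.im * Real.cosh (Real.pi * z.im) *
        (Real.pi * z.re * Real.cos (Real.pi * z.re) - Real.sin (Real.pi * z.re)) := by
  rw [mul_im, conj_re, conj_im, complex_sin_re, complex_sin_im, re_pi_mul, im_pi_mul]
  ring

theorem abs_im_conj_mul_sin_le (hz : 0 < z.im) {E : ℝ}
    (hE : |Real.sin (Real.pi * z.re) - Real.pi * z.re * Real.cos (Real.pi * z.re)| ≤ E) :
    |((starRingEnd ℂ) z * Complex.sin (Real.pi * z)).im| ≤ Real.cosh (Real.pi * z.im) *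
      (Real.pi ^ 3 * |z.re| * z.im ^ 3 + z.im * E) := by
  have hpi := Real.pi_pos
  refine le_of_mul_le_mul_left ?_ hpi
  rw [← abs_of_pos hpi, ← abs_mul, abs_of_pos hpi, im_conj_mul_sin]
  have h1 := abs_mul_cosh_sub_sinh_le (Real.pi * z.im)
  have hτ : 0 < Real.pi * z.im := by positivity
  have hc := Real.cosh_pos (Real.pi * z.im)
  rw [abs_of_pos hτ] at h1
  refine (abs_add_le _ _).trans ?_
  rw [abs_mul, abs_mul, abs_mul _ (_ - Real.sin _), abs_of_pos (mul_pos hτ hc),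
    abs_sub_comm _ (Real.sin _), abs_sub_comm (Real.sinh _), abs_mul Real.pi, abs_of_pos hpi]
  calc _ ≤ Real.pi * |z.re| * 1 * ((Real.pi * z.im) ^ 2 * Real.cosh (Real.pi * z.im) *
        (Real.pi * z.im)) + Real.pi * z.im * Real.cosh (Real.pi * z.im) * E := by
        gcongr
        exact Real.abs_cos_le_one _
    _ = _ := by ring

theorem norm_xNumer_le_of_split (hz : 0 < z.im) : ‖xNumer z‖ ≤
    2 * |((starRingEnd ℂ) z * Complex.sin (Real.pi * z)).im| +
      (Real.pi * z.im) ^ 2 * (‖z‖ * ‖Complex.sin (Real.pi * z)‖) := by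
  obtain ⟨k0, k1, k2⟩ := kFactor_bounds hz
  have e : xNumer z = ((2 * ((starRingEnd ℂ) z * Complex.sin (Real.pi * z)).im : ℝ) : ℂ) * I +
      ((1 - kFactor z.im : ℝ) : ℂ) * (z * (starRingEnd ℂ) (Complex.sin (Real.pi * z))) := by
    have := sub_conj ((starRingEnd ℂ) z * Complex.sin (Real.pi * z))
    rw [← this, xNumer, map_mul, conj_conj]
    push_cast
    ring
  rw [e]
  refine (norm_add_le _ _).trans ?_
  rw [norm_mul, norm_mul, norm_mul, norm_I, norm_real, norm_real, Real.norm_eq_abs, Real.norm_eq_abs,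
    RCLike.norm_conj, mul_one, abs_mul, abs_of_pos (by norm_num : (0:ℝ) < 2),
    abs_of_nonneg (by linarith : 0 ≤ 1 - kFactor z.im)]
  gcongr
  linarith

theorem norm_xNumer_le (hz : 0 < z.im) (hz1 : z.im ≤ 1) :
    ‖xNumer z‖ ≤ 7 * Real.pi ^ 3 * Real.cosh Real.pi * z.im * ‖z‖ ^ 3 ∧
    ‖xNumer z‖ ≤ 7 * Real.pi ^ 3 * Real.cosh Real.pi * z.im * ‖z‖ ^ 2 := by
  have hpi := Real.pi_gt_three
  have hpi0 := Real.pi_pos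
  have hH : Real.cosh (Real.pi * z.im) ≤ Real.cosh Real.pi := by
    rw [Real.cosh_le_cosh, abs_of_pos hpi0, abs_of_pos (by positivity)]
    nlinarith
  have hH0 := Real.cosh_pos (Real.pi * z.im)
  have hs : |z.re| ≤ ‖z‖ := abs_re_le_norm z
  have ht : z.im ≤ ‖z‖ := (le_abs_self _).trans (abs_im_le_norm z)
  have hS1 : ‖Complex.sin (Real.pi * z)‖ ≤ Real.pi * Real.cosh Real.pi * ‖z‖ := by
    refine le_trans ?_ (show Real.pi * Real.cosh (Real.pi * z.im) * ‖z‖ ≤ _ by gcongr)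
    rw [← sq_le_sq₀ (norm_nonneg _) (by positivity), ← normSq_eq_norm_sq, mul_pow, mul_pow,
      ← normSq_eq_norm_sq]
    exact norm_sin_pi_mul_le hz.le
  have hS2 : ‖Complex.sin (Real.pi * z)‖ ≤ Real.cosh Real.pi := by
    refine le_trans ?_ hH
    rw [← sq_le_sq₀ (norm_nonneg _) hH0.le, ← normSq_eq_norm_sq, normSq_sin, im_pi_mul,
      Real.cosh_sq, add_comm]
    gcongr
    exact Real.sin_sq_le_one _
  set H := Real.cosh Real.pi
  set t := z.im
  set r := ‖z‖
  set S := ‖Complex.sin (Real.pi * z)‖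
  have hr0 : 0 < r := hz.trans_le ht
  have hH1 : 0 < H := Real.cosh_pos _
  have hσ : |Real.pi * z.re| ≤ Real.pi * r := by rw [abs_mul, abs_of_pos hpi0]; gcongr
  have E1 : |Real.sin (Real.pi * z.re) - Real.pi * z.re * Real.cos (Real.pi * z.re)| ≤
      Real.pi ^ 3 * r ^ 3 := by
    refine (abs_sin_sub_mul_cos_le _).trans ?_
    rw [← sq_abs]
    calc _ ≤ (Real.pi * r) ^ 2 * (Real.pi * r) := by gcongr
      _ = _ := by ring
  have E2 : |Real.sin (Real.pi * z.re) - Real.pi * z.re * Real.cos (Real.pi * z.re)| ≤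
      2 * Real.pi ^ 2 * r ^ 2 := by
    set σ := Real.pi * z.re
    have h2 : σ ^ 2 ≤ Real.pi ^ 2 * r ^ 2 := by rw [← sq_abs, ← mul_pow]; gcongr
    have h3 : |Real.sin σ - σ * Real.cos σ| ≤ 2 * σ ^ 2 := by
      rcases le_total |σ| 1 with h | h
      · refine (abs_sin_sub_mul_cos_le _).trans ?_
        nlinarith [sq_nonneg σ]
      · refine (abs_sub _ _).trans ?_
        rw [abs_mul]
        have a1 := Real.abs_sin_le_one σ
        have a2 := Real.abs_cos_le_one σ
        nlinarith [sq_abs σ, abs_nonneg (Real.cos σ)]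
    linarith
  have F1 := abs_im_conj_mul_sin_le hz E1
  have F2 := abs_im_conj_mul_sin_le hz E2
  have hN := norm_xNumer_le_of_split hz
  constructor
  · calc ‖xNumer z‖ ≤ 2 * (H * (Real.pi ^ 3 * r * (t * r ^ 2) + t * (Real.pi ^ 3 * r ^ 3))) +
          (Real.pi ^ 2 * (t * r)) * (r * (Real.pi * H * r)) := by
          refine hN.trans (add_le_add (mul_le_mul_of_nonneg_left (F1.trans ?_) (by norm_num)) ?_)
          · have : t ^ 3 ≤ t * r ^ 2 := by
              calc t ^ 3 = t * t ^ 2 := by ring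
                _ ≤ _ := by gcongr
            gcongr
          · have : (Real.pi * t) ^ 2 ≤ Real.pi ^ 2 * (t * r) := by
              rw [mul_pow, pow_two t]; gcongr
            gcongr
      _ = 5 * (Real.pi ^ 3 * H * t * r ^ 3) := by ring
      _ ≤ 7 * (Real.pi ^ 3 * H * t * r ^ 3) := by gcongr; norm_num
      _ = _ := by ring
  · calc ‖xNumer z‖ ≤ 2 * (H * (Real.pi ^ 3 * r * (t * r) + t * (2 * Real.pi ^ 2 * r ^ 2))) +
          (Real.pi ^ 2 * (t * r)) * (r * H) := by
          refine hN.trans (add_le_add (mul_le_mul_of_nonneg_left (F2.trans ?_) (by norm_num)) ?_)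
          · have : t ^ 3 ≤ t * r := by
              calc t ^ 3 = t * (t * t) := by ring
                _ ≤ t * (1 * r) := by gcongr
                _ = _ := by ring
            gcongr
          · have : (Real.pi * t) ^ 2 ≤ Real.pi ^ 2 * (t * r) := by
              rw [mul_pow, pow_two t]; gcongr
            gcongr
      _ = 2 * (Real.pi ^ 3 * H * t * r ^ 2) + 5 * (Real.pi ^ 2 * H * t * r ^ 2) := by ring
      _ ≤ 2 * (Real.pi ^ 3 * H * t * r ^ 2) + 5 * (Real.pi ^ 3 * H * t * r ^ 2) := by
        gcongr <;> linarith
      _ = _ := by ring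

theorem exists_xProfile_bound : ∃ K : ℝ, 0 ≤ K ∧ ∀ z : ℂ, 0 < z.im → z.im ≤ 1 →
    ‖xProfile z‖ ^ 2 ≤ K * (z.im * (1 + ‖z‖ ^ 2)⁻¹) * (herglotzCot z).im := by
  refine ⟨2 * (7 * Real.pi ^ 3 * Real.cosh Real.pi) ^ 2, by positivity, fun z hz hz1 => ?_⟩
  obtain ⟨h1, h2⟩ := norm_xNumer_le hz hz1
  have hpi := Real.pi_gt_three
  have hpi0 := Real.pi_pos
  set H := 7 * Real.pi ^ 3 * Real.cosh Real.pi
  have hS : 0 < ‖Complex.sin (Real.pi * z)‖ := norm_pos_iff.2 (sin_pi_mul_ne_zero_of_im_pos hz)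
  have hsh : z.im ≤ Real.sinh (Real.pi * z.im) * Real.cosh (Real.pi * z.im) := by
    have a1 := Real.self_le_sinh_iff.2 (by positivity : 0 ≤ Real.pi * z.im)
    have a2 := Real.one_le_cosh (Real.pi * z.im)
    have a3 : z.im ≤ Real.sinh (Real.pi * z.im) := by nlinarith
    exact a3.trans (le_mul_of_one_le_right (hz.le.trans a3) a2)
  have hr : 0 < ‖z‖ := norm_pos_iff.2 fun h => by simp [h] at hz
  have hN : ‖xNumer z‖ ^ 2 * (1 + ‖z‖ ^ 2) ≤ 2 * H ^ 2 * z.im ^ 2 * ‖z‖ ^ 6 := by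
    have b1 : ‖xNumer z‖ ^ 2 ≤ (H * z.im * ‖z‖ ^ 3) ^ 2 := by gcongr
    have b2 : ‖xNumer z‖ ^ 2 ≤ (H * z.im * ‖z‖ ^ 2) ^ 2 := by gcongr
    have b3 : ‖xNumer z‖ ^ 2 * ‖z‖ ^ 2 ≤ (H * z.im * ‖z‖ ^ 2) ^ 2 * ‖z‖ ^ 2 := by gcongr
    nlinarith
  rw [xProfile_eq hz, herglotzCot_im, norm_mul, norm_inv, norm_mul, norm_mul, norm_mul, norm_pow,
    RCLike.norm_conj, norm_real, Real.norm_eq_abs, abs_of_pos hpi0, normSq_eq_norm_sq]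
  set S := ‖Complex.sin (Real.pi * z)‖
  rw [mul_pow, inv_pow, ← div_eq_mul_inv, div_le_iff₀ (by positivity)]
  have e : 2 * H ^ 2 * (z.im * (1 + ‖z‖ ^ 2)⁻¹) *
      (Real.sinh (Real.pi * z.im) * Real.cosh (Real.pi * z.im) / S ^ 2) *
      (Real.pi * ‖z‖ ^ 2 * ‖z‖ * S) ^ 2 = 2 * H ^ 2 * z.im * ‖z‖ ^ 6 * Real.pi ^ 2 *
      (Real.sinh (Real.pi * z.im) * Real.cosh (Real.pi * z.im)) * (1 + ‖z‖ ^ 2)⁻¹ := by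
    field_simp
  rw [e, le_mul_inv_iff₀ (by positivity)]
  refine hN.trans ?_
  calc 2 * H ^ 2 * z.im ^ 2 * ‖z‖ ^ 6 = 2 * H ^ 2 * z.im * ‖z‖ ^ 6 * 1 * z.im := by ring
    _ ≤ _ := by
      gcongr
      nlinarith
end bounds

end

section

open Complex MeasureTheory Filter Topology

section uniform
variable (S : Finset ℤ) (a : ℤ → ℝ)

theorem exists_uFun_vFun_uniform_bound : ∃ M : ℝ, 1 ≤ M ∧ ∀ z : ℂ, 0 < z.im → z.im ≤ 1 →
    |uFun S a z| ≤ M ∧ |vFun S a z| ≤ M := by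
  set H := Real.cosh Real.pi ^ 2 with hH
  set T := ∑ m ∈ S, |a m|
  have hT : 0 ≤ T := Finset.sum_nonneg fun _ _ => abs_nonneg _
  have hpi := Real.pi_pos
  have hb (f : ℂ → ℝ) (C : ℝ) (z : ℂ) (hf : ∀ m : ℤ, |f (z - m)| ≤ C) :
      |∑ m ∈ S, a m * f (z - m)| ≤ T * C := by
    refine (Finset.abs_sum_le_sum_abs _ _).trans ?_
    rw [Finset.sum_mul]
    refine Finset.sum_le_sum fun m _ => ?_
    rw [abs_mul]
    gcongr
    exact hf m
  have him (z : ℂ) (m : ℤ) : (z - m).im = z.im := by simp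
  refine ⟨1 + T * H + T * (4 + Real.pi ^ 2), ?_, fun z hz hz1 => ⟨?_, ?_⟩⟩
  · have : 0 ≤ T * H := by positivity
    have : 0 ≤ T * (4 + Real.pi ^ 2) := by positivity
    linarith
  · rw [uFun_eq_sum]
    refine (hb _ H z fun m => ?_).trans ?_
    · rw [abs_of_nonneg (uProfile_nonneg (by simpa using hz.le))]
      refine (uProfile_le (by simpa using hz)).trans ?_
      rw [him, hH]
      have := Real.cosh_pos (Real.pi * z.im)
      gcongr
      rw [Real.cosh_le_cosh, abs_of_pos hpi, abs_of_pos (by positivity)]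
      nlinarith
    · have : 0 ≤ T * (4 + Real.pi ^ 2) := by positivity
      linarith
  · rw [vFun_eq_sum]
    refine (hb _ (4 + Real.pi ^ 2) z fun m => ?_).trans ?_
    · refine (abs_vProfile_le (by simpa using hz)).trans ?_
      rw [him]
      nlinarith [sq_nonneg Real.pi]
    · have : 0 ≤ T * H := by positivity
      linarith

theorem exists_xFun_bound : ∃ K : ℝ, 0 ≤ K ∧ ∀ z : ℂ, 0 < z.im → z.im ≤ 1 →
    ‖xFun S a z‖ ^ 2 ≤
      K * (z.im * ∑ m ∈ S, (1 + ‖z - (m : ℂ)‖ ^ 2)⁻¹) * (herglotzCot z).im := by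
  obtain ⟨K, hK, h⟩ := exists_xProfile_bound
  set T := ∑ m ∈ S, |a m| ^ 2
  have hT : 0 ≤ T := Finset.sum_nonneg fun _ _ => by positivity
  refine ⟨T * K, by positivity, fun z hz hz1 => ?_⟩
  have h1 : ‖xFun S a z‖ ≤ ∑ m ∈ S, |a m| * ‖xProfile (z - m)‖ := by
    rw [xFun_eq_sum]
    refine (norm_sum_le _ _).trans_eq (Finset.sum_congr rfl fun m _ => ?_)
    rw [norm_mul, norm_real, Real.norm_eq_abs]
  calc ‖xFun S a z‖ ^ 2 ≤ (∑ m ∈ S, |a m| * ‖xProfile (z - m)‖) ^ 2 := by gcongr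
    _ ≤ T * ∑ m ∈ S, ‖xProfile (z - m)‖ ^ 2 := Finset.sum_mul_sq_le_sq_mul_sq _ _ _
    _ ≤ T * ∑ m ∈ S, K * (z.im * (1 + ‖z - (m : ℂ)‖ ^ 2)⁻¹) * (herglotzCot z).im := by
      gcongr with m _
      have := h (z - m) (by simpa using hz) (by simpa using hz1)
      rwa [herglotzCot_sub_intCast, show (z - (m : ℂ)).im = z.im by simp] at this
    _ = _ := by
      rw [← Finset.sum_mul, ← Finset.mul_sum, ← Finset.mul_sum]
      ring

theorem exists_im_wFun_le {A B : ℝ} {j : ℕ} (hQ : ∀ u v, 0 ≤ qReal A B (j + 1) u v) :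
    ∃ K : ℝ, 0 ≤ K ∧ ∀ z : ℂ, 0 < z.im → z.im ≤ 1 → (wFun S a A B (j + 1) z).im ≤
      A * (uFun S a z ^ (j + 2) * (herglotzCot z).im) -
        vFun S a z ^ (j + 2) * ((herglotzCot z).im / normSq (herglotzCot z)) +
      K * (z.im * ∑ m ∈ S, (1 + ‖z - (m : ℂ)‖ ^ 2)⁻¹) := by
  obtain ⟨M, hM, hb⟩ := exists_uFun_vFun_uniform_bound S a
  obtain ⟨K, hK, hx⟩ := exists_xFun_bound S a
  set K1 := (|A| + 1 + |B|) * (2 * M) ^ j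
  have hK1 : 0 ≤ K1 := by positivity
  set β := (((j + 1 : ℕ) : ℝ) + 2) / Real.pi with hβ
  refine ⟨K1 * (β ^ 2 * K / 4), by positivity, fun z hz hz1 => ?_⟩
  obtain ⟨hu, hv⟩ := hb z hz hz1
  have hh := herglotzCot_im_pos hz
  set G := z.im * ∑ m ∈ S, (1 + ‖z - (m : ℂ)‖ ^ 2)⁻¹ with hG
  have hG0 : 0 ≤ G := mul_nonneg hz.le (Finset.sum_nonneg fun _ _ => by positivity)
  rw [wFun, im_potential]
  refine add_le_add_right ?_ _
  rcases eq_or_ne (cauchySum S a z) 0 with h0 | h0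
  · have hu : uFun S a z = 0 := by simp [uFun, h0]
    have hv : vFun S a z = 0 := by simp [vFun, hu, h0]
    simp only [hu, hv, qReal]
    simp
    positivity
  · have h0' := h0
    rw [cauchySum_eq S a hz] at h0'
    have h1 := im_lamFactor (j + 1) (uFun S a z) (vFun S a z) (herglotzCot z)
      (cauchySumDeriv S a z) h0'
    rw [← cauchySum_eq S a hz, ← xFun] at h1
    have h2 := mul_sub_sq_le (y := ‖cauchySum S a z‖⁻¹) (x := ‖xFun S a z‖) (β := β)
      (hQ (uFun S a z) (vFun S a z)) (qReal_le_sq A B j hu hv) hh hK1 (by positivity)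
    calc _ ≤ _ := mul_le_mul_of_nonneg_left h1 (hQ _ _)
      _ ≤ _ := h2
      _ ≤ K1 * (β ^ 2 * (K * G * (herglotzCot z).im) / (4 * (herglotzCot z).im)) := by
        gcongr
        exact hx z hz hz1
      _ = _ := by field_simp

end uniform

section line
variable (S : Finset ℤ) (a : ℤ → ℝ) {t : ℝ}

theorem line_im (s t : ℝ) : ((s : ℂ) + t * I).im = t := by simp

theorem continuous_line (t : ℝ) : Continuous fun s : ℝ => (s : ℂ) + t * I := by fun_prop

theorem continuous_herglotzCot_line (ht : 0 < t) :
    Continuous fun s : ℝ => herglotzCot (s + t * I) := by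
  refine continuous_iff_continuousAt.2 fun s => ContinuousAt.comp (g := herglotzCot) ?_
    (continuous_line t).continuousAt
  exact (hasDerivAt_herglotzCot (sin_pi_mul_ne_zero_of_im_pos (by simpa using ht))).continuousAt

theorem continuous_cauchySum_line (ht : 0 < t) :
    Continuous fun s : ℝ => cauchySum S a (s + t * I) := by
  refine continuous_iff_continuousAt.2 fun s => ContinuousAt.comp (g := cauchySum S a) ?_
    (continuous_line t).continuousAt
  exact (hasDerivAt_cauchySum S a (by simpa using ht)).continuousAt

theorem continuous_uFun_line (ht : 0 < t) : Continuous fun s : ℝ => uFun S a (s + t * I) := by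
  unfold uFun
  refine (continuous_im.comp (continuous_cauchySum_line S a ht)).div
    (continuous_im.comp (continuous_herglotzCot_line ht)) fun s => ?_
  exact (herglotzCot_im_pos (by simpa using ht)).ne'

theorem continuous_vFun_line (ht : 0 < t) : Continuous fun s : ℝ => vFun S a (s + t * I) := by
  unfold vFun
  exact (continuous_re.comp (continuous_cauchySum_line S a ht)).sub
    ((continuous_uFun_line S a ht).mul (continuous_re.comp (continuous_herglotzCot_line ht)))

theorem continuous_wFun_line (A B : ℝ) (j : ℕ) (ht : 0 < t) :
    Continuous fun s : ℝ => wFun S a A B (j + 1) (s + t * I) :=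
  continuous_iff_continuousAt.2 fun s => ContinuousAt.comp (g := wFun S a A B (j + 1))
    (continuousAt_wFun S a A B j (by simpa using ht)) (continuous_line t).continuousAt

theorem integral_inv_one_add_sq_le (m t : ℝ) (x y : ℝ) (hxy : x ≤ y) :
    ∫ s in x..y, (1 + ‖(s : ℂ) + t * I - m‖ ^ 2)⁻¹ ≤ Real.pi := by
  have h1 : ∫ s in x..y, (1 + ‖(s : ℂ) + t * I - m‖ ^ 2)⁻¹ ≤
      ∫ s in x..y, (1 + (s - m) ^ 2)⁻¹ := by
    refine intervalIntegral.integral_mono_on hxy ?_ ?_ fun s _ => ?_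
    · refine Continuous.intervalIntegrable (Continuous.inv₀ (by fun_prop) fun s => ?_) _ _
      positivity
    · refine Continuous.intervalIntegrable (Continuous.inv₀ (by fun_prop) fun s => ?_) _ _
      positivity
    · have : (s - m) ^ 2 ≤ ‖(s : ℂ) + t * I - m‖ ^ 2 := by
        rw [← normSq_eq_norm_sq, normSq_apply]
        simp
        nlinarith [mul_self_nonneg t]
      gcongr
  refine h1.trans ?_
  rw [intervalIntegral.integral_comp_sub_right (fun s => (1 + s ^ 2)⁻¹), integral_inv_one_add_sq]
  linarith [Real.arctan_lt_pi_div_two (y - m), Real.neg_pi_div_two_lt_arctan (x - m)]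

theorem exists_integral_vFun_le {A B : ℝ} {j : ℕ} (hQ : ∀ u v, 0 ≤ qReal A B (j + 1) u v)
    (h : ∃ m ∈ S, a m ≠ 0) : ∃ K : ℝ, 0 ≤ K ∧ ∀ t : ℝ, 0 < t → t ≤ 1 → ∃ R0 : ℝ, ∀ R, R0 ≤ R →
      ∫ s in (-R)..R, vFun S a (s + t * I) ^ (j + 2) *
        ((herglotzCot (s + t * I)).im / normSq (herglotzCot (s + t * I))) ≤
      A * (∫ s in (-R)..R, uFun S a (s + t * I) ^ (j + 2) * (herglotzCot (s + t * I)).im) +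
        K * t := by
  obtain ⟨K, hK, hle⟩ := exists_im_wFun_le S a hQ
  refine ⟨K * (S.card * Real.pi) + 1, by positivity, fun t ht ht1 => ?_⟩
  obtain ⟨K1, hge⟩ := exists_integral_im_wFun_ge S a hQ h ht
  refine ⟨max 1 (K1 / t), fun R hR => ?_⟩
  have hR1 : 1 ≤ R := (le_max_left _ _).trans hR
  have hR0 : 0 < R := by linarith
  have hR2 : K1 / R ≤ t := by
    rw [div_le_comm₀ hR0 ht]
    exact (le_max_right _ _).trans hR
  have hRR : -R ≤ R := by linarith
  have hnz (s : ℝ) : normSq (herglotzCot (s + t * I)) ≠ 0 :=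
    (normSq_pos.2 (herglotzCot_ne_zero (by simpa using ht))).ne'
  have c1 := continuous_herglotzCot_line ht
  have c2 := continuous_uFun_line S a ht
  have c3 := continuous_vFun_line S a ht
  have i1 : IntervalIntegrable (fun s : ℝ => vFun S a (s + t * I) ^ (j + 2) *
      ((herglotzCot (s + t * I)).im / normSq (herglotzCot (s + t * I)))) volume (-R) R :=
    ((c3.pow _).mul ((continuous_im.comp c1).div (continuous_normSq.comp c1)
      hnz)).intervalIntegrable _ _
  have i2 : IntervalIntegrable (fun s : ℝ => A * (uFun S a (s + t * I) ^ (j + 2) *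
      (herglotzCot (s + t * I)).im)) volume (-R) R :=
    (continuous_const.mul ((c2.pow _).mul (continuous_im.comp c1))).intervalIntegrable _ _
  have i3 (m : ℤ) : IntervalIntegrable (fun s : ℝ => (1 + ‖(s : ℂ) + t * I - m‖ ^ 2)⁻¹)
      volume (-R) R := by
    refine Continuous.intervalIntegrable (Continuous.inv₀ (by fun_prop) fun s => ?_) _ _
    positivity
  have i4 : IntervalIntegrable (fun s : ℝ => K * (t * ∑ m ∈ S,
      (1 + ‖(s : ℂ) + t * I - m‖ ^ 2)⁻¹)) volume (-R) R :=
    (IntervalIntegrable.sum S fun m _ => i3 m).const_mul t |>.const_mul K |>.congr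
      (fun s _ => by simp)
  have key : ∫ s in (-R)..R, (wFun S a A B (j + 1) (s + t * I)).im ≤
      ∫ s in (-R)..R, (A * (uFun S a (s + t * I) ^ (j + 2) * (herglotzCot (s + t * I)).im) -
        vFun S a (s + t * I) ^ (j + 2) *
          ((herglotzCot (s + t * I)).im / normSq (herglotzCot (s + t * I))) +
        K * (t * ∑ m ∈ S, (1 + ‖(s : ℂ) + t * I - m‖ ^ 2)⁻¹)) := by
    refine intervalIntegral.integral_mono_on hRR
      ((continuous_im.comp (continuous_wFun_line S a A B j ht)).intervalIntegrable _ _)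
      ((i2.sub i1).add i4) fun s _ => ?_
    have := hle (s + t * I) (by simpa using ht) (by simpa using ht1)
    rwa [line_im] at this
  rw [intervalIntegral.integral_add (i2.sub i1) i4, intervalIntegral.integral_sub i2 i1,
    intervalIntegral.integral_const_mul, intervalIntegral.integral_const_mul,
    intervalIntegral.integral_const_mul, intervalIntegral.integral_finsetSum fun m _ => i3 m] at key
  have h5 : ∑ m ∈ S, ∫ s in (-R)..R, (1 + ‖(s : ℂ) + t * I - m‖ ^ 2)⁻¹ ≤ S.card * Real.pi := by
    rw [← nsmul_eq_mul]
    refine Finset.sum_le_card_nsmul _ _ _ fun m _ => ?_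
    simpa using integral_inv_one_add_sq_le m t (-R) R hRR
  have h6 : K * (t * ∑ m ∈ S, ∫ s in (-R)..R, (1 + ‖(s : ℂ) + t * I - m‖ ^ 2)⁻¹) ≤
      K * (t * (S.card * Real.pi)) := by gcongr
  have h7 := hge R hR0
  linarith

end line

end

section

open Complex MeasureTheory Filter Topology

/-- The Poisson kernel of the upper half plane. -/
def poissonKer (y x : ℝ) : ℝ := Real.pi⁻¹ * (y / (x ^ 2 + y ^ 2))

theorem integral_poissonKer_mul {y : ℝ} (hy : 0 < y) (x : ℝ) (f : ℝ → ℝ) :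
    ∫ s, poissonKer y (s - x) * f s = ∫ r, Real.pi⁻¹ * (1 + r ^ 2)⁻¹ * f (x + y * r) := by
  have h1 : ∫ s, poissonKer y (s - x) * f s = ∫ s, poissonKer y s * f (x + s) := by
    rw [← integral_add_left_eq_self (fun s => poissonKer y (s - x) * f s) x]
    simp
  have h2 := Measure.integral_comp_mul_left (fun s => poissonKer y s * f (x + s)) y
  rw [abs_of_pos (inv_pos.2 hy), smul_eq_mul, eq_inv_mul_iff_mul_eq₀ hy.ne',
    ← integral_const_mul] at h2
  rw [h1, ← h2]
  refine integral_congr_ae (Eventually.of_forall fun r => ?_)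
  have : (0:ℝ) < 1 + r ^ 2 := by positivity
  have e : (y * r) ^ 2 + y ^ 2 = y ^ 2 * (1 + r ^ 2) := by ring
  simp only [poissonKer, e]
  field_simp

theorem integrable_cauchy : Integrable fun r : ℝ => Real.pi⁻¹ * (1 + r ^ 2)⁻¹ :=
  integrable_inv_one_add_sq.const_mul _

theorem integral_cauchy : ∫ r : ℝ, Real.pi⁻¹ * (1 + r ^ 2)⁻¹ = 1 := by
  rw [integral_const_mul, integral_univ_inv_one_add_sq, inv_mul_cancel₀ Real.pi_ne_zero]

theorem integrable_poissonKer {y : ℝ} (hy : 0 < y) (x : ℝ) :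
    Integrable fun s => poissonKer y (s - x) := by
  refine Integrable.comp_sub_right (f := poissonKer y) ?_ x
  refine ((integrable_inv_one_add_sq.comp_div hy.ne').const_mul (Real.pi⁻¹ * y⁻¹)).congr
    (Eventually.of_forall fun s => ?_)
  simp only [poissonKer]
  field_simp
  ring

theorem tendsto_integral_poissonKer {ι : Type*} {l : Filter ι} [l.IsCountablyGenerated]
    {y : ι → ℝ} {f : ι → ℝ → ℝ} {x L M : ℝ} (hy : ∀ᶠ t in l, 0 < y t)
    (hf : ∀ᶠ t in l, Measurable (f t)) (hM : ∀ᶠ t in l, ∀ s, |f t s| ≤ M)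
    (hL : ∀ r : ℝ, Tendsto (fun t => f t (x + y t * r)) l (𝓝 L)) :
    Tendsto (fun t => ∫ s, poissonKer (y t) (s - x) * f t s) l (𝓝 L) := by
  have h1 : Tendsto (fun t => ∫ r, Real.pi⁻¹ * (1 + r ^ 2)⁻¹ * f t (x + y t * r)) l
      (𝓝 (∫ r : ℝ, Real.pi⁻¹ * (1 + r ^ 2)⁻¹ * L)) := by
    refine tendsto_integral_filter_of_dominated_convergence
      (fun r => Real.pi⁻¹ * (1 + r ^ 2)⁻¹ * M) ?_ ?_ (integrable_cauchy.mul_const M) ?_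
    · filter_upwards [hf] with t ht
      exact (by fun_prop : Measurable _).aestronglyMeasurable
    · filter_upwards [hM] with t ht
      refine Eventually.of_forall fun r => ?_
      have := Real.pi_pos
      rw [norm_mul, Real.norm_eq_abs, Real.norm_eq_abs, abs_of_nonneg (by positivity)]
      gcongr
      exact ht _
    · exact Eventually.of_forall fun r => (hL r).const_mul _
  rw [integral_mul_const, integral_cauchy, one_mul] at h1
  refine h1.congr' ?_
  filter_upwards [hy] with t ht
  rw [integral_poissonKer_mul ht]

section boundary

theorem tendsto_kFactor : Tendsto kFactor (𝓝[>] 0) (𝓝 1) := by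
  have h : Tendsto (fun t : ℝ => 1 - (Real.pi * t) ^ 2) (𝓝[>] 0) (𝓝 1) := by
    have : Continuous fun t : ℝ => 1 - (Real.pi * t) ^ 2 := by fun_prop
    simpa using (this.tendsto 0).mono_left nhdsWithin_le_nhds
  refine tendsto_of_tendsto_of_tendsto_of_le_of_le' h tendsto_const_nhds ?_ ?_
  · filter_upwards [self_mem_nhdsWithin] with t ht using (kFactor_bounds ht).2.2
  · filter_upwards [self_mem_nhdsWithin] with t ht using (kFactor_bounds ht).2.1

theorem tendsto_kFactor_im (x : ℝ) :
    Tendsto (fun z : ℂ => kFactor z.im) (𝓝[{z | 0 < z.im}] x) (𝓝 1) := by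
  refine tendsto_kFactor.comp (tendsto_nhdsWithin_iff.2 ⟨?_, ?_⟩)
  · simpa using (continuous_im.tendsto (x : ℂ)).mono_left nhdsWithin_le_nhds
  · filter_upwards [self_mem_nhdsWithin] with z hz using hz

theorem tendsto_uProfile (n : ℤ) :
    Tendsto uProfile (𝓝[{z | 0 < z.im}] (n : ℂ)) (𝓝 (if n = 0 then 1 else 0)) := by
  have hk := tendsto_kFactor_im n
  have hs : Continuous fun z : ℂ => normSq (Complex.sin (Real.pi * z)) :=
    continuous_normSq.comp (by fun_prop)
  suffices h : Tendsto (fun z : ℂ => normSq (Complex.sin (Real.pi * z)) / (Real.pi ^ 2 * normSq z))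
      (𝓝[{z | 0 < z.im}] (n : ℂ)) (𝓝 (if n = 0 then 1 else 0)) by
    have h2 := h.mul hk
    rw [mul_one] at h2
    refine h2.congr' ?_
    filter_upwards [self_mem_nhdsWithin] with z hz
    rw [uProfile_eq_kFactor hz]
  split_ifs with hn
  · subst hn
    have hd : HasDerivAt (fun z : ℂ => Complex.sin (Real.pi * z)) (Real.pi : ℂ) 0 := by
      have := (((hasDerivAt_id (0 : ℂ)).const_mul (Real.pi : ℂ))).csin
      simpa using this
    have h1 := continuous_normSq.continuousAt.tendsto.comp hd.tendsto_slope
    have h2 := (h1.div_const (Real.pi ^ 2)).mono_left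
      (nhdsWithin_mono (0 : ℂ) (s := {z : ℂ | 0 < z.im}) fun z hz h => by
        simp only [Set.mem_singleton_iff] at h
        simp [h] at hz)
    have e : normSq (Real.pi : ℂ) / Real.pi ^ 2 = 1 := by
      rw [normSq_ofReal, ← pow_two, div_self (by positivity)]
    rw [e] at h2
    simp only [Int.cast_zero]
    refine h2.congr fun z => ?_
    simp only [Function.comp_apply, slope_def_field, map_div₀, mul_zero, Complex.sin_zero, sub_zero]
    rw [div_div, mul_comm (normSq z)]
  · have hnz : normSq (n : ℂ) ≠ 0 := by simpa using hn
    have h0 : Complex.sin (Real.pi * (n : ℂ)) = 0 := by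
      rw [mul_comm]; exact Complex.sin_int_mul_pi n
    have := (hs.tendsto (n : ℂ)).div ((continuous_const (y := Real.pi ^ 2)).mul
      continuous_normSq |>.tendsto (n : ℂ)) (mul_ne_zero (by positivity) hnz)
    rw [h0, map_zero, zero_div] at this
    exact this.mono_left nhdsWithin_le_nhds

variable (S : Finset ℤ) (a : ℤ → ℝ)

theorem tendsto_uFun {n : ℤ} (hn : n ∈ S) :
    Tendsto (uFun S a) (𝓝[{z | 0 < z.im}] (n : ℂ)) (𝓝 (a n)) := by
  have h (m : ℤ) : Tendsto (fun z : ℂ => a m * uProfile (z - m)) (𝓝[{z | 0 < z.im}] (n : ℂ))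
      (𝓝 (a m * if n - m = 0 then 1 else 0)) := by
    refine Tendsto.const_mul _ ((tendsto_uProfile (n - m)).comp (tendsto_nhdsWithin_iff.2 ⟨?_, ?_⟩))
    · push_cast
      exact ((continuous_id.sub continuous_const).tendsto (n : ℂ)).mono_left nhdsWithin_le_nhds
    · filter_upwards [self_mem_nhdsWithin] with z hz
      simpa using hz
  have := tendsto_finsetSum S fun m _ => h m
  simp only [sub_eq_zero, mul_ite, mul_one, mul_zero, Finset.sum_ite_eq, hn, if_true] at this
  exact this.congr fun z => (uFun_eq_sum S a z).symm

theorem half_int_ne (m n : ℤ) : (m : ℂ) - ((n : ℂ) + 1 / 2) ≠ 0 := by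
  intro h
  have h1 : ((2 * (m - n) - 1 : ℤ) : ℂ) = 0 := by push_cast; linear_combination 2 * h
  have := Int.cast_eq_zero.1 h1
  omega

theorem tendsto_vFun (n : ℤ) :
    Tendsto (vFun S a) (𝓝[{z | 0 < z.im}] ((n : ℂ) + 1 / 2))
      (𝓝 (cauchySum S a ((n : ℂ) + 1 / 2)).re) := by
  obtain ⟨M, -, hM⟩ := exists_uFun_vFun_uniform_bound S a
  have hc : ContinuousAt (cauchySum S a) ((n : ℂ) + 1 / 2) :=
    (HasDerivAt.fun_sum fun m _ =>
      (hasDerivAt_inv_intCast_sub m (half_int_ne m n)).const_mul _).continuousAt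
  have e : (Real.pi : ℂ) * ((n : ℂ) + 1 / 2) = n * Real.pi + Real.pi / 2 := by ring
  have hcos : Complex.cos (Real.pi * ((n : ℂ) + 1 / 2)) = 0 := by
    rw [e, Complex.cos_add_pi_div_two, Complex.sin_int_mul_pi, neg_zero]
  have hsin : Complex.sin (Real.pi * ((n : ℂ) + 1 / 2)) ≠ 0 := fun h => by
    have := Complex.sin_sq_add_cos_sq (Real.pi * ((n : ℂ) + 1 / 2))
    rw [h, hcos] at this
    norm_num at this
  have hcot : Tendsto (fun z => (herglotzCot z).re) (𝓝[{z | 0 < z.im}] ((n : ℂ) + 1 / 2)) (𝓝 0) := by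
    have h1 := continuous_re.continuousAt.tendsto.comp (hasDerivAt_herglotzCot hsin).continuousAt
    have h2 : herglotzCot ((n : ℂ) + 1 / 2) = 0 := by rw [herglotzCot, hcos]; simp
    rw [h2, zero_re] at h1
    exact h1.mono_left nhdsWithin_le_nhds
  have hu : Tendsto (fun z => uFun S a z * (herglotzCot z).re)
      (𝓝[{z | 0 < z.im}] ((n : ℂ) + 1 / 2)) (𝓝 0) := by
    refine bdd_le_mul_tendsto_zero' M ?_ hcot
    have him : Tendsto (fun z : ℂ => z.im) (𝓝 ((n : ℂ) + 1 / 2)) (𝓝 0) := by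
      have := continuous_im.tendsto ((n : ℂ) + 1 / 2)
      simpa using this
    filter_upwards [self_mem_nhdsWithin, nhdsWithin_le_nhds (him.eventually (ge_mem_nhds zero_lt_one))]
      with z hz hz1 using (hM z hz hz1).1
  have := ((continuous_re.continuousAt.tendsto.comp hc).mono_left
    (nhdsWithin_le_nhds (s := {z : ℂ | 0 < z.im}))).sub hu
  rw [sub_zero] at this
  exact this

end boundary

end

section

open Complex MeasureTheory Filter Topology

section
variable (S : Finset ℤ) (a : ℤ → ℝ)

theorem poissonKer_le_herglotzCot {t : ℝ} (ht : 0 < t) (n : ℤ) (s : ℝ) :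
    poissonKer (Real.sinh (Real.pi * t) / Real.pi) (s - (n + 1 / 2)) ≤
      (herglotzCot (s + t * I)).im / normSq (herglotzCot (s + t * I)) := by
  have hz : 0 < ((s : ℂ) + t * I).im := by simpa using ht
  have hpi := Real.pi_pos
  have hs := normSq_pos.2 (sin_pi_mul_ne_zero_of_im_pos hz)
  have hc := normSq_pos.2 (cos_pi_mul_ne_zero_of_im_pos hz)
  have hsh : 0 < Real.sinh (Real.pi * t) := Real.sinh_pos_iff.2 (by positivity)
  have hch := Real.one_le_cosh (Real.pi * t)
  rw [herglotzCot_im, normSq_herglotzCot, div_div_div_cancel_right₀ hs.ne', line_im]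
  have hre : ((s : ℂ) + t * I).re = s := by simp
  have hcos : Real.cos (Real.pi * s) ^ 2 ≤ (Real.pi * (s - (n + 1 / 2))) ^ 2 := by
    have e : Real.pi * s = Real.pi * (s - (n + 1 / 2)) + Real.pi / 2 + n * Real.pi := by ring
    rw [e, Real.cos_add_int_mul_pi, Real.cos_add_pi_div_two, mul_pow, neg_sq, ← zpow_natCast,
      ← zpow_mul, mul_comm n, zpow_mul]
    norm_num
    exact sq_le_sq.2 Real.abs_sin_le_abs
  have hb : normSq (Complex.cos (Real.pi * (s + t * I))) ≤
      (Real.pi * (s - (n + 1 / 2))) ^ 2 + Real.sinh (Real.pi * t) ^ 2 := by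
    rw [normSq_cos, re_pi_mul, im_pi_mul, hre, line_im]
    linarith
  have e : poissonKer (Real.sinh (Real.pi * t) / Real.pi) (s - (n + 1 / 2)) =
      Real.sinh (Real.pi * t) * 1 / ((Real.pi * (s - (n + 1 / 2))) ^ 2 + Real.sinh (Real.pi * t) ^ 2) := by
    rw [poissonKer, div_pow]
    have h1 : (s - ((n : ℝ) + 1 / 2)) ^ 2 + Real.sinh (Real.pi * t) ^ 2 / Real.pi ^ 2 =
      ((Real.pi * (s - (n + 1 / 2))) ^ 2 + Real.sinh (Real.pi * t) ^ 2) / Real.pi ^ 2 := by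
      field_simp
    rw [h1]
    field_simp
  rw [e]
  gcongr

theorem cauchySum_line_im (s t : ℝ) :
    (cauchySum S a (s + t * I)).im = ∑ m ∈ S, a m * poissonKer t (s - m) := by
  rw [cauchySum, im_sum]
  refine Finset.sum_congr rfl fun m _ => ?_
  rw [im_ofReal_mul, inv_im, normSq_apply, poissonKer]
  simp
  ring

theorem abs_pow_le_of_abs_le {x M : ℝ} (h : |x| ≤ M) (k : ℕ) : |x ^ k| ≤ M ^ k := by
  rw [abs_pow]; gcongr

/-- The restriction of a power of `vFun` to a window around `n + 1/2`. -/
def vWindow (k : ℕ) (n : ℤ) (t s : ℝ) : ℝ :=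
  (Set.Icc ((n : ℝ) + 1 / 4) (n + 3 / 4)).indicator (fun s : ℝ => vFun S a (s + t * I) ^ k) s

theorem measurable_vWindow (k : ℕ) (n : ℤ) {t : ℝ} (ht : 0 < t) :
    Measurable (vWindow S a k n t) :=
  ((continuous_vFun_line S a ht).pow k).measurable.indicator measurableSet_Icc

theorem abs_vWindow_le {k : ℕ} {n : ℤ} {t M : ℝ} (hM : ∀ s : ℝ, |vFun S a (s + t * I)| ≤ M)
    (s : ℝ) : |vWindow S a k n t s| ≤ M ^ k := by
  rw [vWindow]
  by_cases h : s ∈ Set.Icc ((n : ℝ) + 1 / 4) (n + 3 / 4)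
  · rw [Set.indicator_of_mem h]
    exact abs_pow_le_of_abs_le (hM s) k
  · rw [Set.indicator_of_notMem h, abs_zero]
    exact pow_nonneg ((abs_nonneg _).trans (hM 0)) k

theorem integrable_poissonKer_mul {y x M : ℝ} {f : ℝ → ℝ} (hy : 0 < y) (hf : Measurable f)
    (hM : ∀ s, |f s| ≤ M) : Integrable fun s => poissonKer y (s - x) * f s :=
  (integrable_poissonKer hy x).mul_bdd (c := M) hf.aestronglyMeasurable (Eventually.of_forall hM)

theorem sum_vWindow_le {j : ℕ} (hj : Even j) (F : Finset ℤ) {t R : ℝ} (ht : 0 < t)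
    (hR : ∀ n ∈ F, |(n : ℝ)| + 1 ≤ R) (s : ℝ) :
    ∑ n ∈ F, poissonKer (Real.sinh (Real.pi * t) / Real.pi) (s - (n + 1 / 2)) *
      vWindow S a (j + 2) n t s ≤ (Set.Ioc (-R) R).indicator (fun s => vFun S a (s + t * I) ^ (j + 2) *
        ((herglotzCot (s + t * I)).im / normSq (herglotzCot (s + t * I)))) s := by
  have hj2 : Even (j + 2) := hj.add even_two
  have hz : 0 < ((s : ℂ) + t * I).im := by simpa using ht
  have hpos : 0 ≤ (herglotzCot (s + t * I)).im / normSq (herglotzCot (s + t * I)) :=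
    div_nonneg (herglotzCot_im_pos hz).le (normSq_nonneg _)
  by_cases h : ∃ n ∈ F, s ∈ Set.Icc ((n : ℝ) + 1 / 4) (n + 3 / 4)
  · obtain ⟨n, hn, hs⟩ := h
    rw [Finset.sum_eq_single_of_mem n hn]
    · have hnR := hR n hn
      have hsR : s ∈ Set.Ioc (-R) R :=
        ⟨by linarith [hs.1, neg_abs_le (n : ℝ)], by linarith [hs.2, le_abs_self (n : ℝ)]⟩
      rw [Set.indicator_of_mem hsR, vWindow, Set.indicator_of_mem hs, mul_comm]
      exact mul_le_mul_of_nonneg_left (poissonKer_le_herglotzCot ht n s) (hj2.pow_nonneg _)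
    · intro m _ hmn
      rw [vWindow, Set.indicator_of_notMem, mul_zero]
      intro hs'
      apply hmn
      have h1 : (m : ℝ) < n + 1 := by linarith [hs'.1, hs.2]
      have h2 : (n : ℝ) < m + 1 := by linarith [hs.1, hs'.2]
      have h1' : m < n + 1 := by exact_mod_cast h1
      have h2' : n < m + 1 := by exact_mod_cast h2
      omega
  · push Not at h
    rw [Finset.sum_eq_zero fun n hn => by rw [vWindow, Set.indicator_of_notMem (h n hn), mul_zero]]
    exact Set.indicator_nonneg (fun s _ => mul_nonneg (hj2.pow_nonneg _)
      (div_nonneg (herglotzCot_im_pos (by simpa using ht)).le (normSq_nonneg _))) s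

theorem exists_sum_integral_le {A B : ℝ} {j : ℕ} (hA : 0 ≤ A) (hj : Even j)
    (hQ : ∀ u v, 0 ≤ qReal A B (j + 1) u v) (h : ∃ m ∈ S, a m ≠ 0) (F : Finset ℤ) :
    ∃ K : ℝ, ∀ t : ℝ, 0 < t → t ≤ 1 →
      ∑ n ∈ F, ∫ s, poissonKer (Real.sinh (Real.pi * t) / Real.pi) (s - (n + 1 / 2)) *
        vWindow S a (j + 2) n t s ≤
      A * ∑ m ∈ S, a m * (∫ s, poissonKer t (s - m) * uFun S a (s + t * I) ^ (j + 1)) + K * t := by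
  obtain ⟨M, -, hM⟩ := exists_uFun_vFun_uniform_bound S a
  obtain ⟨K, -, hK⟩ := exists_integral_vFun_le S a hQ h
  refine ⟨K, fun t ht ht1 => ?_⟩
  obtain ⟨R0, hR0⟩ := hK t ht ht1
  have hu (s : ℝ) : |uFun S a (s + t * I)| ≤ M := (hM _ (by simpa using ht) (by simpa using ht1)).1
  have hv (s : ℝ) : |vFun S a (s + t * I)| ≤ M := (hM _ (by simpa using ht) (by simpa using ht1)).2
  have hy : 0 < Real.sinh (Real.pi * t) / Real.pi :=
    div_pos (Real.sinh_pos_iff.2 (mul_pos Real.pi_pos ht)) Real.pi_pos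
  set R := |R0| + ∑ n ∈ F, (|(n : ℝ)| + 1)
  have hRn : 0 ≤ ∑ n ∈ F, (|(n : ℝ)| + 1) := Finset.sum_nonneg fun _ _ => by positivity
  have hR1 : R0 ≤ R := (le_abs_self _).trans (by linarith)
  have hR2 (n : ℤ) (hn : n ∈ F) : |(n : ℝ)| + 1 ≤ R := by
    have := Finset.single_le_sum (f := fun n : ℤ => |(n : ℝ)| + 1) (fun _ _ => by positivity) hn
    have := abs_nonneg R0
    linarith
  have hRR : -R ≤ R := by have := abs_nonneg R0; linarith
  have hnz (s : ℝ) : normSq (herglotzCot (s + t * I)) ≠ 0 :=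
    (normSq_pos.2 (herglotzCot_ne_zero (by simpa using ht))).ne'
  have c1 := continuous_herglotzCot_line ht
  have c3 := continuous_vFun_line S a ht
  have cg : Continuous fun s : ℝ => vFun S a (s + t * I) ^ (j + 2) *
      ((herglotzCot (s + t * I)).im / normSq (herglotzCot (s + t * I))) :=
    (c3.pow _).mul ((continuous_im.comp c1).div (continuous_normSq.comp c1) hnz)
  have left : ∑ n ∈ F, ∫ s, poissonKer (Real.sinh (Real.pi * t) / Real.pi) (s - (n + 1 / 2)) *
      vWindow S a (j + 2) n t s ≤ ∫ s in (-R)..R, vFun S a (s + t * I) ^ (j + 2) *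
        ((herglotzCot (s + t * I)).im / normSq (herglotzCot (s + t * I))) := by
    have hi (n : ℤ) := integrable_poissonKer_mul (x := n + 1 / 2) hy
      (measurable_vWindow S a (j + 2) n ht) (abs_vWindow_le S a hv)
    rw [← integral_finsetSum _ fun n _ => hi n, intervalIntegral.integral_of_le hRR,
      ← integral_indicator measurableSet_Ioc]
    refine integral_mono (integrable_finsetSum _ fun n _ => hi n) ?_ fun s =>
      sum_vWindow_le S a hj F ht hR2 s
    exact (integrable_indicator_iff measurableSet_Ioc).2
      ((cg.integrableOn_Icc (a := -R) (b := R)).mono_set Set.Ioc_subset_Icc_self)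
  have hiu (m : ℤ) : Integrable fun s : ℝ => poissonKer t (s - m) *
      uFun S a (s + t * I) ^ (j + 1) :=
    integrable_poissonKer_mul ht ((continuous_uFun_line S a ht).pow _).measurable fun s =>
      abs_pow_le_of_abs_le (hu s) (j + 1)
  have e (s : ℝ) : uFun S a (s + t * I) ^ (j + 2) * (herglotzCot (s + t * I)).im =
      ∑ m ∈ S, a m * (poissonKer t (s - m) * uFun S a (s + t * I) ^ (j + 1)) := by
    rw [pow_succ, mul_assoc, uFun_mul_im S a (by simpa using ht), cauchySum_line_im,
      Finset.mul_sum]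
    exact Finset.sum_congr rfl fun m _ => by ring
  have right : ∫ s in (-R)..R, uFun S a (s + t * I) ^ (j + 2) * (herglotzCot (s + t * I)).im ≤
      ∑ m ∈ S, a m * (∫ s, poissonKer t (s - m) * uFun S a (s + t * I) ^ (j + 1)) := by
    have hi : Integrable fun s : ℝ =>
        uFun S a (s + t * I) ^ (j + 2) * (herglotzCot (s + t * I)).im := by
      simp only [e]
      exact integrable_finsetSum _ fun m _ => (hiu m).const_mul _
    rw [intervalIntegral.integral_of_le hRR]
    refine (setIntegral_le_integral hi (Eventually.of_forall fun s => ?_)).trans_eq ?_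
    · exact mul_nonneg ((hj.add even_two).pow_nonneg _) (herglotzCot_im_pos (by simpa using ht)).le
    · simp only [e]
      rw [integral_finsetSum _ fun m _ => (hiu m).const_mul _]
      simp only [integral_const_mul]
  calc _ ≤ _ := left
    _ ≤ _ := hR0 R hR1
    _ ≤ _ := by gcongr

theorem tendsto_line {y : ℝ → ℝ} (hy : Tendsto y (𝓝[>] 0) (𝓝 0)) (x r : ℝ) :
    Tendsto (fun t : ℝ => (((x + y t * r : ℝ) : ℂ) + t * I)) (𝓝[>] 0) (𝓝[{z | 0 < z.im}] (x : ℂ)) := by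
  refine tendsto_nhdsWithin_iff.2 ⟨?_, ?_⟩
  · have h1 : Tendsto (fun t : ℝ => t) (𝓝[>] 0) (𝓝 0) := nhdsWithin_le_nhds
    have h2 : Tendsto (fun t : ℝ => x + y t * r) (𝓝[>] 0) (𝓝 x) := by
      simpa using (hy.mul_const r).const_add x
    have h3 := ((continuous_ofReal.tendsto _).comp h2).add
      (((continuous_ofReal.tendsto _).comp h1).mul_const I)
    simpa using h3
  · filter_upwards [self_mem_nhdsWithin] with t ht
    simpa using ht

theorem sum_cauchySum_pow_le {A B : ℝ} {j : ℕ} (hA : 0 ≤ A) (hj : Even j)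
    (hQ : ∀ u v, 0 ≤ qReal A B (j + 1) u v) (F : Finset ℤ) :
    ∑ n ∈ F, (cauchySum S a ((n : ℂ) + 1 / 2)).re ^ (j + 2) ≤ A * ∑ m ∈ S, a m ^ (j + 2) := by
  by_cases h : ∃ m ∈ S, a m ≠ 0
  swap
  · push Not at h
    have h1 (z : ℂ) : cauchySum S a z = 0 := Finset.sum_eq_zero fun m hm => by simp [h m hm]
    rw [Finset.sum_eq_zero (fun n _ => by simp [h1]), Finset.sum_eq_zero fun m hm => by simp [h m hm]]
    simp
  obtain ⟨M, -, hM⟩ := exists_uFun_vFun_uniform_bound S a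
  obtain ⟨K, hK⟩ := exists_sum_integral_le S a hA hj hQ h F
  have hI : ∀ᶠ t : ℝ in 𝓝[>] 0, 0 < t ∧ t ≤ 1 := by
    filter_upwards [Ioc_mem_nhdsGT (zero_lt_one' ℝ)] with t ht using ht
  have hid : Tendsto (fun t : ℝ => t) (𝓝[>] 0) (𝓝 0) := nhdsWithin_le_nhds
  have hy : Tendsto (fun t => Real.sinh (Real.pi * t) / Real.pi) (𝓝[>] 0) (𝓝 0) := by
    have : Continuous fun t => Real.sinh (Real.pi * t) / Real.pi := by fun_prop
    simpa using (this.tendsto 0).mono_left (nhdsWithin_le_nhds (s := Set.Ioi 0))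
  have hl : Tendsto (fun t : ℝ => ∑ n ∈ F, ∫ s, poissonKer (Real.sinh (Real.pi * t) / Real.pi)
      (s - (n + 1 / 2)) * vWindow S a (j + 2) n t s) (𝓝[>] 0)
      (𝓝 (∑ n ∈ F, (cauchySum S a ((n : ℂ) + 1 / 2)).re ^ (j + 2))) := by
    refine tendsto_finsetSum _ fun n _ => tendsto_integral_poissonKer (M := M ^ (j + 2)) ?_ ?_ ?_ ?_
    · filter_upwards [hI] with t ht
      exact div_pos (Real.sinh_pos_iff.2 (mul_pos Real.pi_pos ht.1)) Real.pi_pos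
    · filter_upwards [hI] with t ht using measurable_vWindow S a _ n ht.1
    · filter_upwards [hI] with t ht
      exact abs_vWindow_le S a fun s => (hM _ (by simpa using ht.1) (by simpa using ht.2)).2
    · intro r
      have h1 := tendsto_line hy (n + 1 / 2) r
      push_cast at h1
      have h2 := ((tendsto_vFun S a n).comp h1).pow (j + 2)
      refine h2.congr' ?_
      have h3 : Tendsto (fun t => (n : ℝ) + 1 / 2 + Real.sinh (Real.pi * t) / Real.pi * r) (𝓝[>] 0)
          (𝓝 (n + 1 / 2)) := by
        simpa using (hy.mul_const r).const_add ((n : ℝ) + 1 / 2)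
      filter_upwards [h3.eventually (Icc_mem_nhds (a := (n : ℝ) + 1 / 4) (b := n + 3 / 4)
        (by linarith) (by linarith))] with t ht
      rw [vWindow, Set.indicator_of_mem (Set.mem_Icc.2 ht)]
      simp
  have hr : Tendsto (fun t : ℝ => A * ∑ m ∈ S, a m * (∫ s, poissonKer t (s - m) *
      uFun S a (s + t * I) ^ (j + 1)) + K * t) (𝓝[>] 0)
      (𝓝 (A * ∑ m ∈ S, a m * a m ^ (j + 1) + K * 0)) := by
    refine (Tendsto.const_mul _ (tendsto_finsetSum _ fun m hm => Tendsto.const_mul _ ?_)).add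
      (hid.const_mul K)
    refine tendsto_integral_poissonKer (y := fun t => t)
      (f := fun t s => uFun S a (s + t * I) ^ (j + 1)) (M := M ^ (j + 1)) ?_ ?_ ?_ ?_
    · filter_upwards [hI] with t ht using ht.1
    · filter_upwards [hI] with t ht using ((continuous_uFun_line S a ht.1).pow _).measurable
    · filter_upwards [hI] with t ht
      exact fun s => abs_pow_le_of_abs_le (hM _ (by simpa using ht.1) (by simpa using ht.2)).1 _
    · intro r
      have h1 := tendsto_line hid m r
      rw [ofReal_intCast] at h1
      exact ((tendsto_uFun S a hm).comp h1).pow (j + 1)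
  have := le_of_tendsto_of_tendsto hl hr (by filter_upwards [hI] with t ht using hK t ht.1 ht.2)
  refine this.trans_eq ?_
  rw [mul_zero, add_zero]
  congr 1
  exact Finset.sum_congr rfl fun m _ => by ring
end

end

section

open Complex MeasureTheory Filter Topology

section angular

/-- The restriction of the normalised quadratic-type form to the unit circle; `p = q + 2`. -/
def angForm (q : ℕ) (θ x : ℝ) : ℝ :=
  (Real.sin x / Real.sin θ) ^ (q + 2) - (Real.cos x / Real.cos θ) ^ (q + 2) +
    (Real.cos θ * Real.sin θ)⁻¹ * Real.cos ((q + 2) * x)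

/-- The derivative of `angForm`. -/
def angFormDeriv (q : ℕ) (θ x : ℝ) : ℝ :=
  (q + 2) * ((Real.sin x / Real.sin θ) ^ (q + 1) * (Real.cos x / Real.sin θ) +
    (Real.cos x / Real.cos θ) ^ (q + 1) * (Real.sin x / Real.cos θ) -
    (Real.cos θ * Real.sin θ)⁻¹ * Real.sin ((q + 2) * x))

/-- The right hand side of `F'' + p² F = R`. -/
def angRhs (q : ℕ) (θ x : ℝ) : ℝ :=
  (q + 2) * (q + 1) * ((Real.sin x / Real.sin θ) ^ q / Real.sin θ ^ 2 -
    (Real.cos x / Real.cos θ) ^ q / Real.cos θ ^ 2)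

variable (q : ℕ) (θ x : ℝ)

theorem hasDerivAt_angForm : HasDerivAt (angForm q θ) (angFormDeriv q θ x) x := by
  have h1 := ((Real.hasDerivAt_sin x).div_const (Real.sin θ)).fun_pow (q + 2)
  have h2 := ((Real.hasDerivAt_cos x).div_const (Real.cos θ)).fun_pow (q + 2)
  have h3 := (((hasDerivAt_id x).const_mul ((q : ℝ) + 2)).cos).const_mul (Real.cos θ * Real.sin θ)⁻¹
  refine ((h1.sub h2).add h3).congr_deriv ?_
  simp only [angFormDeriv, id, mul_one]
  push_cast
  ring

theorem hasDerivAt_angFormDeriv : HasDerivAt (angFormDeriv q θ)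
    (angRhs q θ x - (q + 2) ^ 2 * angForm q θ x) x := by
  have h1 := (((Real.hasDerivAt_sin x).div_const (Real.sin θ)).fun_pow (q + 1)).mul
    ((Real.hasDerivAt_cos x).div_const (Real.sin θ))
  have h2 := (((Real.hasDerivAt_cos x).div_const (Real.cos θ)).fun_pow (q + 1)).mul
    ((Real.hasDerivAt_sin x).div_const (Real.cos θ))
  have h3 := (((hasDerivAt_id x).const_mul ((q : ℝ) + 2)).sin).const_mul (Real.cos θ * Real.sin θ)⁻¹
  refine (((h1.add h2).sub h3).const_mul ((q : ℝ) + 2)).congr_deriv ?_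
  simp only [angForm, angRhs, id, mul_one]
  push_cast
  simp only [div_eq_mul_inv]
  linear_combination ((q + 2) * (q + 1) * ((Real.sin x * (Real.sin θ)⁻¹) ^ q * (Real.sin θ)⁻¹ ^ 2 -
    (Real.cos x * (Real.cos θ)⁻¹) ^ q * (Real.cos θ)⁻¹ ^ 2)) * Real.sin_sq_add_cos_sq x

/-- The Wronskian of `angForm` with `cos (p x)`. -/
def angWronskian : ℝ :=
  angFormDeriv q θ x * Real.cos ((q + 2) * x) + (q + 2) * angForm q θ x * Real.sin ((q + 2) * x)

theorem hasDerivAt_angWronskian :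
    HasDerivAt (angWronskian q θ) (angRhs q θ x * Real.cos ((q + 2) * x)) x := by
  have h1 := (hasDerivAt_angFormDeriv q θ x).mul
    (((hasDerivAt_id x).const_mul ((q : ℝ) + 2)).cos)
  have h2 := ((hasDerivAt_angForm q θ x).const_mul ((q : ℝ) + 2)).mul
    (((hasDerivAt_id x).const_mul ((q : ℝ) + 2)).sin)
  refine (h1.add h2).congr_deriv ?_
  simp only [id]
  ring

theorem hasDerivAt_angForm_div (hx : Real.cos ((q + 2) * x) ≠ 0) :
    HasDerivAt (fun x => angForm q θ x / Real.cos ((q + 2) * x))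
      (angWronskian q θ x / Real.cos ((q + 2) * x) ^ 2) x := by
  refine ((hasDerivAt_angForm q θ x).fun_div
    (((hasDerivAt_id x).const_mul ((q : ℝ) + 2)).cos) hx).congr_deriv ?_
  simp only [id, angWronskian]
  ring

/-- The critical angle `π / (2 p)` with `p = q + 2`. -/
def critAngle : ℝ := Real.pi / (2 * (q + 2))

theorem critAngle_pos : 0 < critAngle q := by
  have := Real.pi_pos
  unfold critAngle
  positivity

theorem critAngle_mul : ((q : ℝ) + 2) * critAngle q = Real.pi / 2 := by
  unfold critAngle
  field_simp

theorem critAngle_le : critAngle q ≤ Real.pi / 4 := by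
  have := critAngle_mul q
  have h := critAngle_pos q
  nlinarith [mul_nonneg (Nat.cast_nonneg (α := ℝ) q) h.le]

theorem sin_critAngle_pos : 0 < Real.sin (critAngle q) :=
  Real.sin_pos_of_pos_of_lt_pi (critAngle_pos q) (by linarith [critAngle_le q, Real.pi_pos])

theorem cos_critAngle_pos : 0 < Real.cos (critAngle q) :=
  Real.cos_pos_of_mem_Ioo
    ⟨by linarith [critAngle_pos q, Real.pi_pos], by linarith [critAngle_le q, Real.pi_pos]⟩

theorem sin_critAngle_le_cos : Real.sin (critAngle q) ≤ Real.cos (critAngle q) := by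
  have h := critAngle_pos q
  have h' := critAngle_le q
  have hpi := Real.pi_pos
  rw [← Real.sin_pi_div_two_sub]
  exact Real.sin_le_sin_of_le_of_le_pi_div_two (by linarith) (by linarith) (by linarith)

theorem angForm_critAngle : angForm q (critAngle q) (critAngle q) = 0 := by
  have h1 := (sin_critAngle_pos q).ne'
  have h2 := (cos_critAngle_pos q).ne'
  rw [angForm, critAngle_mul, Real.cos_pi_div_two, div_self h1, div_self h2]
  simp

theorem angFormDeriv_critAngle : angFormDeriv q (critAngle q) (critAngle q) = 0 := by
  have h1 := (sin_critAngle_pos q).ne'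
  have h2 := (cos_critAngle_pos q).ne'
  rw [angFormDeriv, critAngle_mul, Real.sin_pi_div_two, div_self h1, div_self h2, one_pow]
  have := Real.sin_sq_add_cos_sq (critAngle q)
  field_simp
  linear_combination ((q : ℝ) + 2) * this

theorem angWronskian_critAngle : angWronskian q (critAngle q) (critAngle q) = 0 := by
  rw [angWronskian, angFormDeriv_critAngle, angForm_critAngle]
  simp

theorem angWronskian_zero : angWronskian q θ 0 = 0 := by
  simp [angWronskian, angFormDeriv]

theorem angRhs_mono {x y : ℝ} (hx : 0 ≤ x) (hxy : x ≤ y) (hy : y ≤ Real.pi / 2) :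
    angRhs q (critAngle q) x ≤ angRhs q (critAngle q) y := by
  have h1 := sin_critAngle_pos q
  have h2 := cos_critAngle_pos q
  have h3 : Real.sin x ≤ Real.sin y :=
    Real.sin_le_sin_of_le_of_le_pi_div_two (by linarith) hy hxy
  have h4 : Real.cos y ≤ Real.cos x := Real.cos_le_cos_of_nonneg_of_le_pi hx (by linarith) hxy
  have h5 : 0 ≤ Real.sin x := Real.sin_nonneg_of_nonneg_of_le_pi hx (by linarith)
  have h6 : 0 ≤ Real.cos y := Real.cos_nonneg_of_neg_pi_div_two_le_of_le (by linarith) hy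
  unfold angRhs
  gcongr

theorem angRhs_critAngle_nonneg : 0 ≤ angRhs q (critAngle q) (critAngle q) := by
  have h1 := sin_critAngle_pos q
  have h2 := cos_critAngle_pos q
  have h3 := sin_critAngle_le_cos q
  rw [angRhs, div_self h1.ne', div_self h2.ne', one_pow]
  have : 1 / Real.cos (critAngle q) ^ 2 ≤ 1 / Real.sin (critAngle q) ^ 2 := by gcongr
  have : 0 ≤ 1 / Real.sin (critAngle q) ^ 2 - 1 / Real.cos (critAngle q) ^ 2 := by linarith
  positivity

theorem continuous_angWronskian : Continuous (angWronskian q θ) :=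
  continuous_iff_continuousAt.2 fun x => (hasDerivAt_angWronskian q θ x).continuousAt

theorem angWronskian_nonpos {x : ℝ} (hx : 0 ≤ x) (hx2 : x ≤ 2 * critAngle q) :
    angWronskian q (critAngle q) x ≤ 0 := by
  have hθ := critAngle_pos q
  have hθ' := critAngle_le q
  have hp := critAngle_mul q
  have hq : (0:ℝ) < q + 2 := by positivity
  have hpi := Real.pi_pos
  have hcos1 (y : ℝ) (hy0 : 0 ≤ y) (hy : y ≤ critAngle q) : 0 ≤ Real.cos ((q + 2) * y) :=
    Real.cos_nonneg_of_neg_pi_div_two_le_of_le (by nlinarith) (by nlinarith)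
  rcases le_total x (critAngle q) with h | h
  · rcases le_total (angRhs q (critAngle q) x) 0 with hR | hR
    · have := antitoneOn_of_hasDerivWithinAt_nonpos (convex_Icc 0 x)
        (continuous_angWronskian q (critAngle q)).continuousOn
        (fun y _ => (hasDerivAt_angWronskian q (critAngle q) y).hasDerivWithinAt) fun y hy => by
          rw [interior_Icc] at hy
          exact mul_nonpos_of_nonpos_of_nonneg ((angRhs_mono q hy.1.le hy.2.le (by linarith)).trans hR)
            (hcos1 y hy.1.le (hy.2.le.trans h))
      have := this (Set.left_mem_Icc.2 hx) (Set.right_mem_Icc.2 hx) hx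
      rwa [angWronskian_zero] at this
    · have := monotoneOn_of_hasDerivWithinAt_nonneg (convex_Icc x (critAngle q))
        (continuous_angWronskian q (critAngle q)).continuousOn
        (fun y _ => (hasDerivAt_angWronskian q (critAngle q) y).hasDerivWithinAt) fun y hy => by
          rw [interior_Icc] at hy
          exact mul_nonneg (hR.trans (angRhs_mono q hx hy.1.le (by linarith [hy.2])))
            (hcos1 y (hx.trans hy.1.le) hy.2.le)
      have := this (Set.left_mem_Icc.2 h) (Set.right_mem_Icc.2 h) h
      rwa [angWronskian_critAngle] at this
  · have := antitoneOn_of_hasDerivWithinAt_nonpos (convex_Icc (critAngle q) x)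
      (continuous_angWronskian q (critAngle q)).continuousOn
      (fun y _ => (hasDerivAt_angWronskian q (critAngle q) y).hasDerivWithinAt) fun y hy => by
        rw [interior_Icc] at hy
        refine mul_nonpos_of_nonneg_of_nonpos ((angRhs_critAngle_nonneg q).trans
          (angRhs_mono q hθ.le hy.1.le (by linarith [hy.2]))) ?_
        refine Real.cos_nonpos_of_pi_div_two_le_of_le ?_ ?_
        · nlinarith [hy.1]
        · have : (q + 2) * y ≤ (q + 2) * (2 * critAngle q) := by
            gcongr; linarith [hy.2]
          linarith
    have := this (Set.left_mem_Icc.2 h) (Set.right_mem_Icc.2 h) h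
    rwa [angWronskian_critAngle] at this

theorem tendsto_angForm_div :
    Tendsto (fun x => angForm q (critAngle q) x / Real.cos ((q + 2) * x)) (𝓝[≠] (critAngle q))
      (𝓝 0) := by
  have h1 := (hasDerivAt_angForm q (critAngle q) (critAngle q)).tendsto_slope
  have h2 := ((((hasDerivAt_id (critAngle q)).const_mul ((q : ℝ) + 2)).cos)).tendsto_slope
  rw [angFormDeriv_critAngle] at h1
  simp only [id] at h2
  rw [critAngle_mul, Real.sin_pi_div_two] at h2
  have h3 := h1.div h2 (by
    have : (0:ℝ) < q + 2 := by positivity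
    rw [neg_one_mul]
    exact neg_ne_zero.2 (by simpa using this.ne'))
  rw [zero_div] at h3
  refine h3.congr' ?_
  filter_upwards [self_mem_nhdsWithin] with x hx
  have hx' : x - critAngle q ≠ 0 := sub_ne_zero.2 hx
  simp only [Pi.div_apply, slope_def_field, angForm_critAngle, critAngle_mul, Real.cos_pi_div_two,
    sub_zero]
  rw [div_div_div_cancel_right₀ hx']

theorem angForm_nonneg_of_reduced {x : ℝ} (hx : 0 ≤ x) (hx2 : x ≤ 2 * critAngle q) :
    0 ≤ angForm q (critAngle q) x := by
  have hθ := critAngle_pos q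
  have hp := critAngle_mul q
  have hq : (0:ℝ) < q + 2 := by positivity
  have hpi := Real.pi_pos
  set θ := critAngle q with hθdef
  have hder (y : ℝ) (hy : Real.cos ((q + 2) * y) ≠ 0) := hasDerivAt_angForm_div q θ y hy
  rcases lt_trichotomy x θ with h | h | h
  · have hc (y : ℝ) (h0 : 0 ≤ y) (h1 : y < θ) : 0 < Real.cos ((q + 2) * y) :=
      Real.cos_pos_of_mem_Ioo ⟨by nlinarith, by nlinarith⟩
    have anti : AntitoneOn (fun x => angForm q θ x / Real.cos ((q + 2) * x)) (Set.Ico x θ) := by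
      refine antitoneOn_of_hasDerivWithinAt_nonpos (convex_Ico x θ)
        (fun y hy => (hder y (hc y (hx.trans hy.1) hy.2).ne').continuousAt.continuousWithinAt)
        (fun y hy => (hder y ?_).hasDerivWithinAt) fun y hy => ?_
      · rw [interior_Ico] at hy
        exact (hc y (hx.trans hy.1.le) hy.2).ne'
      · rw [interior_Ico] at hy
        exact div_nonpos_of_nonpos_of_nonneg
          (angWronskian_nonpos q (hx.trans hy.1.le) (by linarith [hy.2])) (sq_nonneg _)
    have hlim : Tendsto (fun x => angForm q θ x / Real.cos ((q + 2) * x)) (𝓝[<] θ) (𝓝 0) :=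
      (tendsto_angForm_div q).mono_left (nhdsWithin_mono _ fun y hy => ne_of_lt hy)
    have := le_of_tendsto hlim (b := angForm q θ x / Real.cos ((q + 2) * x)) (by
      filter_upwards [Ico_mem_nhdsLT h] with y hy
      exact anti (Set.left_mem_Ico.2 h) hy hy.1)
    by_contra! hneg
    exact absurd (div_neg_of_neg_of_pos hneg (hc x hx h)) (not_lt.2 this)
  · rw [h, angForm_critAngle]
  · have hc (y : ℝ) (h0 : θ < y) (h1 : y ≤ x) : Real.cos ((q + 2) * y) < 0 := by
      refine Real.cos_neg_of_pi_div_two_lt_of_lt (by nlinarith) ?_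
      have : (q + 2) * y ≤ (q + 2) * (2 * θ) := by gcongr; linarith
      linarith
    have anti : AntitoneOn (fun x => angForm q θ x / Real.cos ((q + 2) * x)) (Set.Ioc θ x) := by
      refine antitoneOn_of_hasDerivWithinAt_nonpos (convex_Ioc θ x)
        (fun y hy => (hder y (hc y hy.1 hy.2).ne).continuousAt.continuousWithinAt)
        (fun y hy => (hder y ?_).hasDerivWithinAt) fun y hy => ?_
      · rw [interior_Ioc] at hy
        exact (hc y hy.1 hy.2.le).ne
      · rw [interior_Ioc] at hy
        exact div_nonpos_of_nonpos_of_nonneg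
          (angWronskian_nonpos q (hθ.le.trans hy.1.le) (hy.2.le.trans hx2)) (sq_nonneg _)
    have hlim : Tendsto (fun x => angForm q θ x / Real.cos ((q + 2) * x)) (𝓝[>] θ) (𝓝 0) :=
      (tendsto_angForm_div q).mono_left (nhdsWithin_mono _ fun y hy => ne_of_gt hy)
    have := ge_of_tendsto hlim (b := angForm q θ x / Real.cos ((q + 2) * x)) (by
      filter_upwards [Ioc_mem_nhdsGT h] with y hy
      exact anti hy (Set.right_mem_Ioc.2 h) hy.2)
    by_contra! hneg
    exact absurd (div_pos_of_neg_of_neg hneg (hc x h le_rfl)) (not_lt.2 this)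

theorem angForm_nonneg {x : ℝ} (hx : 0 ≤ x) (hx2 : x ≤ Real.pi / 2) :
    0 ≤ angForm q (critAngle q) x := by
  rcases le_total x (2 * critAngle q) with h | h
  · exact angForm_nonneg_of_reduced q hx h
  have hθ := critAngle_pos q
  refine (angForm_nonneg_of_reduced q (by positivity) le_rfl).trans ?_
  have hpi := Real.pi_pos
  have h1 := sin_critAngle_pos q
  have h2 := cos_critAngle_pos q
  have h3 : Real.sin (2 * critAngle q) ≤ Real.sin x :=
    Real.sin_le_sin_of_le_of_le_pi_div_two (by linarith) hx2 h
  have h4 : Real.cos x ≤ Real.cos (2 * critAngle q) :=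
    Real.cos_le_cos_of_nonneg_of_le_pi (by linarith) (by linarith) h
  have h5 : 0 ≤ Real.sin (2 * critAngle q) :=
    Real.sin_nonneg_of_nonneg_of_le_pi (by linarith) (by linarith)
  have h6 : 0 ≤ Real.cos x := Real.cos_nonneg_of_neg_pi_div_two_le_of_le (by linarith) hx2
  have h7 : Real.cos ((q + 2) * (2 * critAngle q)) = -1 := by
    rw [mul_left_comm, critAngle_mul, mul_div_cancel₀ _ (by norm_num), Real.cos_pi]
  have h8 := Real.neg_one_le_cos ((q + 2) * x)
  unfold angForm
  rw [h7]
  gcongr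
end angular

/-- The Pichorides-type inequality, in exact form for even exponents. -/
theorem exists_qReal_nonneg {q : ℕ} (hq : Even q) : ∃ B : ℝ, ∀ u v,
    0 ≤ qReal (Real.cot (critAngle q) ^ (q + 2)) B (q + 1) u v := by
  have h1 := sin_critAngle_pos q
  have h2 := cos_critAngle_pos q
  set θ := critAngle q
  set B := Real.cos θ ^ (q + 2) * (Real.cos θ * Real.sin θ)⁻¹
  refine ⟨B, ?_⟩
  have hq2 : Even (q + 2) := hq.add even_two
  have pos : ∀ u v : ℝ, 0 ≤ u → 0 ≤ v → 0 ≤ qReal (Real.cot θ ^ (q + 2)) B (q + 1) u v := by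
    intro u v hu hv
    set z : ℂ := (v : ℂ) + I * u with hz
    have hre : ‖z‖ * Real.cos z.arg = v := by rw [norm_mul_cos_arg]; simp [hz]
    have him : ‖z‖ * Real.sin z.arg = u := by rw [norm_mul_sin_arg]; simp [hz]
    have ha0 : 0 ≤ z.arg := arg_nonneg_iff.2 (by simpa [hz] using hu)
    have ha1 : z.arg ≤ Real.pi / 2 := by
      have := abs_arg_le_pi_div_two_iff.2 (show 0 ≤ z.re by simpa [hz] using hv)
      exact (le_abs_self _).trans this
    have hpow : (z ^ (q + 2)).re = ‖z‖ ^ (q + 2) * Real.cos ((q + 2) * z.arg) := by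
      conv_lhs => rw [← norm_mul_cos_add_sin_mul_I z]
      rw [mul_pow, Complex.cos_add_sin_mul_I_pow, ← ofReal_pow, re_ofReal_mul, add_re, mul_I_re]
      norm_cast
      simp
    have e : qReal (Real.cot θ ^ (q + 2)) B (q + 1) u v =
        ‖z‖ ^ (q + 2) * Real.cos θ ^ (q + 2) * angForm q θ z.arg := by
      rw [qReal, ← hz, hpow, ← hre, ← him, angForm, Real.cot_eq_cos_div_sin]
      simp only [mul_pow, div_pow, B]
      field_simp
    rw [e]
    have := angForm_nonneg q ha0 ha1
    positivity
  intro u v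
  have hsymu (u v : ℝ) : qReal (Real.cot θ ^ (q + 2)) B (q + 1) (-u) v =
      qReal (Real.cot θ ^ (q + 2)) B (q + 1) u v := by
    rw [qReal, qReal, hq2.neg_pow, ← conj_re (_ ^ _), map_pow]
    simp
  have hsymv (u v : ℝ) : qReal (Real.cot θ ^ (q + 2)) B (q + 1) u (-v) =
      qReal (Real.cot θ ^ (q + 2)) B (q + 1) u v := by
    rw [← hsymu, qReal, qReal, hq2.neg_pow, hq2.neg_pow]
    push_cast
    rw [show (-(v : ℂ) + I * -u) = -(v + I * u) by ring, hq2.neg_pow]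
  rcases le_total 0 u with hu | hu <;> rcases le_total 0 v with hv | hv
  · exact pos u v hu hv
  · rw [← hsymv]; exact pos _ _ hu (by linarith)
  · rw [← hsymu]; exact pos _ _ (by linarith) hv
  · rw [← hsymu, ← hsymv]; exact pos _ _ (by linarith) (by linarith)

end

section

open Complex Filter Topology

section

/-- The Riesz–Titchmarsh transform of the restriction of `a` to `S`. -/
def rtSum (S : Finset ℤ) (a : ℤ → ℂ) (n : ℤ) : ℂ :=
  ∑ k ∈ S, a k * (((1 / Real.pi) * ((n : ℝ) - k + 1 / 2)⁻¹ : ℝ) : ℂ)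

/-- `C` bounds the norm of the Riesz–Titchmarsh operator between all finite blocks. -/
def FiniteBound (p C : ℝ) : Prop :=
  ∀ (S F : Finset ℤ) (a : ℤ → ℂ), ∑ n ∈ F, ‖rtSum S a n‖ ^ p ≤ C ^ p * ∑ k ∈ S, ‖a k‖ ^ p

theorem cauchySum_half_int_re (S : Finset ℤ) (a : ℤ → ℝ) (n : ℤ) :
    (cauchySum S a ((n : ℂ) + 1 / 2)).re =
      -∑ k ∈ S, a k * ((1 / Real.pi) * ((n : ℝ) - k + 1 / 2)⁻¹) := by
  have : cauchySum S a ((n : ℂ) + 1 / 2) =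
      ((-∑ k ∈ S, a k * ((1 / Real.pi) * ((n : ℝ) - k + 1 / 2)⁻¹) : ℝ) : ℂ) := by
    rw [cauchySum]
    push_cast
    rw [← Finset.sum_neg_distrib]
    refine Finset.sum_congr rfl fun k _ => ?_
    rw [show (n : ℂ) - k + 1 / 2 = -(k - (n + 1 / 2)) by ring, inv_neg]
    ring
  rw [this, ofReal_re]

theorem sum_realPart_pow_le {q : ℕ} (hq : Even q) (S F : Finset ℤ) (a : ℤ → ℂ) (θ : ℝ) :
    ∑ n ∈ F, (‖rtSum S a n‖ * Real.cos (θ - (rtSum S a n).arg)) ^ (q + 2) ≤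
      Real.cot (critAngle q) ^ (q + 2) * ∑ k ∈ S, (‖a k‖ * Real.cos (θ - (a k).arg)) ^ (q + 2) := by
  have rot (z : ℂ) : ‖z‖ * Real.cos (θ - z.arg) = z.re * Real.cos θ + z.im * Real.sin θ := by
    rw [Real.cos_sub]
    linear_combination Real.cos θ * norm_mul_cos_arg z + Real.sin θ * norm_mul_sin_arg z
  obtain ⟨B, hB⟩ := exists_qReal_nonneg hq
  have h := sum_cauchySum_pow_le S (fun k => ‖a k‖ * Real.cos (θ - (a k).arg))
    (hq.add even_two |>.pow_nonneg _) hq hB F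
  refine le_trans (Finset.sum_le_sum fun n _ => le_of_eq ?_) h
  rw [cauchySum_half_int_re, (hq.add even_two).neg_pow, rot, rtSum, re_sum, im_sum,
    Finset.sum_mul, Finset.sum_mul, ← Finset.sum_add_distrib]
  congr 1
  refine Finset.sum_congr rfl fun k _ => ?_
  rw [rot, re_mul_ofReal, im_mul_ofReal]
  ring

theorem integral_rotated_pow (r φ : ℝ) (k : ℕ) :
    ∫ θ in (0 : ℝ)..(2 * Real.pi), (r * Real.cos (θ - φ)) ^ k =
      r ^ k * ∫ θ in (0 : ℝ)..(2 * Real.pi), Real.cos θ ^ k := by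
  simp only [mul_pow]
  rw [intervalIntegral.integral_const_mul]
  congr 1
  rw [intervalIntegral.integral_comp_sub_right (fun θ => Real.cos θ ^ k)]
  have hper : Function.Periodic (fun θ => Real.cos θ ^ k) (2 * Real.pi) := fun x => by
    simp only [Real.cos_add_two_pi]
  have := hper.intervalIntegral_add_eq (0 - φ) 0
  rw [zero_add] at this
  rw [← this]
  congr 1
  ring

theorem integral_cos_pow_pos {k : ℕ} (hk : Even k) :
    0 < ∫ θ in (0 : ℝ)..(2 * Real.pi), Real.cos θ ^ k := by
  have hpi := Real.pi_pos
  refine intervalIntegral.integral_pos (by positivity) (by fun_prop)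
    (fun x _ => hk.pow_nonneg _) ⟨0, ⟨le_rfl, by positivity⟩, by simp⟩

theorem sum_rtSum_pow_le {q : ℕ} (hq : Even q) (S F : Finset ℤ) (a : ℤ → ℂ) :
    ∑ n ∈ F, ‖rtSum S a n‖ ^ (q + 2) ≤
      Real.cot (critAngle q) ^ (q + 2) * ∑ k ∈ S, ‖a k‖ ^ (q + 2) := by
  have hpi := Real.pi_pos
  have h := intervalIntegral.integral_mono_on (a := 0) (b := 2 * Real.pi) (by positivity)
    (Continuous.intervalIntegrable (μ := MeasureTheory.volume) (by fun_prop) _ _)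
    (Continuous.intervalIntegrable (by fun_prop) _ _)
    fun θ _ => sum_realPart_pow_le hq S F a θ
  rw [intervalIntegral.integral_const_mul,
    intervalIntegral.integral_finsetSum fun _ _ => Continuous.intervalIntegrable (by fun_prop) _ _,
    intervalIntegral.integral_finsetSum fun _ _ => Continuous.intervalIntegrable (by fun_prop) _ _]
    at h
  simp only [integral_rotated_pow] at h
  rw [← Finset.sum_mul, ← Finset.sum_mul, ← mul_assoc] at h
  exact le_of_mul_le_mul_right h (integral_cos_pow_pos (hq.add even_two))

theorem finiteBound_even {n : ℕ} (hn : 0 < n) :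
    FiniteBound (2 * n) (Real.cot (Real.pi / (2 * (2 * n)))) := by
  intro S F a
  obtain ⟨m, rfl⟩ : ∃ m, n = m + 1 := ⟨n - 1, by omega⟩
  have e : (2 * ((m + 1 : ℕ) : ℝ)) = ((2 * m + 2 : ℕ) : ℝ) := by push_cast; ring
  have h := sum_rtSum_pow_le (even_two_mul m) S F a
  rw [critAngle] at h
  rw [e]
  simp only [Real.rpow_natCast]
  push_cast at h ⊢
  exact h

theorem RT_eq_tsum (a : ℤ → ℂ) (n : ℤ) :
    RT a n = ∑' k, a k * (((1 / Real.pi) * ((n : ℝ) - k + 1 / 2)⁻¹ : ℝ) : ℂ) := by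
  rw [RT, ← tsum_mul_left, ← (Equiv.subLeft n).tsum_eq]
  refine tsum_congr fun k => ?_
  simp only [Equiv.subLeft_apply]
  push_cast
  rw [sub_sub_cancel]
  ring

variable {p C : ℝ}

theorem FiniteBound.sum_RT_le (h : FiniteBound p C) (hp : 0 < p) (hC : 0 ≤ C) {a : ℤ → ℂ}
    (ha : MemLpZ p a) (F : Finset ℤ) :
    ∑ n ∈ F, ‖RT a n‖ ^ p ≤ C ^ p * ∑' k, ‖a k‖ ^ p := by
  classical
  let f (n k : ℤ) : ℂ := a k * (((1 / Real.pi) * ((n : ℝ) - k + 1 / 2)⁻¹ : ℝ) : ℂ)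
  have hbound (F : Finset ℤ) (S : Finset ℤ) :
      ∑ n ∈ F, ‖rtSum S a n‖ ^ p ≤ C ^ p * ∑' k, ‖a k‖ ^ p :=
    (h S F a).trans (by
      gcongr
      exact ha.sum_le_tsum S fun _ _ => by positivity)
  have hlim : Tendsto (fun S => ∑ n ∈ F with Summable (f n), ‖rtSum S a n‖ ^ p) atTop
      (𝓝 (∑ n ∈ F with Summable (f n), ‖RT a n‖ ^ p)) := by
    refine tendsto_finsetSum _ fun n hn => ?_
    rw [RT_eq_tsum]
    exact ((Finset.mem_filter.1 hn).2.hasSum.norm).rpow_const (Or.inr hp.le)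
  refine le_trans (Finset.sum_filter_of_ne fun n _ hne => ?_).ge
    (le_of_tendsto' hlim (hbound _))
  by_contra hns
  rw [RT_eq_tsum, tsum_eq_zero_of_not_summable hns, norm_zero, Real.zero_rpow hp.ne'] at hne
  exact hne rfl

theorem FiniteBound.memLpZ_RT (h : FiniteBound p C) (hp : 0 < p) (hC : 0 ≤ C) {a : ℤ → ℂ}
    (ha : MemLpZ p a) : MemLpZ p (RT a) :=
  summable_of_sum_le (fun _ => by positivity) (h.sum_RT_le hp hC ha)

theorem FiniteBound.tsum_RT_le (h : FiniteBound p C) (hp : 0 < p) (hC : 0 ≤ C) {a : ℤ → ℂ}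
    (ha : MemLpZ p a) : ∑' n, ‖RT a n‖ ^ p ≤ C ^ p * ∑' k, ‖a k‖ ^ p :=
  (h.memLpZ_RT hp hC ha).tsum_le_of_sum_le (h.sum_RT_le hp hC ha)

theorem FiniteBound.lpNorm_RT_le (h : FiniteBound p C) (hp : 0 < p) (hC : 0 ≤ C) {a : ℤ → ℂ}
    (ha : MemLpZ p a) : _root_.lpNorm p (RT a) ≤ C * _root_.lpNorm p a := by
  have h1 : 0 ≤ ∑' n, ‖RT a n‖ ^ p := tsum_nonneg fun _ => by positivity
  have h2 : 0 ≤ ∑' n, ‖a n‖ ^ p := tsum_nonneg fun _ => by positivity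
  have := Real.rpow_le_rpow h1 (h.tsum_RT_le hp hC ha) (one_div_nonneg.2 hp.le)
  rwa [Real.mul_rpow (by positivity) h2, ← Real.rpow_mul hC, mul_one_div_cancel hp.ne',
    Real.rpow_one] at this

theorem finiteBound_of_lpNorm_le {C' : ℝ} (h : FiniteBound p C) (hp : 0 < p) (hC : 0 ≤ C)
    (hC' : 0 ≤ C')
    (hle : ∀ a : ℤ → ℂ, MemLpZ p a → _root_.lpNorm p (RT a) ≤ C' * _root_.lpNorm p a) :
    FiniteBound p C' := by
  classical
  intro S F a
  set b : ℤ → ℂ := fun k => if k ∈ S then a k else 0 with hb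
  have hb0 (k : ℤ) (hk : k ∉ S) : ‖b k‖ ^ p = 0 := by
    simp [hb, hk, Real.zero_rpow hp.ne']
  have hbS : MemLpZ p b := summable_of_ne_finset_zero (s := S) hb0
  have hRT (n : ℤ) : RT b n = rtSum S a n := by
    rw [RT_eq_tsum, tsum_eq_sum (s := S) fun k hk => by simp [hb, hk], rtSum]
    exact Finset.sum_congr rfl fun k hk => by simp [hb, hk]
  have hsum : ∑' k, ‖b k‖ ^ p = ∑ k ∈ S, ‖a k‖ ^ p := by
    rw [tsum_eq_sum (s := S) hb0]
    exact Finset.sum_congr rfl fun k hk => by simp [hb, hk]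
  have h1 : 0 ≤ ∑' n, ‖RT b n‖ ^ p := tsum_nonneg fun _ => by positivity
  have h2 : 0 ≤ ∑' n, ‖b n‖ ^ p := tsum_nonneg fun _ => by positivity
  have := Real.rpow_le_rpow (Real.rpow_nonneg h1 _) (hle b hbS) hp.le
  rw [_root_.lpNorm, Real.mul_rpow hC' (Real.rpow_nonneg h2 _), ← Real.rpow_mul h1,
    ← Real.rpow_mul h2, one_div_mul_cancel hp.ne', Real.rpow_one, Real.rpow_one, hsum] at this
  refine le_trans ?_ this
  simp only [← hRT]
  exact (h.memLpZ_RT hp hC hbS).sum_le_tsum F fun _ _ => by positivity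

end

end

section

open Complex Filter Topology

section

/-- The dual vector of `z` for the exponent `q`. -/
def dualVec (q : ℝ) (z : ℂ) : ℂ := (starRingEnd ℂ) z * ((‖z‖ ^ (q - 2) : ℝ) : ℂ)

theorem dualVec_mul {q : ℝ} (hq : 0 < q) (z : ℂ) : dualVec q z * z = ((‖z‖ ^ q : ℝ) : ℂ) := by
  rcases eq_or_ne z 0 with rfl | hz
  · simp [Real.zero_rpow hq.ne']
  have hz' : 0 < ‖z‖ := norm_pos_iff.2 hz
  rw [dualVec, mul_right_comm, ← normSq_eq_conj_mul_self, normSq_eq_norm_sq, ← ofReal_mul,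
    Real.rpow_sub hz', Real.rpow_two, mul_div_cancel₀ _ (by positivity)]

theorem norm_dualVec {q : ℝ} (hq : 1 < q) (z : ℂ) : ‖dualVec q z‖ = ‖z‖ ^ (q - 1) := by
  rcases eq_or_ne z 0 with rfl | hz
  · simp [dualVec, Real.zero_rpow (sub_pos.2 hq).ne']
  have hz' : 0 < ‖z‖ := norm_pos_iff.2 hz
  rw [dualVec, norm_mul, RCLike.norm_conj, norm_real, Real.norm_of_nonneg (by positivity),
    ← Real.rpow_one_add' hz'.le (by linarith)]
  ring_nf

theorem sum_mul_rtSum (S F : Finset ℤ) (a b : ℤ → ℂ) :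
    ∑ n ∈ F, b n * rtSum S a n = -∑ k ∈ S, a k * rtSum F b (k - 1) := by
  simp only [rtSum, Finset.mul_sum]
  rw [Finset.sum_comm, ← Finset.sum_neg_distrib]
  refine Finset.sum_congr rfl fun k _ => ?_
  rw [← Finset.sum_neg_distrib]
  refine Finset.sum_congr rfl fun n _ => ?_
  have : ((n : ℝ) - k + 1 / 2)⁻¹ = -(((k - 1 : ℤ) : ℝ) - n + 1 / 2)⁻¹ := by
    rw [← inv_neg]
    push_cast
    ring_nf
  rw [this]
  push_cast
  ring

theorem rpow_le_of_le_mul_rpow {p q N D : ℝ} (hpq : p.HolderConjugate q) (hN : 0 ≤ N)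
    (hD : 0 ≤ D) (h : N ≤ D * N ^ (1 / p)) : N ≤ D ^ q := by
  rcases hN.eq_or_lt with rfl | hN
  · positivity
  have hq := hpq.symm.pos
  have h1 : N = N ^ (1 / q) * N ^ (1 / p) := by
    rw [← Real.rpow_add hN, one_div, one_div, hpq.symm.inv_add_inv_eq_one, Real.rpow_one]
  have h2 : N ^ (1 / q) ≤ D := by
    refine le_of_mul_le_mul_right (?_ : _ ≤ D * N ^ (1 / p)) (by positivity)
    rwa [← h1]
  calc N = (N ^ (1 / q)) ^ q := by
        rw [← Real.rpow_mul hN.le, one_div_mul_cancel hq.ne', Real.rpow_one]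
    _ ≤ D ^ q := by gcongr

theorem FiniteBound.dual {p q C : ℝ} (h : FiniteBound p C) (hpq : p.HolderConjugate q)
    (hC : 0 ≤ C) : FiniteBound q C := by
  classical
  intro S F a
  have hq := hpq.symm.lt
  have hp := hpq.pos
  set c := rtSum S a
  set b : ℤ → ℂ := fun n => dualVec q (c n)
  set N := ∑ n ∈ F, ‖c n‖ ^ q with hN
  set A := ∑ k ∈ S, ‖a k‖ ^ q with hA
  have hN0 : 0 ≤ N := Finset.sum_nonneg fun _ _ => by positivity
  have hA0 : 0 ≤ A := Finset.sum_nonneg fun _ _ => by positivity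
  have hb : ∑ n ∈ F, ‖b n‖ ^ p = N := by
    refine Finset.sum_congr rfl fun n _ => ?_
    rw [norm_dualVec hq, ← Real.rpow_mul (norm_nonneg _), hpq.symm.sub_one_mul_conj]
  have hpair : (N : ℂ) = -∑ k ∈ S, a k * rtSum F b (k - 1) := by
    rw [← sum_mul_rtSum, hN, ofReal_sum]
    exact Finset.sum_congr rfl fun n _ => (dualVec_mul (by linarith) _).symm
  have h1 : N ≤ ∑ k ∈ S, ‖a k‖ * ‖rtSum F b (k - 1)‖ := by
    calc N = ‖(N : ℂ)‖ := by rw [norm_real, Real.norm_of_nonneg hN0]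
      _ ≤ ∑ k ∈ S, ‖a k * rtSum F b (k - 1)‖ := by
        rw [hpair, norm_neg]; exact norm_sum_le _ _
      _ = _ := by simp only [norm_mul]
  have h2 := Real.inner_le_Lp_mul_Lq S (fun k => ‖a k‖) (fun k => ‖rtSum F b (k - 1)‖) hpq.symm
  simp only [abs_norm] at h2
  have h3 : ∑ k ∈ S, ‖rtSum F b (k - 1)‖ ^ p ≤ C ^ p * N := by
    have := h F (S.image fun k => k - 1) b
    rwa [Finset.sum_image fun _ _ _ _ h => sub_left_injective h, hb] at this
  have h4 : (∑ k ∈ S, ‖rtSum F b (k - 1)‖ ^ p) ^ (1 / p) ≤ C * N ^ (1 / p) := by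
    refine (Real.rpow_le_rpow (Finset.sum_nonneg fun _ _ => by positivity) h3
      (by positivity)).trans_eq ?_
    rw [Real.mul_rpow (by positivity) hN0, ← Real.rpow_mul hC, mul_one_div_cancel hp.ne',
      Real.rpow_one]
  have h5 : N ≤ (A ^ (1 / q) * C) * N ^ (1 / p) := by
    rw [mul_assoc]
    exact (h1.trans h2).trans (by gcongr)
  refine (rpow_le_of_le_mul_rpow hpq hN0 (by positivity) h5).trans_eq ?_
  rw [Real.mul_rpow (by positivity) hC, ← Real.rpow_mul hA0, one_div_mul_cancel (by linarith),
    Real.rpow_one, mul_comm]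

end

end

section

open Filter Topology MeasureTheory

section

/-- The coefficients of the power series of `(1 - t) ^ (-α)`. -/
def binCoeff (α : ℝ) (m : ℕ) : ℝ := Real.Gamma (m + α) / (Real.Gamma α * m.factorial)

theorem Real.Gamma_add_le_rpow_mul {x s : ℝ} (hx : 0 < x) (hs : 0 < s) (hs1 : s < 1) :
    Real.Gamma (x + s) ≤ x ^ s * Real.Gamma x := by
  have h := Real.Gamma_mul_add_mul_le_rpow_Gamma_mul_rpow_Gamma hx (show 0 < x + 1 by linarith)
    (sub_pos.2 hs1) hs (by ring)
  have hG := Real.Gamma_pos_of_pos hx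
  rw [Real.Gamma_add_one hx.ne', Real.mul_rpow hx.le hG.le,
    show (1 - s) * x + s * (x + 1) = x + s by ring] at h
  refine h.trans_eq ?_
  rw [mul_left_comm, ← Real.rpow_add hG, sub_add_cancel, Real.rpow_one]

theorem Real.rpow_le_Gamma_div_Gamma {x s : ℝ} (hx : 0 < x) (hs : 0 < s) (hs1 : s < 1) :
    x ^ (-s) ≤ Real.Gamma x / Real.Gamma (x + s) := by
  rw [Real.rpow_neg hx.le, le_div_iff₀ (Real.Gamma_pos_of_pos (by linarith)),
    inv_mul_le_iff₀ (by positivity)]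
  exact Real.Gamma_add_le_rpow_mul hx hs hs1

variable {α : ℝ}

theorem binCoeff_pos (hα : 0 < α) (m : ℕ) : 0 < binCoeff α m := by
  have h1 := Real.Gamma_pos_of_pos hα
  have h2 : 0 < Real.Gamma (m + α) := Real.Gamma_pos_of_pos (by positivity)
  unfold binCoeff
  positivity

theorem binCoeff_zero (hα : 0 < α) : binCoeff α 0 = 1 := by
  have h1 := (Real.Gamma_pos_of_pos hα).ne'
  simp [binCoeff, h1]

theorem binCoeff_succ (hα : 0 < α) (m : ℕ) :
    (m + 1) * binCoeff α (m + 1) = (m + α) * binCoeff α m := by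
  have h1 := (Real.Gamma_pos_of_pos hα).ne'
  have h2 : (m : ℝ) + α ≠ 0 := by positivity
  rw [binCoeff, binCoeff, Nat.factorial_succ]
  push_cast
  rw [add_right_comm, Real.Gamma_add_one h2]
  field_simp

theorem binCoeff_le (hα : 0 < α) (hα1 : α < 1) (m : ℕ) :
    binCoeff α (m + 1) ≤ ((m : ℝ) + 1) ^ (α - 1) / Real.Gamma α := by
  have h1 := Real.Gamma_pos_of_pos hα
  have hm : (0 : ℝ) < m + 1 := by positivity
  have h := Real.Gamma_add_le_rpow_mul hm hα hα1
  rw [Real.Gamma_nat_eq_factorial] at h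
  rw [binCoeff, Nat.factorial_succ, Real.rpow_sub_one hm.ne']
  push_cast
  rw [div_le_div_iff₀ (by positivity) h1]
  calc _ ≤ ((m + 1 : ℝ) ^ α * m.factorial) * Real.Gamma α := by gcongr
    _ = _ := by field_simp

theorem le_binCoeff (hα : 0 < α) (hα1 : α < 1) (m : ℕ) :
    ((m : ℝ) + 1) ^ (α - 1) / Real.Gamma α ≤ binCoeff α m := by
  have h1 := Real.Gamma_pos_of_pos hα
  have hm : (0 : ℝ) < m + α := by positivity
  have h := Real.rpow_le_Gamma_div_Gamma hm (sub_pos.2 hα1) (by linarith)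
  rw [neg_sub, add_add_sub_cancel, Real.Gamma_nat_eq_factorial] at h
  rw [binCoeff, mul_comm (Real.Gamma α), ← div_div]
  gcongr
  exact (Real.rpow_le_rpow_of_nonpos hm (by linarith) (by linarith)).trans h

theorem tendsto_binCoeff (hα : 0 < α) (hα1 : α < 1) : Tendsto (binCoeff α) atTop (𝓝 0) := by
  rw [← tendsto_add_atTop_iff_nat 1]
  have h : Tendsto (fun m : ℕ => ((m : ℝ) + 1) ^ (-(1 - α)) / Real.Gamma α) atTop (𝓝 0) := by
    rw [← zero_div (Real.Gamma α)]
    exact ((tendsto_rpow_neg_atTop (sub_pos.2 hα1)).comp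
      (tendsto_atTop_add_const_right _ _ tendsto_natCast_atTop_atTop)).div_const _
  refine squeeze_zero (fun m => (binCoeff_pos hα _).le) (fun m => ?_) h
  rw [neg_sub]
  exact binCoeff_le hα hα1 m

theorem summable_binCoeff_div_succ (hα : 0 < α) (hα1 : α < 1) :
    Summable fun m : ℕ => binCoeff α m / (m + 1) := by
  have h (m : ℕ) : (1 - α) * (binCoeff α m / (m + 1)) = binCoeff α m - binCoeff α (m + 1) := by
    have := binCoeff_succ hα m
    field_simp
    linear_combination this
  have h1 : 0 < 1 - α := by linarith
  rw [← summable_mul_left_iff h1.ne']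
  refine summable_of_sum_range_le (c := binCoeff α 0) (fun m => ?_) fun N => ?_
  · have := binCoeff_pos hα m
    positivity
  · rw [Finset.sum_congr rfl fun m _ => h m, Finset.sum_range_sub']
    linarith [binCoeff_pos hα N]

/-- `x` keeps distance at least `1/2` from the natural numbers. -/
def FarFromNat (x : ℝ) : Prop := ∀ m : ℕ, 1 / 2 ≤ |x - m|

theorem farFromNat_half_int (n : ℤ) : FarFromNat (n + 1 / 2) := by
  intro m
  rcases le_or_gt (m : ℤ) n with h | h
  · have : (m : ℝ) ≤ n := by exact_mod_cast h
    exact le_abs.2 (Or.inl (by linarith))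
  · have : (n : ℝ) + 1 ≤ m := by exact_mod_cast h
    exact le_abs.2 (Or.inr (by linarith))

theorem summable_binCoeff_div (hα : 0 < α) (hα1 : α < 1) {x : ℝ} (hx : FarFromNat x) :
    Summable fun m : ℕ => binCoeff α m / (x - m) := by
  refine Summable.of_norm_bounded ((summable_binCoeff_div_succ hα hα1).mul_left (3 + 2 * |x|))
    fun m => ?_
  have hc := binCoeff_pos hα m
  have h := hx m
  have h0 : 0 < |x - m| := by linarith
  rw [norm_div, Real.norm_of_nonneg hc.le, Real.norm_eq_abs, mul_div_left_comm]
  rw [div_le_iff₀ h0, mul_assoc]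
  have h3 : (m : ℝ) ≤ |x| + |x - m| := by
    have := neg_abs_le (x - m)
    have := le_abs_self x
    linarith
  have h4 : 1 ≤ (3 + 2 * |x|) / (m + 1) * |x - m| := by
    rw [div_mul_eq_mul_div, one_le_div (by positivity)]
    nlinarith [abs_nonneg x]
  nlinarith

/-- The Cauchy-type sum of the coefficients `binCoeff α`. -/
def binSum (α x : ℝ) : ℝ := ∑' m : ℕ, binCoeff α m / (x - m)

theorem hasSum_binSum (hα : 0 < α) (hα1 : α < 1) {x : ℝ} (hx : FarFromNat x) :
    HasSum (fun m : ℕ => binCoeff α m / (x - m)) (binSum α x) :=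
  (summable_binCoeff_div hα hα1 hx).hasSum

theorem binSum_succ (hα : 0 < α) (hα1 : α < 1) {x : ℝ} (hx : FarFromNat x)
    (hx1 : FarFromNat (x + 1)) : (x + 1) * binSum α (x + 1) = (x + α) * binSum α x := by
  have h := ((hasSum_binSum hα hα1 hx1).mul_left (x + 1)).sub
    ((hasSum_binSum hα hα1 hx).mul_left (x + α))
  have key (y : ℝ) (hy : FarFromNat y) (m : ℕ) : y - m ≠ 0 := fun h => by
    have := hy m
    rw [h, abs_zero] at this
    norm_num at this
  set d : ℕ → ℝ := fun m => m * binCoeff α m / (x + 1 - m) with hd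
  have hterm (m : ℕ) : (x + 1) * (binCoeff α m / (x + 1 - m)) - (x + α) * (binCoeff α m / (x - m)) =
      d m - d (m + 1) := by
    have h1 := key _ hx1 m
    have h2 := key _ hx m
    have h3 := binCoeff_succ hα m
    simp only [hd]
    push_cast
    rw [h3, show x + 1 - ((m : ℝ) + 1) = x - m by ring]
    field_simp
    ring
  have hd0 : Tendsto d atTop (𝓝 0) := by
    have h1 : Tendsto (fun m : ℕ => (x + 1) * (binCoeff α m / (x + 1 - m)) - binCoeff α m) atTop
        (𝓝 ((x + 1) * 0 - 0)) :=
      ((summable_binCoeff_div hα hα1 hx1).tendsto_atTop_zero.const_mul _).sub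
        (tendsto_binCoeff hα hα1)
    rw [mul_zero, sub_zero] at h1
    refine h1.congr fun m => ?_
    have h1 := key _ hx1 m
    simp only [hd]
    field_simp
    ring
  have h2 := h.tendsto_sum_nat
  simp only [hterm, Finset.sum_range_sub'] at h2
  have h3 : Tendsto (fun n => d 0 - d n) atTop (𝓝 (d 0 - 0)) := tendsto_const_nhds.sub hd0
  have := tendsto_nhds_unique h2 h3
  simp only [hd, Nat.cast_zero, zero_mul, zero_div, sub_zero] at this
  linarith

theorem binCoeff_eq_choose (hα : 0 < α) (m : ℕ) :
    binCoeff α m = Ring.choose (α + m - 1) m := by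
  rw [← Ring.multichoose_eq]
  induction m with
  | zero => simp [binCoeff_zero hα]
  | succ m ih =>
    have h1 := Ring.factorial_nsmul_multichoose_eq_ascPochhammer α (m + 1)
    have h2 := Ring.factorial_nsmul_multichoose_eq_ascPochhammer α m
    rw [ascPochhammer_succ_right, Polynomial.smeval_mul, ← h2, ← ih] at h1
    have h3 : Polynomial.smeval (Polynomial.X + (m : Polynomial ℕ)) α = α + m := by
      simp [Polynomial.smeval_add, Polynomial.smeval_X, Polynomial.smeval_natCast]
    rw [h3, Nat.factorial_succ, nsmul_eq_mul, nsmul_eq_mul] at h1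
    push_cast at h1
    have h4 := binCoeff_succ hα m
    have h5 : (m.factorial : ℝ) ≠ 0 := by positivity
    have h6 : (m : ℝ) + 1 ≠ 0 := by positivity
    refine mul_left_cancel₀ (mul_ne_zero h5 h6) ?_
    linear_combination m.factorial * h4 - h1

theorem hasSum_binCoeff (hα : 0 < α) {t : ℝ} (h0 : 0 < t) (h1 : t < 1) :
    HasSum (fun m : ℕ => binCoeff α m * t ^ m) ((1 - t) ^ (-α)) := by
  have h := (Real.one_div_one_sub_rpow_hasFPowerSeriesOnBall_zero α).hasSum (y := t) (by
    rw [Metric.mem_eball, edist_zero_right, Real.enorm_eq_ofReal h0.le]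
    simpa using h1)
  rw [zero_add, one_div, ← Real.rpow_neg (by linarith)] at h
  refine h.congr_fun fun m => ?_
  rw [binCoeff_eq_choose hα, FormalMultilinearSeries.ofScalars_apply_eq, smul_eq_mul]

theorem integral_beta {x y : ℝ} (hx : 0 < x) (hy : 0 < y) :
    ∫ t in Set.Ioc (0 : ℝ) 1, t ^ (x - 1) * (1 - t) ^ (y - 1) =
      Real.Gamma x * Real.Gamma y / Real.Gamma (x + y) := by
  have h := ProbabilityTheory.beta_eq_betaIntegralReal x y hx hy
  rw [ProbabilityTheory.beta] at h
  rw [h, Complex.betaIntegral, intervalIntegral.integral_of_le zero_le_one,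
    ← RCLike.re_to_complex, ← integral_re]
  · refine setIntegral_congr_fun measurableSet_Ioc fun t ht => ?_
    norm_cast
    rw [← Complex.ofReal_cpow ht.1.le, ← Complex.ofReal_cpow (by linarith [ht.2]),
      RCLike.re_to_complex, Complex.re_mul_ofReal, Complex.ofReal_re]
  · have := Complex.betaIntegral_convergent (u := x) (v := y) (by simpa) (by simpa)
    rwa [intervalIntegrable_iff_integrableOn_Ioc_of_le (by simp), IntegrableOn] at this

theorem integral_rpow_Ioc {r : ℝ} (hr : -1 < r) : ∫ t in Set.Ioc (0 : ℝ) 1, t ^ r = 1 / (r + 1) := by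
  rw [← intervalIntegral.integral_of_le zero_le_one, integral_rpow (Or.inl hr), Real.one_rpow,
    Real.zero_rpow (by linarith), sub_zero]

theorem integrableOn_rpow_Ioc {r : ℝ} (hr : -1 < r) :
    IntegrableOn (fun t : ℝ => t ^ r) (Set.Ioc 0 1) := by
  rw [← intervalIntegrable_iff_integrableOn_Ioc_of_le zero_le_one]
  exact intervalIntegral.intervalIntegrable_rpow' hr

theorem binSum_neg (hα : 0 < α) (hα1 : α < 1) {x : ℝ} (hx : 1 / 2 ≤ x) :
    -binSum α (-x) = Real.Gamma x * Real.Gamma (1 - α) / Real.Gamma (x + (1 - α)) := by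
  have hx0 : 0 < x := by linarith
  have hfar : FarFromNat (-x) := fun m => by
    have : (0 : ℝ) ≤ m := by positivity
    exact le_abs.2 (Or.inr (by linarith))
  have hr (m : ℕ) : -1 < m + x - 1 := by
    have : (0 : ℝ) ≤ m := by positivity
    linarith
  have hint (m : ℕ) : ∫ t in Set.Ioc (0 : ℝ) 1, binCoeff α m * t ^ (m + x - 1) =
      -(binCoeff α m / (-x - m)) := by
    rw [integral_const_mul, integral_rpow_Ioc (hr m), ← div_neg]
    ring_nf
  have hS := (hasSum_binSum hα hα1 hfar).neg
  have h := hasSum_integral_of_summable_integral_norm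
    (F := fun (m : ℕ) (t : ℝ) => binCoeff α m * t ^ (m + x - 1))
    (μ := volume.restrict (Set.Ioc (0 : ℝ) 1))
    (fun m => (integrableOn_rpow_Ioc (hr m)).const_mul _) (by
      refine hS.summable.congr fun m => ?_
      rw [← hint]
      refine setIntegral_congr_fun measurableSet_Ioc fun t ht => ?_
      have := ht.1
      exact (Real.norm_of_nonneg (mul_nonneg (binCoeff_pos hα m).le (by positivity))).symm)
  simp only [hint] at h
  rw [hS.unique h, ← integral_beta hx0 (sub_pos.2 hα1), integral_Ioc_eq_integral_Ioo,
    integral_Ioc_eq_integral_Ioo]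
  refine setIntegral_congr_fun measurableSet_Ioo fun t ht => ?_
  have e (m : ℕ) : binCoeff α m * t ^ (m + x - 1) = t ^ (x - 1) * (binCoeff α m * t ^ m) := by
    rw [show (m : ℝ) + x - 1 = x - 1 + m by ring, Real.rpow_add ht.1, Real.rpow_natCast]
    ring
  simp only [e]
  rw [tsum_mul_left, (hasSum_binCoeff hα ht.1 ht.2).tsum_eq]
  ring_nf

theorem binSum_mul_Gamma (hα : 0 < α) (hα1 : α < 1 / 2) (n : ℕ) :
    binSum α (n + 1 / 2) * Real.Gamma (n + 1 / 2 + 1) =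
      Real.Gamma (1 - α) * Real.cos (Real.pi * α) * Real.Gamma (n + 1 / 2 + α) := by
  have hα2 : α < 1 := by linarith
  have hfar (n : ℕ) : FarFromNat (n + 1 / 2) := by simpa using farFromNat_half_int n
  induction n with
  | zero =>
    have h1 := binSum_neg hα hα2 (le_refl (1 / 2))
    have h2 := binSum_succ hα hα2 (x := -1 / 2) (by convert farFromNat_half_int (-1) using 1; norm_num)
      (by convert hfar 0 using 1; norm_num)
    have hG := Real.Gamma_mul_Gamma_one_sub (1 / 2 + α)
    have h3 : (1 / 2 : ℝ) - α ≠ 0 := by linarith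
    have hc : 0 < Real.cos (Real.pi * α) :=
      Real.cos_pos_of_mem_Ioo ⟨by nlinarith [Real.pi_pos], by nlinarith [Real.pi_pos]⟩
    rw [show Real.pi * (1 / 2 + α) = Real.pi * α + Real.pi / 2 by ring, Real.sin_add_pi_div_two,
      show 1 - (1 / 2 + α) = 1 / 2 - α by ring, eq_div_iff hc.ne'] at hG
    rw [show (1 / 2 : ℝ) + (1 - α) = (1 / 2 - α) + 1 by ring, Real.Gamma_add_one h3,
      Real.Gamma_one_half_eq] at h1
    rw [show (-1 / 2 : ℝ) + 1 = 1 / 2 by norm_num, neg_div] at h2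
    have h4 : Real.Gamma (1 / 2 - α) ≠ 0 := (Real.Gamma_pos_of_pos (by linarith)).ne'
    rw [eq_div_iff (mul_ne_zero h3 h4)] at h1
    rw [Nat.cast_zero, zero_add, Real.Gamma_add_one (by norm_num), Real.Gamma_one_half_eq]
    have hpi := Real.mul_self_sqrt Real.pi_pos.le
    refine mul_left_cancel₀ h4 ?_
    linear_combination √Real.pi * Real.Gamma (1 / 2 - α) * h2 + √Real.pi * h1
      - Real.Gamma (1 - α) * hG + Real.Gamma (1 - α) * hpi
  | succ n ih =>
    have h := binSum_succ hα hα2 (hfar n)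
      (by simpa [add_right_comm] using hfar (n + 1))
    have h1 : (n : ℝ) + 1 / 2 + 1 ≠ 0 := by positivity
    have h2 : (n : ℝ) + 1 / 2 + α ≠ 0 := by positivity
    push_cast
    rw [add_right_comm (n : ℝ) 1 (1 / 2), Real.Gamma_add_one h1,
      add_right_comm _ 1 α, Real.Gamma_add_one h2]
    linear_combination Real.Gamma (n + 1 / 2 + 1) * h + (n + 1 / 2 + α) * ih

theorem binSum_sub_binSum_neg_ge (hα : 0 < α) (hα1 : α < 1 / 2) (n : ℕ) :
    Real.Gamma (1 - α) * (1 + Real.cos (Real.pi * α)) * ((n : ℝ) + 1) ^ (α - 1) ≤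
      binSum α (n + 1 / 2) - binSum α (-(n + 1 / 2)) := by
  have hn : (0 : ℝ) ≤ n := by positivity
  have hx : (0 : ℝ) < n + 1 / 2 := by positivity
  have hxα : (0 : ℝ) < n + 1 / 2 + α := by positivity
  have hG : 0 < Real.Gamma (1 - α) := Real.Gamma_pos_of_pos (by linarith)
  have hc : 0 < Real.cos (Real.pi * α) :=
    Real.cos_pos_of_mem_Ioo ⟨by nlinarith [Real.pi_pos], by nlinarith [Real.pi_pos]⟩
  have h1 := binSum_neg hα (by linarith) (show (1 : ℝ) / 2 ≤ n + 1 / 2 by linarith)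
  have h2 := binSum_mul_Gamma hα hα1 n
  rw [← eq_div_iff (Real.Gamma_pos_of_pos (by positivity)).ne'] at h2
  have h3 := Real.rpow_le_Gamma_div_Gamma hx (show 0 < 1 - α by linarith) (by linarith)
  have h4 := Real.rpow_le_Gamma_div_Gamma hxα (show 0 < 1 - α by linarith) (by linarith)
  rw [neg_sub, add_add_sub_cancel] at h4
  rw [neg_sub] at h3
  have h5 : ((n : ℝ) + 1) ^ (α - 1) ≤ (n + 1 / 2 : ℝ) ^ (α - 1) :=
    Real.rpow_le_rpow_of_nonpos hx (by linarith) (by linarith)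
  have h6 : ((n : ℝ) + 1) ^ (α - 1) ≤ (n + 1 / 2 + α : ℝ) ^ (α - 1) :=
    Real.rpow_le_rpow_of_nonpos hxα (by linarith) (by linarith)
  rw [sub_eq_add_neg (binSum _ _), h1, h2, mul_comm (Real.Gamma (n + 1 / 2)), mul_div_assoc, mul_div_assoc]
  calc _ = Real.Gamma (1 - α) * Real.cos (Real.pi * α) * ((n : ℝ) + 1) ^ (α - 1) +
        Real.Gamma (1 - α) * ((n : ℝ) + 1) ^ (α - 1) := by ring
    _ ≤ _ := by
      gcongr
      · exact h6.trans h4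
      · exact h5.trans h3

end

end

section

open Filter Topology

section
variable {α : ℝ}

/-- The coefficients `binCoeff α`, extended by zero to the negative integers. -/
def binCoeffZ (α : ℝ) (k : ℤ) : ℝ := if 0 ≤ k then binCoeff α k.toNat else 0

/-- The near-extremal sequence: the symmetrisation of `binCoeffZ`. -/
def testSeq (α : ℝ) (k : ℤ) : ℂ := ((binCoeffZ α k + binCoeffZ α (-k) : ℝ) : ℂ)

theorem binCoeffZ_natCast (m : ℕ) : binCoeffZ α m = binCoeff α m := by
  simp [binCoeffZ]

theorem binCoeffZ_of_neg {k : ℤ} (hk : k < 0) : binCoeffZ α k = 0 := by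
  simp [binCoeffZ, hk]

theorem hasSum_binCoeffZ (hα : 0 < α) (hα1 : α < 1) {x : ℝ} (hx : FarFromNat x) :
    HasSum (fun k : ℤ => binCoeffZ α k / (x - k)) (binSum α x) := by
  rw [← (Nat.cast_injective (R := ℤ)).hasSum_iff]
  · simpa [Function.comp_def, binCoeffZ_natCast] using hasSum_binSum hα hα1 hx
  · intro k hk
    have : k < 0 := by
      by_contra! h
      exact hk ⟨k.toNat, by simpa using h⟩
    rw [binCoeffZ_of_neg this, zero_div]

theorem RT_testSeq (hα : 0 < α) (hα1 : α < 1) (n : ℤ) :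
    RT (testSeq α) n =
      ((1 / Real.pi * (binSum α (n + 1 / 2) - binSum α (-(n + 1 / 2))) : ℝ) : ℂ) := by
  have h1 := hasSum_binCoeffZ hα hα1 (farFromNat_half_int n)
  have h2 := hasSum_binCoeffZ hα hα1 (x := -((n : ℝ) + 1 / 2)) (by
    convert farFromNat_half_int (-n - 1) using 1
    push_cast
    ring)
  rw [← (Equiv.neg ℤ).hasSum_iff] at h2
  have h := ((h1.sub h2).mul_left (1 / Real.pi)).tsum_eq
  rw [RT_eq_tsum, ← h, Complex.ofReal_tsum]
  refine tsum_congr fun k => ?_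
  rw [testSeq, ← Complex.ofReal_mul]
  congr 1
  simp only [Function.comp_apply, Equiv.neg_apply]
  push_cast
  rw [show -((n : ℝ) + 1 / 2) - -(k : ℝ) = -((n : ℝ) - k + 1 / 2) by ring,
    show (n : ℝ) + 1 / 2 - k = (n : ℝ) - k + 1 / 2 by ring, div_neg]
  ring

theorem cot_half_mul_Gamma (hα : 0 < α) (hα1 : α < 1) :
    Real.cot (Real.pi * α / 2) / Real.Gamma α =
      1 / Real.pi * (Real.Gamma (1 - α) * (1 + Real.cos (Real.pi * α))) := by
  have hpi := Real.pi_pos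
  have hG := Real.Gamma_mul_Gamma_one_sub α
  have hs : 0 < Real.sin (Real.pi * α / 2) :=
    Real.sin_pos_of_pos_of_lt_pi (by positivity) (by nlinarith)
  have hc : 0 < Real.cos (Real.pi * α / 2) :=
    Real.cos_pos_of_mem_Ioo ⟨by nlinarith, by nlinarith⟩
  have hΓ := (Real.Gamma_pos_of_pos hα).ne'
  have e : Real.pi * α = 2 * (Real.pi * α / 2) := by ring
  rw [Real.cot_eq_cos_div_sin]
  rw [e, Real.sin_two_mul, eq_div_iff (by positivity)] at hG
  rw [e, Real.cos_two_mul, ← e]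
  field_simp
  linear_combination -hG * Real.cos (Real.pi * α / 2)

theorem le_norm_RT_testSeq (hα : 0 < α) (hα1 : α < 1 / 2) (n : ℕ) :
    Real.cot (Real.pi * α / 2) * binCoeff α (n + 1) ≤ ‖RT (testSeq α) n‖ := by
  have hpi := Real.pi_pos
  have hcot : 0 ≤ Real.cot (Real.pi * α / 2) := by
    rw [Real.cot_eq_cos_div_sin]
    exact div_nonneg (Real.cos_nonneg_of_neg_pi_div_two_le_of_le (by nlinarith) (by nlinarith))
      (Real.sin_nonneg_of_nonneg_of_le_pi (by positivity) (by nlinarith))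
  rw [RT_testSeq hα (by linarith), Complex.norm_real, Real.norm_eq_abs, Int.cast_natCast]
  refine le_trans ?_ (le_abs_self _)
  calc _ ≤ Real.cot (Real.pi * α / 2) * (((n : ℝ) + 1) ^ (α - 1) / Real.Gamma α) := by
        gcongr
        exact binCoeff_le hα (by linarith) n
    _ = 1 / Real.pi * (Real.Gamma (1 - α) * (1 + Real.cos (Real.pi * α)) *
        ((n : ℝ) + 1) ^ (α - 1)) := by
        rw [mul_div_left_comm, cot_half_mul_Gamma hα (by linarith)]
        ring
    _ ≤ _ := by
        gcongr
        exact binSum_sub_binSum_neg_ge hα hα1 n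

theorem norm_RT_testSeq_neg (hα : 0 < α) (hα1 : α < 1) (n : ℕ) :
    ‖RT (testSeq α) (-(n + 1 : ℤ))‖ = ‖RT (testSeq α) n‖ := by
  rw [RT_testSeq hα hα1, RT_testSeq hα hα1, ← norm_neg, ← Complex.ofReal_neg]
  congr 3
  push_cast
  rw [show -((n : ℝ) + 1) + 1 / 2 = -(n + 1 / 2) by ring, neg_neg]
  ring

theorem norm_testSeq_succ (hα : 0 < α) (n : ℕ) :
    ‖testSeq α ((n + 1 : ℕ) : ℤ)‖ = binCoeff α (n + 1) := by
  rw [testSeq, binCoeffZ_natCast, binCoeffZ_of_neg (by omega), add_zero, Complex.norm_real,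
    Real.norm_of_nonneg (binCoeff_pos hα _).le]

theorem norm_testSeq_neg (k : ℤ) : ‖testSeq α (-k)‖ = ‖testSeq α k‖ := by
  rw [testSeq, testSeq, neg_neg, add_comm]

theorem norm_testSeq_zero (hα : 0 < α) : ‖testSeq α 0‖ = 2 := by
  have h := binCoeffZ_natCast (α := α) 0
  rw [binCoeff_zero hα, Nat.cast_zero] at h
  rw [testSeq, neg_zero, h]
  norm_num

theorem summable_binCoeff_rpow (hα : 0 < α) {q : ℝ} (hq : 1 < (1 - α) * q) (hq0 : 0 < q) :
    Summable fun n : ℕ => binCoeff α (n + 1) ^ q := by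
  have hα1 : α < 1 := by
    by_contra! h
    nlinarith
  have hG := Real.Gamma_pos_of_pos hα
  have h := (summable_nat_add_iff 1).2 (Real.summable_nat_rpow.2 (show -((1 - α) * q) < -1 by linarith))
  refine Summable.of_nonneg_of_le (fun n => Real.rpow_nonneg (binCoeff_pos hα _).le _) (fun n => ?_)
    (h.mul_right ((Real.Gamma α ^ q)⁻¹))
  refine (Real.rpow_le_rpow (binCoeff_pos hα _).le (binCoeff_le hα hα1 n) hq0.le).trans_eq ?_
  rw [Real.div_rpow (by positivity) hG.le, ← Real.rpow_mul (by positivity), div_eq_mul_inv]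
  push_cast
  ring_nf

theorem hasSum_testSeq (hα : 0 < α) {q : ℝ} (hq : 1 < (1 - α) * q) (hq0 : 0 < q) :
    HasSum (fun k : ℤ => ‖testSeq α k‖ ^ q)
      (2 ^ q + 2 * ∑' n : ℕ, binCoeff α (n + 1) ^ q) := by
  have h := (summable_binCoeff_rpow hα hq hq0).hasSum
  have h1 : HasSum (fun n : ℕ => ‖testSeq α n‖ ^ q)
      (∑' n : ℕ, binCoeff α (n + 1) ^ q + 2 ^ q) := by
    rw [← hasSum_nat_add_iff' 1]
    simpa only [norm_testSeq_succ hα, Finset.sum_range_one, Nat.cast_zero, norm_testSeq_zero hα,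
      add_sub_cancel_right] using h
  have h2 : HasSum (fun n : ℕ => ‖testSeq α (-(n + 1 : ℤ))‖ ^ q)
      (∑' n : ℕ, binCoeff α (n + 1) ^ q) := by
    refine h.congr_fun fun n => ?_
    rw [norm_testSeq_neg, ← norm_testSeq_succ hα]
    push_cast
    rfl
  rw [show ∀ x y : ℝ, x + 2 * y = y + x + y by intros; ring]
  exact HasSum.of_nat_of_neg_add_one (f := fun k : ℤ => ‖testSeq α k‖ ^ q) h1 h2

theorem FiniteBound.sum_binCoeff_le {q C K : ℝ} (h : FiniteBound q C) (hα : 0 < α)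
    (hα1 : α < 1 / 2) (hq : 1 < (1 - α) * q) (hq0 : 0 < q) (hC : 0 ≤ C) (hCK : C < K)
    (hK : K ≤ Real.cot (Real.pi * α / 2)) (N : ℕ) :
    ∑ n ∈ Finset.range N, binCoeff α (n + 1) ^ q ≤ C ^ q * 2 ^ q / (2 * (K ^ q - C ^ q)) := by
  have hs := hasSum_testSeq hα hq hq0
  have hsum := summable_binCoeff_rpow hα hq hq0
  set X := ∑' n : ℕ, binCoeff α (n + 1) ^ q with hX
  have hb := h.tsum_RT_le hq0 hC hs.summable
  have hm := h.memLpZ_RT hq0 hC hs.summable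
  rw [hs.tsum_eq] at hb
  have h1 : Summable fun n : ℕ => ‖RT (testSeq α) n‖ ^ q :=
    hm.comp_injective (Nat.cast_injective (R := ℤ))
  have h2 : HasSum (fun n : ℕ => ‖RT (testSeq α) (-(n + 1 : ℤ))‖ ^ q)
      (∑' n : ℕ, ‖RT (testSeq α) n‖ ^ q) := by
    simpa only [norm_RT_testSeq_neg hα (show α < 1 by linarith)] using h1.hasSum
  rw [(HasSum.of_nat_of_neg_add_one (f := fun k : ℤ => ‖RT (testSeq α) k‖ ^ q) h1.hasSum h2).tsum_eq]
    at hb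
  have h3 : K ^ q * X ≤ ∑' n : ℕ, ‖RT (testSeq α) n‖ ^ q := by
    rw [hX, ← tsum_mul_left]
    refine (hsum.mul_left _).tsum_le_tsum (fun n => ?_) h1
    have hc := (binCoeff_pos hα (n + 1)).le
    rw [← Real.mul_rpow (hC.trans hCK.le) hc]
    refine Real.rpow_le_rpow (mul_nonneg (hC.trans hCK.le) hc) ?_ hq0.le
    exact (mul_le_mul_of_nonneg_right hK hc).trans (le_norm_RT_testSeq hα hα1 n)
  have h4 : C ^ q < K ^ q := Real.rpow_lt_rpow hC hCK hq0
  refine (hsum.sum_le_tsum _ fun n _ => Real.rpow_nonneg (binCoeff_pos hα _).le _).trans ?_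
  rw [le_div_iff₀ (by linarith)]
  linarith

theorem continuousAt_binCoeff (hα : 0 < α) (m : ℕ) :
    ContinuousAt (fun α => binCoeff α m) α := by
  have hG (x : ℝ) (hx : 0 < x) : ContinuousAt Real.Gamma x :=
    (Real.differentiableAt_Gamma fun k => by
      have : (0 : ℝ) ≤ k := by positivity
      linarith).continuousAt
  have h0 := Real.Gamma_pos_of_pos hα
  refine ContinuousAt.div ?_ ((hG α hα).mul continuousAt_const) (by positivity)
  exact ContinuousAt.comp (f := fun α : ℝ => (m : ℝ) + α) (hG _ (by positivity))
    (continuousAt_const.add continuousAt_id)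

theorem FiniteBound.cot_le {p q C : ℝ} (hpq : p.HolderConjugate q) (hp : 2 ≤ p) (hC : 0 ≤ C)
    (h : FiniteBound q C) : Real.cot (Real.pi / (2 * p)) ≤ C := by
  by_contra! hlt
  have hpi := Real.pi_pos
  have hq0 := hpq.symm.pos
  have hp0 := hpq.pos
  have hβ : 0 < 1 / p := by positivity
  have hβ1 : 1 / p ≤ 1 / 2 := by gcongr
  have hinv : (1 - 1 / p) * q = 1 := by
    rw [one_div, hpq.one_sub_inv, inv_mul_cancel₀ hq0.ne']
  set D := C ^ q * 2 ^ q / (2 * (Real.cot (Real.pi / (2 * p)) ^ q - C ^ q))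
  have hle (N : ℕ) : ∑ n ∈ Finset.range N, binCoeff (1 / p) (n + 1) ^ q ≤ D := by
    have hlim : Tendsto (fun α => ∑ n ∈ Finset.range N, binCoeff α (n + 1) ^ q) (𝓝[<] (1 / p))
        (𝓝 (∑ n ∈ Finset.range N, binCoeff (1 / p) (n + 1) ^ q)) :=
      tendsto_finsetSum _ fun n _ => (((continuousAt_binCoeff hβ (n + 1)).tendsto).mono_left
        nhdsWithin_le_nhds).rpow_const (Or.inr hq0.le)
    refine le_of_tendsto hlim ?_
    filter_upwards [Ioo_mem_nhdsLT hβ] with α hα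
    refine h.sum_binCoeff_le hα.1 (by linarith [hα.2]) ?_ hq0 hC hlt ?_ N
    · refine hinv.symm.trans_lt (mul_lt_mul_of_pos_right ?_ hq0)
      linarith [hα.2]
    · have e : Real.pi / (2 * p) = Real.pi * (1 / p) / 2 := by ring
      have h1 : Real.pi * α / 2 < Real.pi * (1 / p) / 2 := by
        gcongr
        exact hα.2
      have h0 : 0 < Real.pi * α / 2 := by
        have := hα.1
        positivity
      have h2 : Real.pi * (1 / p) / 2 ≤ Real.pi / 4 := by nlinarith
      have hs0 : 0 < Real.sin (Real.pi * α / 2) :=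
        Real.sin_pos_of_pos_of_lt_pi h0 (by linarith)
      rw [e, Real.cot_eq_cos_div_sin, Real.cot_eq_cos_div_sin]
      refine div_le_div₀ (Real.cos_nonneg_of_neg_pi_div_two_le_of_le (by linarith) (by linarith))
        (Real.cos_le_cos_of_nonneg_of_le_pi h0.le (by linarith) h1.le) hs0
        (Real.sin_le_sin_of_le_of_le_pi_div_two (by linarith) (by linarith) h1.le)
  have hsum := summable_of_sum_range_le
    (fun n => Real.rpow_nonneg (binCoeff_pos hβ (n + 1)).le q) hle
  have hG := Real.Gamma_pos_of_pos hβ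
  have hge (n : ℕ) : (((n + 2 : ℕ) : ℝ))⁻¹ * (Real.Gamma (1 / p) ^ q)⁻¹ ≤
      binCoeff (1 / p) (n + 1) ^ q := by
    have h1 := Real.rpow_le_rpow (by positivity)
      (le_binCoeff hβ (by linarith) (n + 1)) hq0.le
    refine le_trans (le_of_eq ?_) h1
    rw [Real.div_rpow (by positivity) hG.le, ← Real.rpow_mul (by positivity), div_eq_mul_inv (_ ^ _),
      show (1 / p - 1) * q = -1 by linarith, Real.rpow_neg_one]
    push_cast
    ring_nf
  have hdiv := Summable.of_nonneg_of_le (fun n => by positivity) hge hsum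
  rw [summable_mul_right_iff (by positivity), summable_nat_add_iff (f := fun n : ℕ => (n : ℝ)⁻¹) 2]
    at hdiv
  exact Real.not_summable_natCast_inv hdiv
end

theorem FiniteBound.opNormOn_eq {p C : ℝ} (hp : 0 < p) (hC : 0 ≤ C) (h : FiniteBound p C)
    (hmin : ∀ C' : ℝ, 0 ≤ C' → FiniteBound p C' → C ≤ C') : opNormOn p RT = C := by
  refine IsLeast.csInf_eq ⟨⟨hC, fun a ha => h.lpNorm_RT_le hp hC ha⟩, fun C' hC' => ?_⟩
  exact hmin C' hC'.1 (finiteBound_of_lpNorm_le h hp hC hC'.1 hC'.2)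

end

/-- The ℓ^p norm of the Riesz–Titchmarsh transform for p = 2n or p = 2n/(2n-1). -/
theorem riesz_titchmarsh_sharp_norm (n : ℕ) (hn : 0 < n) (p : ℝ)
    (hp : p = 2 * (n : ℝ) ∨ p = 2 * (n : ℝ) / (2 * (n : ℝ) - 1)) :
    (∀ a : ℤ → ℂ, MemLpZ p a →
      lpNorm p (RT a) ≤ Real.cot (Real.pi / (2 * pstar p)) * lpNorm p a) ∧
    opNormOn p RT = Real.cot (Real.pi / (2 * pstar p)) := by
  have hn1 : (1 : ℝ) ≤ n := by exact_mod_cast hn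
  have hpi := Real.pi_pos
  have hconj : (2 * (n : ℝ)).HolderConjugate (2 * n / (2 * n - 1)) :=
    Real.HolderConjugate.conjExponent (by linarith)
  have hle : 2 * (n : ℝ) / (2 * n - 1) ≤ 2 * n := by
    rw [div_le_iff₀ (by linarith)]
    nlinarith
  have hstar : pstar p = 2 * n := by
    rcases hp with rfl | rfl
    · exact max_eq_left hle
    · rw [pstar, ← hconj.symm.conjugate_eq]
      exact max_eq_right hle
  have hang : Real.pi / (2 * (2 * n)) ≤ Real.pi / 4 := by gcongr; linarith
  have hang0 : 0 ≤ Real.pi / (2 * (2 * n)) := by positivity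
  have hcot : 0 ≤ Real.cot (Real.pi / (2 * (2 * n))) := by
    rw [Real.cot_eq_cos_div_sin]
    exact div_nonneg
      (Real.cos_nonneg_of_neg_pi_div_two_le_of_le (by linarith) (by linarith))
      (Real.sin_nonneg_of_nonneg_of_le_pi hang0 (by linarith))
  have hB := finiteBound_even hn
  have hB' := hB.dual hconj hcot
  rw [hstar]
  rcases hp with rfl | rfl
  · exact ⟨fun a ha => hB.lpNorm_RT_le hconj.pos hcot ha,
      hB.opNormOn_eq hconj.pos hcot fun C hC h => (h.dual hconj hC).cot_le hconj (by linarith) hC⟩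
  · exact ⟨fun a ha => hB'.lpNorm_RT_le hconj.symm.pos hcot ha,
      hB'.opNormOn_eq hconj.symm.pos hcot fun C hC h => h.cot_le hconj (by linarith) hC⟩

end
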